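/- Let n, m, n', m' be positive integers with n + m = n' + m', let μ, μ' > 0, and suppose m ≥ 2. If f is a proper holomorphic mapping of the Fock–Bargmann–Hartogs domain D_{n,m}(μ) into D_{n',m'}(μ'), then f is a biholomorphism from D_{n,m}(μ) onto D_{n',m'}(μ'). -/

import Mathlib

/-- The Fock–Bargmann–Hartogs domain
`D_{n,m}(μ) = {(z,w) ∈ ℂ^n × ℂ^m : ‖w‖² < exp (−μ‖z‖²)}`. -/
def FBH (n m : ℕ) (μ : ℝ) :
    Set (EuclideanSpace ℂ (Fin n) × EuclideanSpace ℂ (Fin m)) :=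
  {p | ‖p.2‖ ^ 2 < Real.exp (-μ * ‖p.1‖ ^ 2)}

section
open Set Filter Topology MeasureTheory Metric
namespace FBHProof

section DI
variable {E : Type*} [NormedAddCommGroup E] [NormedSpace ℂ E]
variable {G : Type*} [NormedAddCommGroup G] [NormedSpace ℂ G]
variable {α : Type*} [MeasurableSpace α] {ν : Measure α}

lemma aesm_clm [FiniteDimensional ℂ E] {T : α → E →L[ℂ] G}
    (h : ∀ v, AEStronglyMeasurable (fun a => T a v) ν) : AEStronglyMeasurable T ν := by
  let b := Module.finBasis ℂ E
  have : T = fun a => ∑ i, ContinuousLinearMap.smulRightL ℂ E G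
      (LinearMap.toContinuousLinearMap (b.coord i)) (T a (b i)) := by
    funext a
    ext x
    conv_lhs => rw [← b.sum_repr x]
    rw [map_sum]
    simp
  rw [this]
  refine Finset.aestronglyMeasurable_fun_sum _ fun i _ => ?_
  exact (ContinuousLinearMap.continuous _).comp_aestronglyMeasurable (h _)

/-- Differentiation under the integral sign for holomorphic functions. -/
theorem differentiableOn_integral [FiniteDimensional ℂ E] {U : Set E} (hU : IsOpen U)
    {F : E → α → G} {bound : α → ℝ}
    (hm : ∀ x ∈ U, AEStronglyMeasurable (F x) ν)
    (hb : ∀ᵐ a ∂ν, ∀ x ∈ U, ‖F x a‖ ≤ bound a) (hbi : Integrable bound ν)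
    (hd : ∀ᵐ a ∂ν, DifferentiableOn ℂ (fun x => F x a) U) :
    DifferentiableOn ℂ (fun x => ∫ a, F x a ∂ν) U := by
  classical
  intro x₀ hx₀
  apply DifferentiableAt.differentiableWithinAt
  obtain ⟨R, hR, hRU⟩ := Metric.isOpen_iff.1 hU x₀ hx₀
  have key := hasFDerivAt_integral_of_dominated_of_fderiv_le (𝕜 := ℂ) (μ := ν) (F := F)
    (F' := fun x a => fderiv ℂ (fun y => F y a) x) (x₀ := x₀) (s := ball x₀ (R / 2))
    (bound := fun a => (2 * bound a) / (R / 2))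
    (ball_mem_nhds _ (by positivity))
    (by filter_upwards [hU.mem_nhds hx₀] with x hx using hm x hx)
    (hbi.mono' (hm _ hx₀) (by filter_upwards [hb] with a ha using ha _ hx₀))
    ?_ ?_ ((hbi.const_mul 2).div_const _) ?_
  · exact key.differentiableAt
  · apply aesm_clm
    intro v
    refine aestronglyMeasurable_of_tendsto_ae (u := (atTop : Filter ℕ))
      (f := fun (n : ℕ) a => if x₀ + ((n : ℂ))⁻¹ • v ∈ U then
        (n : ℂ) • (F (x₀ + ((n : ℂ))⁻¹ • v) a - F x₀ a) else 0) ?_ ?_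
    · intro n
      by_cases h : x₀ + ((n : ℂ))⁻¹ • v ∈ U
      · simp only [h, if_true]
        exact ((hm _ h).sub (hm _ hx₀)).const_smul _
      · simp only [h, if_false]
        exact aestronglyMeasurable_const
    · filter_upwards [hd] with a ha
      have h1 := ((ha x₀ hx₀).differentiableAt (hU.mem_nhds hx₀)).hasFDerivAt
      have h2 := h1.lim (l := (atTop : Filter ℕ)) v (c := fun n : ℕ => (n : ℂ)) (by
        simpa using tendsto_natCast_atTop_atTop)
      refine h2.congr' ?_
      have h3 : Tendsto (fun n : ℕ => x₀ + ((n : ℂ))⁻¹ • v) atTop (𝓝 x₀) := by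
        have : Tendsto (fun n : ℕ => ((n : ℂ))⁻¹) atTop (𝓝 0) := tendsto_inv_atTop_nhds_zero_nat
        simpa using tendsto_const_nhds.add (this.smul_const v)
      filter_upwards [h3.eventually (hU.mem_nhds hx₀)] with n hn
      exact (if_pos hn).symm
  · filter_upwards [hb, hd] with a ha hda x hx
    have hsub : ball x (R / 2) ⊆ U := by
      refine Subset.trans ?_ hRU
      apply ball_subset_ball'
      rw [mem_ball] at hx; linarith
    have hxU : x ∈ U := hsub (mem_ball_self (by positivity))
    refine Complex.norm_fderiv_le_div_of_mapsTo_ball (hda.mono hsub) ?_ (by positivity)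
    intro y hy
    rw [mem_closedBall, dist_eq_norm]
    refine (norm_sub_le _ _).trans ?_
    have := ha y (hsub hy); have := ha x hxU; linarith
  · filter_upwards [hd] with a hda x hx
    have hxU : x ∈ U := hRU (ball_subset_ball (by linarith) hx)
    exact ((hda x hxU).differentiableAt (hU.mem_nhds hxU)).hasFDerivAt

lemma differentiableOn_fderiv_apply [FiniteDimensional ℂ E] [CompleteSpace G] {U : Set E}
    (hU : IsOpen U) {f : E → G} (hf : DifferentiableOn ℂ f U) (v : E) :
    DifferentiableOn ℂ (fun x => fderiv ℂ f x v) U := by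
  intro x₀ hx₀
  apply DifferentiableAt.differentiableWithinAt
  obtain ⟨R, hR, hRU⟩ := Metric.isOpen_iff.1 hU x₀ hx₀
  obtain ⟨δ, hδ, hδv⟩ : ∃ δ > 0, δ * ‖v‖ < R / 2 := by
    refine ⟨R / 2 / (‖v‖ + 1), by positivity, ?_⟩
    rw [div_mul_eq_mul_div, div_lt_iff₀ (by positivity)]
    nlinarith [norm_nonneg v]
  have hmem : ∀ x ∈ ball x₀ (R / 4), ∀ ζ : ℂ, ‖ζ‖ ≤ δ → x + ζ • v ∈ closedBall x₀ (3 * R / 4) := by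
    intro x hx ζ hζ
    rw [mem_closedBall, dist_eq_norm]
    rw [mem_ball, dist_eq_norm] at hx
    calc ‖x + ζ • v - x₀‖ = ‖(x - x₀) + ζ • v‖ := by congr 1; abel
      _ ≤ ‖x - x₀‖ + ‖ζ‖ * ‖v‖ := by rw [← norm_smul]; exact norm_add_le _ _
      _ ≤ R / 4 + R / 2 := by
        have := mul_le_mul_of_nonneg_right hζ (norm_nonneg v)
        linarith
      _ = _ := by ring
  have hcb : closedBall x₀ (3 * R / 4) ⊆ U := (closedBall_subset_ball (by linarith)).trans hRU
  have : ProperSpace E := FiniteDimensional.proper ℂ E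
  obtain ⟨M, hM⟩ := (isCompact_closedBall x₀ (3 * R / 4)).exists_bound_of_continuousOn
    (hf.continuousOn.mono hcb)
  have hline : ∀ x ∈ ball x₀ (R / 4), ∀ ζ : ℂ, ‖ζ‖ ≤ δ →
      HasDerivAt (fun ζ : ℂ => f (x + ζ • v)) (fderiv ℂ f (x + ζ • v) v) ζ := by
    intro x hx ζ hζ
    have h1 := (hf.differentiableAt (hU.mem_nhds (hcb (hmem x hx ζ hζ)))).hasFDerivAt
    have h2 : HasDerivAt (fun ζ : ℂ => x + ζ • v) v ζ := by
      simpa using ((hasDerivAt_id ζ).smul_const v).const_add x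
    exact h1.comp_hasDerivAt ζ h2
  have hcauchy : ∀ x ∈ ball x₀ (R / 4), fderiv ℂ f x v = (2 * Real.pi * Complex.I : ℂ)⁻¹ •
      ∮ z in C(0, δ), (1 / (z - 0) ^ 2) • f (x + z • v) := by
    intro x hx
    have h1 : DifferentiableOn ℂ (fun ζ : ℂ => f (x + ζ • v)) (closedBall 0 δ) := by
      intro ζ hζ
      exact (hline x hx ζ (by simpa using hζ)).differentiableAt.differentiableWithinAt
    have h2 := h1.deriv_eq_smul_circleIntegral hδ
    rw [(hline x hx 0 (by simpa using hδ.le)).deriv] at h2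
    rw [h2, smul_smul, inv_mul_cancel₀ Complex.two_pi_I_ne_zero, one_smul]
    simp
  have hD : DifferentiableOn ℂ (fun x => ∮ z in C(0, δ), (1 / (z - 0) ^ 2) • f (x + z • v))
      (ball x₀ (R / 4)) := by
    unfold circleIntegral
    simp only [intervalIntegral.integral_of_le Real.two_pi_pos.le]
    have hz : ∀ θ, ‖circleMap 0 δ θ‖ = δ := by
      intro θ; simp [abs_of_pos hδ]
    refine differentiableOn_integral isOpen_ball (bound := fun _ => δ * ((1 / δ ^ 2) * M)) ?_ ?_ ?_ ?_
    · intro x hx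
      apply ContinuousOn.aestronglyMeasurable _ measurableSet_Ioc
      have hc : Continuous (fun θ : ℝ => f (x + circleMap 0 δ θ • v)) := by
        rw [continuous_iff_continuousAt]
        intro θ
        have := (hline x hx _ (hz θ).le).continuousAt
        exact ContinuousAt.comp (f := circleMap 0 δ) this (continuous_circleMap 0 δ).continuousAt
      apply Continuous.continuousOn
      simp only [deriv_circleMap]
      refine Continuous.smul (by fun_prop) (Continuous.smul ?_ hc)
      refine Continuous.div continuous_const (by fun_prop) ?_
      intro θ h
      have := hz θ
      simp only [sub_zero, pow_eq_zero_iff, ne_eq, OfNat.ofNat_ne_zero, not_false_eq_true] at h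
      rw [h] at this; simp at this; linarith
    · refine Eventually.of_forall fun θ x hx => ?_
      rw [norm_smul, norm_smul, deriv_circleMap]
      have h1 := hM _ (hmem x hx _ (hz θ).le)
      have h0 : 0 ≤ M := (norm_nonneg _).trans h1
      simp only [norm_mul, norm_div, norm_pow, sub_zero, hz, norm_one, Complex.norm_I, mul_one]
      gcongr
    · exact integrable_const _
    · refine Eventually.of_forall fun θ x hx => ?_
      apply DifferentiableAt.differentiableWithinAt
      refine DifferentiableAt.const_smul (DifferentiableAt.const_smul ?_ _) _
      have := (hf.differentiableAt (hU.mem_nhds (hcb (hmem x hx _ (hz θ).le))))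
      exact DifferentiableAt.comp (f := fun x => x + circleMap 0 δ θ • v) x this (by fun_prop)
  have hD2 : DifferentiableAt ℂ (fun x => (2 * Real.pi * Complex.I : ℂ)⁻¹ •
      ∮ z in C(0, δ), (1 / (z - 0) ^ 2) • f (x + z • v)) x₀ :=
    ((hD x₀ (mem_ball_self (by positivity))).differentiableAt
      (ball_mem_nhds _ (by positivity))).const_smul _
  refine hD2.congr_of_eventuallyEq ?_
  filter_upwards [ball_mem_nhds x₀ (show 0 < R / 4 by positivity)] with x hx using hcauchy x hx

lemma contDiffOn_of_hol [FiniteDimensional ℂ E] [CompleteSpace G] {U : Set E}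
    (hU : IsOpen U) (k : ℕ) : ∀ {f : E → G} (_ : DifferentiableOn ℂ f U), ContDiffOn ℂ k f U := by
  induction k with
  | zero => intro f hf; simpa using hf.continuousOn
  | succ k ih =>
    intro f hf
    rw [Nat.cast_succ]
    refine contDiffOn_succ_of_fderiv_apply hf (by simp) ?_
    intro y
    refine (ih (differentiableOn_fderiv_apply hU hf y)).congr ?_
    intro x hx
    rw [fderivWithin_of_isOpen hU hx]

end DI
end FBHProof
end

section
open Set Filter Topology MeasureTheory Metric
open scoped Nat
namespace FBHProof

section IT
variable {E : Type*} [NormedAddCommGroup E] [NormedSpace ℂ E]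
variable {G : Type*} [NormedAddCommGroup G] [NormedSpace ℂ G] [CompleteSpace G]

lemma hol_zero_line {U : Set E} (hU : IsOpen U) (hc : Convex ℝ U) {u : E → G}
    (hu : DifferentiableOn ℂ u U) {y : E} (hy : y ∈ U) (h0 : u =ᶠ[𝓝 y] 0) : EqOn u 0 U := by
  intro z hz
  let L : ℂ → E := fun ζ => y + ζ • (z - y)
  have hL : Continuous L := by fun_prop
  have hT : IsOpen (L ⁻¹' U) := hU.preimage hL
  have hTc : Convex ℝ (L ⁻¹' U) := by
    intro a ha b hb s t hs ht hst
    have := hc ha hb hs ht hst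
    simp only [mem_preimage]
    convert this using 1
    simp only [L]
    have h1 : ((s : ℂ) + t) = 1 := by exact_mod_cast hst
    have e1 : s • (y + a • (z - y)) = (s : ℂ) • (y + a • (z - y)) := rfl
    have e2 : t • (y + b • (z - y)) = (t : ℂ) • (y + b • (z - y)) := rfl
    rw [e1, e2, smul_add, smul_add, smul_smul, smul_smul, Complex.real_smul, Complex.real_smul]
    rw [add_smul]
    generalize z - y = w
    conv_lhs => rw [← one_smul ℂ y, ← h1, add_smul]
    abel
  have hd : DifferentiableOn ℂ (u ∘ L) (L ⁻¹' U) := by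
    refine hu.comp ?_ (fun _ h => h)
    exact (Differentiable.differentiableOn (by fun_prop))
  have ha := hd.analyticOnNhd hT
  have h0T : (0 : ℂ) ∈ L ⁻¹' U := by simpa [L] using hy
  have h1T : (1 : ℂ) ∈ L ⁻¹' U := by simpa [L] using hz
  have he : (u ∘ L) =ᶠ[𝓝 0] 0 := by
    have : Tendsto L (𝓝 0) (𝓝 y) := by
      have := hL.tendsto 0; simpa [L] using this
    exact this.eventually h0
  have := ha.eqOn_zero_of_preconnected_of_eventuallyEq_zero hTc.isPreconnected h0T he h1T
  simpa [L] using this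

/-- Identity theorem. -/
theorem hol_identity {U : Set E} (hU : IsOpen U) (hc : IsPreconnected U) {u : E → G}
    (hu : DifferentiableOn ℂ u U) {y : E} (hy : y ∈ U) (h0 : u =ᶠ[𝓝 y] 0) : EqOn u 0 U := by
  let S : Set E := {x | u =ᶠ[𝓝 x] 0}
  have hS : IsOpen S := isOpen_setOfPred_eventually_nhds
  have := hc.subset_of_closure_inter_subset hS ⟨y, hy, h0⟩ ?_
  · intro x hx
    exact (this hx).self_of_nhds
  · rintro x ⟨hx, hxU⟩
    obtain ⟨r, hr, hrU⟩ := Metric.isOpen_iff.1 hU x hxU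
    obtain ⟨z, hz, hzx⟩ := Metric.mem_closure_iff.1 hx r hr
    have hzb : z ∈ ball x r := by rwa [mem_ball, dist_comm]
    have := hol_zero_line isOpen_ball (convex_ball x r) (hu.mono hrU) hzb hz
    exact eventually_of_mem (ball_mem_nhds x hr) this
end IT

section hom
variable {E : Type*} [NormedAddCommGroup E] [NormedSpace ℂ E]

/-- Complete circular open set. -/
structure CC (Ω : Set E) : Prop where
  isOpen : IsOpen Ω
  zero : (0 : E) ∈ Ω
  smul : ∀ x ∈ Ω, ∀ ζ : ℂ, ‖ζ‖ ≤ 1 → ζ • x ∈ Ω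

/-- homogeneous part -/
noncomputable def hp (k : ℕ) (u : E → ℂ) (x : E) : ℂ :=
  iteratedDeriv k (fun ζ : ℂ => u (ζ • x)) 0 / (k ! : ℂ)

lemma iteratedDeriv_scale (k : ℕ) (g : ℂ → ℂ) (c : ℂ) :
    iteratedDeriv k (fun ζ => g (c * ζ)) = fun ζ => c ^ k * iteratedDeriv k g (c * ζ) := by
  induction k with
  | zero => simp
  | succ k ih =>
    rw [iteratedDeriv_succ, ih]
    funext ζ
    have h1 := deriv_comp_mul_left c (iteratedDeriv k g) ζ
    have h2 : deriv (fun ζ => c ^ k * iteratedDeriv k g (c * ζ)) ζ =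
        c ^ k * deriv (fun ζ => iteratedDeriv k g (c * ζ)) ζ := deriv_const_mul_field _
    rw [h2, h1, iteratedDeriv_succ, smul_eq_mul]
    ring

lemma hp_smul (k : ℕ) (u : E → ℂ) (c : ℂ) (x : E) : hp k u (c • x) = c ^ k * hp k u x := by
  have := congrFun (iteratedDeriv_scale k (fun ζ => u (ζ • x)) c) 0
  unfold hp
  simp only [mul_zero] at this
  rw [mul_div_assoc', ← this]
  congr 2
  funext ζ
  rw [smul_smul, mul_comm]

lemma norm_circle (θ : ℝ) : ‖circleMap 0 1 θ‖ = 1 := by simp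
lemma circle_ne (θ : ℝ) : circleMap 0 1 θ ≠ 0 := by
  rw [← norm_ne_zero_iff, norm_circle]; exact one_ne_zero

lemma hp_circle (k : ℕ) {U : Set E} (hU : IsOpen U) {u : E → ℂ} (hu : DifferentiableOn ℂ u U)
    {x : E} (hx : ∀ ζ : ℂ, ‖ζ‖ ≤ 1 → ζ • x ∈ U) :
    ∫ θ in (0:ℝ)..2 * Real.pi, ((circleMap 0 1 θ) ^ k)⁻¹ * u (circleMap 0 1 θ • x) =
      (2 * Real.pi : ℂ) * hp k u x := by
  have h1 : DifferentiableOn ℂ (fun ζ : ℂ => u (ζ • x)) (closedBall 0 1) := by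
    intro ζ hζ
    have := hu.differentiableAt (hU.mem_nhds (hx ζ (by simpa using hζ)))
    exact (this.comp (f := fun ζ : ℂ => ζ • x) ζ (by fun_prop)).differentiableWithinAt
  have h2 := h1.circleIntegral_one_div_sub_center_pow_smul one_pos k
  unfold circleIntegral at h2
  have h3 : ∀ θ : ℝ, deriv (circleMap 0 1) θ • ((1 / (circleMap 0 1 θ - 0) ^ (k + 1)) •
      u (circleMap 0 1 θ • x)) = Complex.I * (((circleMap 0 1 θ) ^ k)⁻¹ * u (circleMap 0 1 θ • x)) := by
    intro θ
    have := circle_ne θ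
    rw [deriv_circleMap, smul_eq_mul, smul_eq_mul, sub_zero]
    field_simp
    ring
  simp only [h3] at h2
  rw [intervalIntegral.integral_const_mul] at h2
  have h4 := mul_left_cancel₀ Complex.I_ne_zero (h2.trans
    (show _ = Complex.I * ((2 * Real.pi : ℂ) * hp k u x) from ?_))
  · exact h4
  · unfold hp; rw [smul_eq_mul]; ring

lemma circle_cont {U : Set E} (hU : IsOpen U) {u : E → ℂ} (hu : ContinuousOn u U)
    {x : E} (hx : ∀ ζ : ℂ, ‖ζ‖ ≤ 1 → ζ • x ∈ U) :
    Continuous fun θ : ℝ => u (circleMap 0 1 θ • x) := by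
  rw [continuous_iff_continuousAt]
  intro θ
  have h := hu.continuousAt (hU.mem_nhds (hx _ (norm_circle θ).le))
  exact ContinuousAt.comp (f := fun θ : ℝ => circleMap 0 1 θ • x) h
    (by fun_prop)

lemma hp_norm_le (k : ℕ) {U : Set E} (hU : IsOpen U) {u : E → ℂ} (hu : DifferentiableOn ℂ u U)
    {x : E} (hx : ∀ ζ : ℂ, ‖ζ‖ ≤ 1 → ζ • x ∈ U) {C : ℝ} (hC : ∀ ζ : ℂ, ‖ζ‖ = 1 → ‖u (ζ • x)‖ ≤ C) :
    ‖hp k u x‖ ≤ C := by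
  have h := hp_circle k hU hu hx
  have h2 := intervalIntegral.norm_integral_le_of_norm_le_const (a := 0) (b := 2 * Real.pi) (C := C)
    (f := fun θ => ((circleMap 0 1 θ) ^ k)⁻¹ * u (circleMap 0 1 θ • x)) (by
      intro θ _
      rw [norm_mul, norm_inv, norm_pow, norm_circle, one_pow, inv_one, one_mul]
      exact hC _ (norm_circle θ))
  rw [h, norm_mul, sub_zero, abs_of_pos Real.two_pi_pos] at h2
  have h3 : ‖(2 * Real.pi : ℂ)‖ = 2 * Real.pi := by
    simp [abs_of_pos Real.pi_pos]
  rw [h3, mul_comm] at h2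
  exact le_of_mul_le_mul_right h2 Real.two_pi_pos

lemma CC.exists_gt {Ω : Set E} (h : CC Ω) {x : E} (hx : x ∈ Ω) :
    ∃ t : ℝ, 1 < t ∧ ∀ ζ : ℂ, ‖ζ‖ ≤ t → ζ • x ∈ Ω := by
  have hc : Tendsto (fun t : ℝ => (t : ℂ) • x) (𝓝 1) (𝓝 x) := by
    have : Continuous (fun t : ℝ => (t : ℂ) • x) := by fun_prop
    simpa using this.tendsto 1
  have h1 := hc.eventually (h.isOpen.mem_nhds hx)
  obtain ⟨t, ht, ht1⟩ := ((h1.filter_mono nhdsWithin_le_nhds).and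
    (self_mem_nhdsWithin (s := Ioi (1:ℝ)))).exists
  replace ht1 : 1 < t := ht1
  refine ⟨t, ht1, fun ζ hζ => ?_⟩
  have h2 := h.smul _ ht (ζ / t) (by
    rw [norm_div, Complex.norm_real, Real.norm_eq_abs, abs_of_pos (by linarith)]
    rw [div_le_one (by linarith)]; exact hζ)
  rw [smul_smul, div_mul_cancel₀] at h2
  · exact h2
  · exact_mod_cast (by linarith : t ≠ 0)

lemma hp_hasSum {Ω : Set E} (h : CC Ω) {u : E → ℂ} (hu : DifferentiableOn ℂ u Ω)
    {x : E} (hx : x ∈ Ω) : HasSum (fun k => hp k u x) (u x) := by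
  obtain ⟨t, ht, hζ⟩ := h.exists_gt hx
  have h1 : DifferentiableOn ℂ (fun ζ : ℂ => u (ζ • x)) (ball 0 t) := by
    intro ζ hζ'
    have := hu.differentiableAt (h.isOpen.mem_nhds (hζ ζ (by simpa using (mem_ball_zero_iff.1 hζ').le)))
    exact (this.comp (f := fun ζ : ℂ => ζ • x) ζ (by fun_prop)).differentiableWithinAt
  have h2 := Complex.hasSum_taylorSeries_on_ball h1 (z := 1) (by simpa using ht)
  simp only [sub_zero, one_pow, one_smul, smul_eq_mul] at h2
  have h3 : (fun k => hp k u x) = fun n : ℕ => (n ! : ℂ)⁻¹ *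
      (1 * iteratedDeriv n (fun ζ : ℂ => u (ζ • x)) 0) := by
    funext n; unfold hp; ring
  rw [h3]; simpa using h2

lemma hp_differentiable [FiniteDimensional ℂ E] {Ω : Set E} (h : CC Ω) {u : E → ℂ}
    (hu : DifferentiableOn ℂ u Ω) (k : ℕ) : Differentiable ℂ (hp k u) := by
  have : ProperSpace E := FiniteDimensional.proper ℂ E
  obtain ⟨ε, hε, hεΩ⟩ := Metric.isOpen_iff.1 h.isOpen 0 h.zero
  have hb : ∀ x ∈ ball (0 : E) (ε / 2), ∀ ζ : ℂ, ‖ζ‖ ≤ 1 → ζ • x ∈ closedBall (0 : E) (ε / 2) := by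
    intro x hx ζ hζ
    rw [mem_closedBall_zero_iff, norm_smul]
    rw [mem_ball_zero_iff] at hx
    nlinarith [norm_nonneg x, norm_nonneg ζ]
  have hcb : closedBall (0 : E) (ε / 2) ⊆ Ω := (closedBall_subset_ball (by linarith)).trans hεΩ
  obtain ⟨M, hM⟩ := (isCompact_closedBall (0 : E) (ε / 2)).exists_bound_of_continuousOn
    (hu.continuousOn.mono hcb)
  have hD : DifferentiableOn ℂ (hp k u) (ball 0 (ε / 2)) := by
    have : DifferentiableOn ℂ (fun x => (2 * Real.pi : ℂ)⁻¹ * ∫ θ in (0:ℝ)..2 * Real.pi,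
        ((circleMap 0 1 θ) ^ k)⁻¹ * u (circleMap 0 1 θ • x)) (ball 0 (ε / 2)) := by
      apply DifferentiableOn.const_mul
      simp only [intervalIntegral.integral_of_le Real.two_pi_pos.le]
      refine differentiableOn_integral isOpen_ball (bound := fun _ => M) ?_ ?_ (integrable_const _) ?_
      · intro x hx
        apply Continuous.aestronglyMeasurable
        refine Continuous.mul ?_ (circle_cont h.isOpen hu.continuousOn
          (fun ζ hζ => hcb (hb x hx ζ hζ)))
        refine Continuous.inv₀ (by fun_prop) (fun θ => pow_ne_zero _ (circle_ne θ))
      · refine Eventually.of_forall fun θ x hx => ?_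
        rw [norm_mul, norm_inv, norm_pow, norm_circle, one_pow, inv_one, one_mul]
        exact hM _ (hb x hx _ (norm_circle θ).le)
      · refine Eventually.of_forall fun θ x hx => ?_
        apply DifferentiableAt.differentiableWithinAt
        refine DifferentiableAt.const_mul ?_ _
        have := hu.differentiableAt (h.isOpen.mem_nhds (hcb (hb x hx _ (norm_circle θ).le)))
        exact this.comp (f := fun x : E => circleMap 0 1 θ • x) x (by fun_prop)
    refine this.congr fun x hx => ?_
    rw [hp_circle k h.isOpen hu (fun ζ hζ => hcb (hb x hx ζ hζ)), inv_mul_cancel_left₀]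
    exact_mod_cast Real.two_pi_pos.ne'
  intro x
  obtain ⟨t, ht, htx⟩ : ∃ t : ℝ, 0 < t ∧ t * ‖x‖ < ε / 2 := by
    refine ⟨ε / 2 / (‖x‖ + 1), by positivity, ?_⟩
    rw [div_mul_eq_mul_div, div_lt_iff₀ (by positivity)]
    nlinarith [norm_nonneg x]
  have htc : (t : ℂ) ≠ 0 := by exact_mod_cast ht.ne'
  have heq : hp k u = fun x => ((t : ℂ) ^ k)⁻¹ * hp k u ((t : ℂ) • x) := by
    funext x
    rw [hp_smul, inv_mul_cancel_left₀ (pow_ne_zero _ htc)]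
  rw [heq]
  apply DifferentiableAt.const_mul
  have hmem : (t : ℂ) • x ∈ ball (0 : E) (ε / 2) := by
    rw [mem_ball_zero_iff, norm_smul, Complex.norm_real, Real.norm_eq_abs, abs_of_pos ht]
    exact htx
  exact (hD.differentiableAt (isOpen_ball.mem_nhds hmem)).comp (f := fun x : E => (t : ℂ) • x) x
    (by fun_prop)

end hom
end FBHProof
end

section
open Set Filter Topology MeasureTheory Metric
open scoped Nat
namespace FBHProof

section rot
variable {E : Type*} [NormedAddCommGroup E] [NormedSpace ℂ E] [FiniteDimensional ℂ E]
  [MeasurableSpace E] [BorelSpace E] (μ : Measure E) [μ.IsAddHaarMeasure]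

lemma map_rot {ζ : ℂ} (hζ : ‖ζ‖ = 1) : μ.map (fun x : E => ζ • x) = μ := by
  have hζ0 : ζ ≠ 0 := by rw [← norm_ne_zero_iff, hζ]; exact one_ne_zero
  let L : E →ₗ[ℝ] E := (ζ • (LinearMap.id : E →ₗ[ℂ] E)).restrictScalars ℝ
  have hL : ∀ x, L x = ζ • x := fun x => rfl
  have him : L '' ball 0 1 = ball 0 1 := by
    ext x
    constructor
    · rintro ⟨y, hy, rfl⟩
      rw [hL]; simpa [norm_smul, hζ] using hy
    · intro hx
      refine ⟨ζ⁻¹ • x, ?_, ?_⟩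
      · simpa [norm_smul, hζ] using hx
      · rw [hL, smul_inv_smul₀ hζ0]
  have h1 := Measure.addHaar_image_linearMap μ L (ball 0 1)
  rw [him] at h1
  have hpos : μ (ball (0:E) 1) ≠ 0 := (measure_ball_pos μ 0 one_pos).ne'
  have hfin : μ (ball (0:E) 1) ≠ ⊤ := measure_ball_lt_top.ne
  have h2 : ENNReal.ofReal |LinearMap.det L| = 1 := by
    have : ENNReal.ofReal |LinearMap.det L| * μ (ball (0:E) 1) = 1 * μ (ball (0:E) 1) := by
      rw [one_mul]; exact h1.symm
    exact (ENNReal.mul_left_inj hpos hfin).1 this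
  have h3 : |LinearMap.det L| = 1 := by
    rwa [ENNReal.ofReal_eq_one] at h2
  have h4 : LinearMap.det L ≠ 0 := by
    intro h; rw [h] at h3; simp at h3
  have := Measure.map_linearMap_addHaar_eq_smul_addHaar μ h4
  rw [abs_inv, h3] at this
  have h5 : (fun x : E => ζ • x) = L := rfl
  rw [h5]
  simpa using this

lemma circ_int {F : E → ℂ} (hF : Integrable F μ) :
    ∫ x, (∫ θ in (0:ℝ)..2 * Real.pi, F (circleMap 0 1 θ • x)) ∂μ = (2 * Real.pi : ℂ) * ∫ x, F x ∂μ := by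
  have : ProperSpace E := FiniteDimensional.proper ℂ E
  simp only [intervalIntegral.integral_of_le Real.two_pi_pos.le]
  set ν : Measure ℝ := volume.restrict (Ioc 0 (2 * Real.pi)) with hν
  have hmp : MeasurePreserving (fun p : ℝ × E => (p.1, circleMap 0 1 p.1 • p.2)) (ν.prod μ) (ν.prod μ) := by
    refine MeasurePreserving.skew_product (g := fun (θ : ℝ) (x : E) => circleMap 0 1 θ • x)
      (MeasurePreserving.id ν) ?_ ?_
    · apply Continuous.measurable
      unfold Function.uncurry
      fun_prop
    · exact Eventually.of_forall fun θ => map_rot μ (norm_circle θ)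
  have hi : Integrable (fun p : ℝ × E => F (circleMap 0 1 p.1 • p.2)) (ν.prod μ) := by
    have h1 : Integrable (fun p : ℝ × E => F p.2) (ν.prod μ) := hF.comp_snd ν
    exact hmp.integrable_comp_of_integrable h1
  rw [← integral_integral_swap hi]
  have : ∀ θ : ℝ, ∫ x, F (circleMap 0 1 θ • x) ∂μ = ∫ x, F x ∂μ := by
    intro θ
    have h := map_rot μ (norm_circle θ) (E := E)
    conv_rhs => rw [← h]
    rw [integral_map (by fun_prop) (by rw [h]; exact hF.1)]
  simp only [this]
  rw [integral_const]
  simp [hν, Real.pi_pos.le]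

/-- integration against a function of weight `-k` only sees the homogeneous part. -/
lemma int_hom (k : ℕ) {U : Set E} (hU : IsOpen U) {u Φ : E → ℂ} (hu : DifferentiableOn ℂ u U)
    (hΦ : ∀ (θ : ℝ) x, Φ (circleMap 0 1 θ • x) = ((circleMap 0 1 θ) ^ k)⁻¹ * Φ x)
    (hsub : ∀ x, Φ x ≠ 0 → ∀ ζ : ℂ, ‖ζ‖ ≤ 1 → ζ • x ∈ U)
    (hi : Integrable (fun x => Φ x * u x) μ) :
    ∫ x, Φ x * u x ∂μ = ∫ x, Φ x * hp k u x ∂μ := by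
  have h1 := circ_int μ hi
  have h2 : ∀ x, ∫ θ in (0:ℝ)..2 * Real.pi, Φ (circleMap 0 1 θ • x) * u (circleMap 0 1 θ • x) =
      (2 * Real.pi : ℂ) * (Φ x * hp k u x) := by
    intro x
    by_cases hx : Φ x = 0
    · simp [hΦ, hx]
    · have h3 := hp_circle k hU hu (hsub x hx)
      have h4 : ∀ θ : ℝ, Φ (circleMap 0 1 θ • x) * u (circleMap 0 1 θ • x) =
        Φ x * (((circleMap 0 1 θ) ^ k)⁻¹ * u (circleMap 0 1 θ • x)) := by
        intro θ; rw [hΦ]; ring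
      simp only [h4]
      rw [intervalIntegral.integral_const_mul, h3]; ring
  simp only [h2] at h1
  rw [integral_const_mul] at h1
  exact (mul_left_cancel₀ (by exact_mod_cast Real.two_pi_pos.ne') h1).symm

/-- mean value property against circular weights -/
lemma mean_value {U : Set E} (hU : IsOpen U) {u ρ : E → ℂ} (hu : DifferentiableOn ℂ u U) (a : E)
    (hρ : ∀ (θ : ℝ) x, ρ (circleMap 0 1 θ • x) = ρ x)
    (hsub : ∀ x, ρ x ≠ 0 → ∀ ζ : ℂ, ‖ζ‖ ≤ 1 → a + ζ • x ∈ U)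
    (hi : Integrable (fun x => ρ x * u (a + x)) μ) :
    ∫ x, ρ x * u (a + x) ∂μ = u a * ∫ x, ρ x ∂μ := by
  have hd : DifferentiableOn ℂ (fun x => u (a + x)) ((fun x => a + x) ⁻¹' U) :=
    hu.comp (by fun_prop) (fun _ h => h)
  have := int_hom μ 0 (hU.preimage (by fun_prop : Continuous fun x : E => a + x)) hd
    (Φ := ρ) (by intro θ x; simp [hρ]) hsub hi
  rw [this, ← integral_const_mul]
  congr 1
  funext x
  simp [hp, mul_comm]

lemma sq_le_int {U : Set E} (hU : IsOpen U) {K : Set E} (hK : IsCompact K) (hKU : K ⊆ U) :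
    ∃ C : ℝ, 0 ≤ C ∧ ∀ u : E → ℂ, DifferentiableOn ℂ u U → IntegrableOn (fun x => ‖u x‖ ^ 2) U μ →
      ∀ x ∈ K, ‖u x‖ ^ 2 ≤ C * ∫ y in U, ‖u y‖ ^ 2 ∂μ := by
  have : ProperSpace E := FiniteDimensional.proper ℂ E
  obtain ⟨δ, hδ, hδU⟩ := hK.exists_cthickening_subset_open hU hKU
  have hball : ∀ x ∈ K, closedBall x δ ⊆ U := fun x hx =>
    (closedBall_subset_cthickening hx δ).trans hδU
  have hpos : 0 < μ.real (ball (0:E) δ) :=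
    ENNReal.toReal_pos (measure_ball_pos μ 0 hδ).ne' measure_ball_lt_top.ne
  refine ⟨(μ.real (ball (0:E) δ))⁻¹, by positivity, ?_⟩
  intro u hu hi x hx
  let ρ : E → ℂ := (ball (0:E) δ).indicator 1
  have hi2 : IntegrableOn (fun y => u y ^ 2) (ball x δ) μ := by
    have h1 : IntegrableOn (fun x => ‖u x‖ ^ 2) (ball x δ) μ :=
      hi.mono_set (ball_subset_closedBall.trans (hball x hx))
    refine Integrable.mono' h1 ?_ (by simp)
    exact (((hu.continuousOn.mono (ball_subset_closedBall.trans (hball x hx))).pow 2).aestronglyMeasurable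
      measurableSet_ball)
  have heq : (fun y => ρ y * u (x + y) ^ 2) = fun y => (ball x δ).indicator (fun z => u z ^ 2) (x + y) := by
    funext y
    simp only [ρ, indicator, mem_ball, dist_eq_norm, add_sub_cancel_left, Pi.one_apply, sub_zero]
    split_ifs <;> simp
  have hii : Integrable (fun y => ρ y * u (x + y) ^ 2) μ := by
    rw [heq]
    exact ((integrable_indicator_iff measurableSet_ball).2 hi2).comp_add_left x
  have hmv := mean_value μ hU (hu.pow 2) x (ρ := ρ) ?_ ?_ hii
  · have h5 : ∫ y, ρ y * u (x + y) ^ 2 ∂μ = ∫ y in ball x δ, u y ^ 2 ∂μ := by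
      rw [heq, integral_add_left_eq_self (fun y => (ball x δ).indicator (fun z => u z ^ 2) y) x,
        integral_indicator measurableSet_ball]
    have h6 : ∫ y, ρ y ∂μ = (μ.real (ball (0:E) δ) : ℂ) := by
      simp only [ρ]
      rw [integral_indicator measurableSet_ball]
      simp
    simp only [Pi.pow_apply] at hmv
    rw [h5, h6] at hmv
    have h7 : ‖u x‖ ^ 2 * μ.real (ball (0:E) δ) ≤ ∫ y in U, ‖u y‖ ^ 2 ∂μ := by
      have : ‖u x ^ 2 * (μ.real (ball (0:E) δ) : ℂ)‖ = ‖u x‖ ^ 2 * μ.real (ball (0:E) δ) := by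
        rw [norm_mul, norm_pow, Complex.norm_real, Real.norm_eq_abs, abs_of_pos hpos]
      rw [← this, ← hmv]
      refine (norm_integral_le_integral_norm _).trans ?_
      simp only [norm_pow]
      exact setIntegral_mono_set hi (Eventually.of_forall fun y => by positivity)
        (ball_subset_closedBall.trans (hball x hx)).eventuallyLE
    rw [inv_mul_eq_div, le_div_iff₀ hpos]
    exact h7
  · intro θ y
    simp only [ρ, indicator, mem_ball_zero_iff, norm_smul, norm_circle, one_mul, Pi.one_apply]
  · intro y hy ζ hζ
    have hy' : y ∈ ball (0:E) δ := by
      by_contra h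
      exact hy (indicator_of_notMem h _)
    apply hball x hx
    rw [mem_closedBall, dist_eq_norm, add_sub_cancel_left, norm_smul]
    rw [mem_ball_zero_iff] at hy'
    nlinarith [norm_nonneg y, norm_nonneg ζ]

end rot
end FBHProof
end

section
open Set Filter Topology MeasureTheory Metric
open scoped Nat
namespace FBHProof

section piola
variable {E : Type*} [NormedAddCommGroup E] [NormedSpace ℂ E] [FiniteDimensional ℂ E]

lemma sum_antisymm {N : ℕ} (T : Fin N → Fin N → ℂ) (h : ∀ k l, T k l = - T l k) :
    ∑ k, ∑ l, T k l = 0 := by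
  have h1 : ∑ k, ∑ l, T k l = - ∑ k, ∑ l, T k l := by
    conv_lhs => rw [Finset.sum_comm]
    rw [← Finset.sum_neg_distrib]
    refine Finset.sum_congr rfl fun k _ => ?_
    rw [← Finset.sum_neg_distrib]
    exact Finset.sum_congr rfl fun l _ => h l k
  have h2 : 2 * ∑ k, ∑ l, T k l = 0 := by linear_combination h1
  exact (mul_eq_zero.1 h2).resolve_left two_ne_zero

noncomputable def detC {N : ℕ} (b : Module.Basis (Fin N) ℂ E) :
    ContinuousMultilinearMap ℂ (fun _ : Fin N => E) ℂ :=
  { b.det.toMultilinearMap with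
    cont := by
      have : (b.det : (Fin N → E) → ℂ) = fun v => (b.toMatrix v).det := by
        funext v; exact b.det_apply v
      change Continuous (b.det : (Fin N → E) → ℂ)
      rw [this]
      apply Continuous.matrix_det
      refine continuous_matrix fun i j => ?_
      simp only [Module.Basis.toMatrix_apply]
      have := (LinearMap.toContinuousLinearMap (b.coord i)).continuous
      exact this.comp (continuous_apply j) }

lemma detC_apply {N : ℕ} (b : Module.Basis (Fin N) ℂ E) (v) : detC b v = b.det v := rfl

/-- Cramer's rule -/
lemma cramer_id {N : ℕ} (b : Module.Basis (Fin N) ℂ E) (u : Fin N → E) (v : E) :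
    ∑ k, b.det (Function.update u k v) • u k = b.det u • v := by
  apply b.repr.injective
  ext i
  have h := congrFun (Matrix.mulVec_cramer (b.toMatrix u) (b.repr v)) i
  simp only [map_sum, map_smul, Finsupp.coe_finsetSum, Finset.sum_apply, Finsupp.coe_smul, Pi.smul_apply,
    smul_eq_mul]
  simp only [Matrix.mulVec, dotProduct, Matrix.cramer_apply, Pi.smul_apply, smul_eq_mul,
    Module.Basis.toMatrix_apply, ← Module.Basis.toMatrix_update, ← Module.Basis.det_apply] at h
  rw [← h]
  exact Finset.sum_congr rfl fun k _ => mul_comm _ _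

/-- cofactor functions -/
noncomputable def cof {N : ℕ} (b : Module.Basis (Fin N) ℂ E) (f : E → E) (v : E) (k : Fin N) (x : E) : ℂ :=
  b.det (Function.update (fun l => fderiv ℂ f x (b l)) k v)

lemma jac_eq {N : ℕ} (b : Module.Basis (Fin N) ℂ E) (T : E →L[ℂ] E) :
    T.det = b.det (fun l => T (b l)) := by
  have := b.det_comp (T : E →ₗ[ℂ] E) b
  rw [b.det_self, mul_one] at this
  exact this.symm

lemma cof_apply {N : ℕ} (b : Module.Basis (Fin N) ℂ E) (f : E → E) (v : E) (x : E) :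
    fderiv ℂ f x (∑ k, cof b f v k x • b k) = (fderiv ℂ f x).det • v := by
  rw [jac_eq b, ← cramer_id, map_sum]
  simp [cof]

lemma cof_hasFDerivAt {N : ℕ} (b : Module.Basis (Fin N) ℂ E) {Ω : Set E} (hΩ : IsOpen Ω) {f : E → E}
    (hf : DifferentiableOn ℂ f Ω) (v : E) (k : Fin N) {x : E} (hx : x ∈ Ω) :
    HasFDerivAt (cof b f v k) (∑ l, ((detC b).toContinuousLinearMap
      (Function.update (fun l => fderiv ℂ f x (b l)) k v) l) ∘L
      (if l = k then 0 else fderiv ℂ (fun y => fderiv ℂ f y (b l)) x)) x := by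
  have h := HasFDerivAt.multilinear_comp (f := detC b) (x := x)
    (g := fun l y => Function.update (fun l => fderiv ℂ f y (b l)) k v l)
    (g' := fun l => if l = k then 0 else fderiv ℂ (fun y => fderiv ℂ f y (b l)) x) ?_
  · exact h
  · intro l
    by_cases hl : l = k
    · subst hl
      simpa using hasFDerivAt_const v x
    · simp only [Function.update_of_ne hl, if_neg hl]
      exact ((differentiableOn_fderiv_apply hΩ hf (b l)).differentiableAt (hΩ.mem_nhds hx)).hasFDerivAt

lemma cof_differentiableOn {N : ℕ} (b : Module.Basis (Fin N) ℂ E) {Ω : Set E} (hΩ : IsOpen Ω) {f : E → E}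
    (hf : DifferentiableOn ℂ f Ω) (v : E) (k : Fin N) : DifferentiableOn ℂ (cof b f v k) Ω :=
  fun _ hx => (cof_hasFDerivAt b hΩ hf v k hx).differentiableAt.differentiableWithinAt

lemma jac_differentiableOn {Ω : Set E} (hΩ : IsOpen Ω) {f : E → E}
    (hf : DifferentiableOn ℂ f Ω) : DifferentiableOn ℂ (fun x => (fderiv ℂ f x).det) Ω := by
  let b := Module.finBasis ℂ E
  intro x hx
  apply DifferentiableAt.differentiableWithinAt
  have h := HasFDerivAt.multilinear_comp (f := detC b) (x := x)
    (g := fun l y => fderiv ℂ f y (b l))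
    (g' := fun l => fderiv ℂ (fun y => fderiv ℂ f y (b l)) x)
    (fun l => ((differentiableOn_fderiv_apply hΩ hf (b l)).differentiableAt (hΩ.mem_nhds hx)).hasFDerivAt)
  refine h.differentiableAt.congr_of_eventuallyEq (Eventually.of_forall fun y => ?_)
  exact jac_eq b _

lemma symm_snd {Ω : Set E} (hΩ : IsOpen Ω) {f : E → E}
    (hf : DifferentiableOn ℂ f Ω) {x : E} (hx : x ∈ Ω) (v w : E) :
    fderiv ℂ (fun y => fderiv ℂ f y v) x w = fderiv ℂ (fun y => fderiv ℂ f y w) x v := by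
  have h2 : ContDiffAt ℂ 2 f x := by
    have := (contDiffOn_of_hol hΩ 2 hf).contDiffAt (hΩ.mem_nhds hx)
    exact_mod_cast this
  have hs := h2.isSymmSndFDerivAt (by simp)
  have hd : DifferentiableAt ℂ (fderiv ℂ f) x := by
    have : ContDiffAt ℂ 1 (fderiv ℂ f) x := h2.fderiv_right (by norm_num)
    exact this.differentiableAt (by norm_num)
  have key : ∀ v w, fderiv ℂ (fun y => fderiv ℂ f y v) x w = fderiv ℂ (fderiv ℂ f) x w v := by
    intro v w
    have := (hd.hasFDerivAt.clm_apply (hasFDerivAt_const v x)).fderiv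
    rw [this]; simp
  rw [key, key]; exact hs _ _

theorem piola {N : ℕ} (b : Module.Basis (Fin N) ℂ E) {Ω : Set E} (hΩ : IsOpen Ω) {f : E → E}
    (hf : DifferentiableOn ℂ f Ω) (v : E) {x : E} (hx : x ∈ Ω) :
    ∑ k, fderiv ℂ (cof b f v k) x (b k) = 0 := by
  set u : Fin N → E := fun l => fderiv ℂ f x (b l) with hu
  set D : Fin N → Fin N → E := fun l k => fderiv ℂ (fun y => fderiv ℂ f y (b l)) x (b k) with hD
  have h1 : ∀ k, fderiv ℂ (cof b f v k) x (b k) =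
      ∑ l, if l = k then 0 else b.det (Function.update (Function.update u k v) l (D l k)) := by
    intro k
    rw [(cof_hasFDerivAt b hΩ hf v k hx).fderiv, ContinuousLinearMap.sum_apply]
    refine Finset.sum_congr rfl fun l _ => ?_
    by_cases hl : l = k
    · simp [hl]
    · simp only [if_neg hl]
      rfl
  simp only [h1]
  apply sum_antisymm
  intro k l
  by_cases hl : l = k
  · simp [hl]
  · rw [if_neg hl, if_neg (Ne.symm hl)]
    have hsw := b.det.map_swap (Function.update (Function.update u k v) l (D l k)) (Ne.symm hl)
    have hDD : D l k = D k l := symm_snd hΩ hf hx _ _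
    have : (Function.update (Function.update u k v) l (D l k)) ∘ (Equiv.swap k l) =
        Function.update (Function.update u l v) k (D k l) := by
      funext i
      rw [Function.comp_apply, hDD]
      by_cases hik : i = k
      · subst hik
        rw [Equiv.swap_apply_left]; simp
      · by_cases hil : i = l
        · subst hil
          rw [Equiv.swap_apply_right]
          simp [Function.update_of_ne hik, Function.update_of_ne (Ne.symm hik)]
        · rw [Equiv.swap_apply_of_ne_of_ne hik hil]
          simp [Function.update_of_ne hik, Function.update_of_ne hil]
    rw [this] at hsw
    rw [hsw, neg_neg]

end piola
end FBHProof
end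

section
open Set Filter Topology MeasureTheory Metric
open scoped Nat ComplexConjugate
namespace FBHProof

section stokes
variable {E : Type*} [NormedAddCommGroup E] [NormedSpace ℂ E] [FiniteDimensional ℂ E]
  [MeasurableSpace E] [BorelSpace E] (μ : Measure E) [μ.IsAddHaarMeasure]

lemma stokes {Ω L : Set E} (hΩ : IsOpen Ω) (hL : IsCompact L) (hLΩ : L ⊆ Ω) {Φ : E → ℂ}
    (hΦ : ContDiffOn ℝ 1 Φ Ω) (h0 : ∀ x ∈ Ω, x ∉ L → Φ x = 0) (w : E) :
    IntegrableOn (fun x => fderiv ℝ Φ x w) Ω μ ∧ ∫ x in Ω, fderiv ℝ Φ x w ∂μ = 0 := by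
  have : ProperSpace E := FiniteDimensional.proper ℂ E
  let Ψ : E → ℂ := Ω.indicator Φ
  have hΨL : ∀ x, x ∉ L → Ψ x = 0 := by
    intro x hx
    by_cases hxΩ : x ∈ Ω
    · simp only [Ψ, indicator_of_mem hxΩ]; exact h0 x hxΩ hx
    · exact indicator_of_notMem hxΩ _
  have hev : ∀ x ∈ Ω, Ψ =ᶠ[𝓝 x] Φ := fun x hx => by
    filter_upwards [hΩ.mem_nhds hx] with y hy using indicator_of_mem hy _
  have hev0 : ∀ x, x ∉ L → Ψ =ᶠ[𝓝 x] 0 := fun x hx => by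
    filter_upwards [hL.isClosed.isOpen_compl.mem_nhds hx] with y hy using hΨL y hy
  have hΨ : ContDiff ℝ 1 Ψ := by
    rw [contDiff_iff_contDiffAt]
    intro x
    by_cases hxΩ : x ∈ Ω
    · exact (hΦ.contDiffAt (hΩ.mem_nhds hxΩ)).congr_of_eventuallyEq (hev x hxΩ)
    · have : x ∉ L := fun h => hxΩ (hLΩ h)
      exact (contDiffAt_const (c := (0:ℂ))).congr_of_eventuallyEq (hev0 x this)
  have hsupp : HasCompactSupport Ψ := HasCompactSupport.intro hL hΨL
  have hfd : Continuous fun x => fderiv ℝ Ψ x w :=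
    (hΨ.continuous_fderiv (by norm_num)).clm_apply continuous_const
  have hfds : HasCompactSupport fun x => fderiv ℝ Ψ x w := hsupp.fderiv_apply (𝕜 := ℝ) w
  have hintg : Integrable (fun x => fderiv ℝ Ψ x w) μ := hfd.integrable_of_hasCompactSupport hfds
  have hz : ∫ x, fderiv ℝ Ψ x w ∂μ = 0 := by
    have := integral_mul_fderiv_eq_neg_fderiv_mul_of_integrable (μ := μ) (𝕜 := ℂ) (f := fun _ : E => (1:ℂ)) (g := Ψ)
      (v := w) (by simp) (by simpa using hintg)
      (by simpa using hΨ.continuous.integrable_of_hasCompactSupport hsupp) (by simp)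
      (fun x _ => hΨ.contDiffAt.differentiableAt (by norm_num))
    simpa using this
  have heq : (fun x => fderiv ℝ Ψ x w) = Ω.indicator (fun x => fderiv ℝ Φ x w) := by
    funext x
    by_cases hxΩ : x ∈ Ω
    · rw [indicator_of_mem hxΩ, (hev x hxΩ).fderiv_eq]
    · have : x ∉ L := fun h => hxΩ (hLΩ h)
      rw [indicator_of_notMem hxΩ, (hev0 x this).fderiv_eq]
      simp
  rw [heq] at hz hintg
  rw [integral_indicator hΩ.measurableSet] at hz
  exact ⟨(integrable_indicator_iff hΩ.measurableSet).1 hintg, hz⟩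

/-- the antilinear part -/
noncomputable def QQ (R : E →L[ℝ] ℝ) (y : E) : ℂ := (R (Complex.I • y) : ℂ) - Complex.I * (R y : ℂ)

lemma QQ_smul (R : E →L[ℝ] ℝ) (c : ℂ) (y : E) : QQ R (c • y) = conj c * QQ R y := by
  unfold QQ
  have h1 : c • y = c.re • y + c.im • (Complex.I • y) := by
    conv_lhs => rw [← Complex.re_add_im c]
    rw [add_smul, mul_smul]
    rfl
  have h2 : Complex.I • c • y = c.re • (Complex.I • y) - c.im • y := by
    rw [h1, smul_add, smul_comm Complex.I c.re y, smul_comm Complex.I c.im, smul_smul]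
    rw [Complex.I_mul_I]
    simp [sub_eq_add_neg]
  rw [h2, h1, map_sub, map_add]
  simp only [map_smul, smul_eq_mul]
  apply Complex.ext
  · simp
  · simp
    ring

lemma QQ_sum (R : E →L[ℝ] ℝ) {N : ℕ} (y : Fin N → E) : QQ R (∑ k, y k) = ∑ k, QQ R (y k) := by
  unfold QQ
  rw [Finset.smul_sum, map_sum, map_sum, Finset.sum_sub_distrib, ← Finset.mul_sum]
  push_cast
  rfl

lemma integrand_id {N : ℕ} (b : Module.Basis (Fin N) ℂ E) {Ω : Set E} (hΩ : IsOpen Ω) {f : E → E}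
    (hf : DifferentiableOn ℂ f Ω) {g : E → ℂ} (hg : DifferentiableOn ℂ g Ω) {ρ : E → ℝ}
    (hρ : ContDiff ℝ 1 ρ) (a v : E) {x : E} (hx : x ∈ Ω) :
    ∑ k, (fderiv ℝ (fun y => g y * conj (cof b f v k y) * (ρ (f y - a) : ℂ)) x (Complex.I • b k)
      - Complex.I * fderiv ℝ (fun y => g y * conj (cof b f v k y) * (ρ (f y - a) : ℂ)) x (b k)) =
    g x * conj ((fderiv ℂ f x).det) * QQ (fderiv ℝ ρ (f x - a)) v := by
  have hg' := (hg.differentiableAt (hΩ.mem_nhds hx)).hasFDerivAt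
  have hf' := (hf.differentiableAt (hΩ.mem_nhds hx)).hasFDerivAt
  have hc' : ∀ k, HasFDerivAt (cof b f v k) (fderiv ℂ (cof b f v k) x) x := fun k =>
    ((cof_differentiableOn b hΩ hf v k).differentiableAt (hΩ.mem_nhds hx)).hasFDerivAt
  have hρ' : HasFDerivAt ρ (fderiv ℝ ρ (f x - a)) (f x - a) :=
    (hρ.contDiffAt.differentiableAt (by norm_num)).hasFDerivAt
  set R := fderiv ℝ ρ (f x - a) with hR
  have hP : ∀ k w, fderiv ℝ (fun y => g y * conj (cof b f v k y) * (ρ (f y - a) : ℂ)) x w =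
      fderiv ℂ g x w * (conj (cof b f v k x) * (ρ (f x - a) : ℂ)) +
      g x * (conj (fderiv ℂ (cof b f v k) x w) * (ρ (f x - a) : ℂ)) +
      g x * (conj (cof b f v k x) * (R (fderiv ℂ f x w) : ℂ)) := by
    intro k w
    have h1 : HasFDerivAt (fun y => (ρ (f y - a) : ℂ))
        (Complex.ofRealCLM ∘L R ∘L ((fderiv ℂ f x).restrictScalars ℝ)) x := by
      have : HasFDerivAt (fun y => f y - a) ((fderiv ℂ f x).restrictScalars ℝ) x :=
        (hf'.restrictScalars ℝ).sub_const a
      exact Complex.ofRealCLM.hasFDerivAt.comp x (hρ'.comp x this)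
    have h2 : HasFDerivAt (fun y => conj (cof b f v k y))
        ((Complex.conjCLE : ℂ →L[ℝ] ℂ) ∘L ((fderiv ℂ (cof b f v k) x).restrictScalars ℝ)) x :=
      (Complex.conjCLE : ℂ →L[ℝ] ℂ).hasFDerivAt.comp x ((hc' k).restrictScalars ℝ)
    have h3 := ((hg'.restrictScalars ℝ).mul h2).mul h1
    have h4 := h3.fderiv
    have h5 : (fun y => g y * conj (cof b f v k y) * (ρ (f y - a) : ℂ)) =
      ((g * fun y => conj (cof b f v k y)) * fun y => (ρ (f y - a) : ℂ)) := rfl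
    rw [h5, h4]
    simp only [_root_.add_apply, _root_.smul_apply, smul_eq_mul, ContinuousLinearMap.comp_apply,
      ContinuousLinearMap.coe_restrictScalars', Complex.ofRealCLM_apply, ContinuousLinearEquiv.coe_coe,
      Complex.conjCLE_apply, Pi.mul_apply]
    ring
  simp only [hP]
  have h6 : ∀ k, (fderiv ℂ g x (Complex.I • b k) * (conj (cof b f v k x) * (ρ (f x - a) : ℂ)) +
      g x * (conj (fderiv ℂ (cof b f v k) x (Complex.I • b k)) * (ρ (f x - a) : ℂ)) +
      g x * (conj (cof b f v k x) * (R (fderiv ℂ f x (Complex.I • b k)) : ℂ))) -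
      Complex.I * (fderiv ℂ g x (b k) * (conj (cof b f v k x) * (ρ (f x - a) : ℂ)) +
      g x * (conj (fderiv ℂ (cof b f v k) x (b k)) * (ρ (f x - a) : ℂ)) +
      g x * (conj (cof b f v k x) * (R (fderiv ℂ f x (b k)) : ℂ))) =
      (-2 * Complex.I * g x * (ρ (f x - a) : ℂ)) * conj (fderiv ℂ (cof b f v k) x (b k)) +
      g x * QQ R (fderiv ℂ f x (cof b f v k x • b k)) := by
    intro k
    have e : fderiv ℂ f x (cof b f v k x • b k) = cof b f v k x • fderiv ℂ f x (b k) := map_smul _ _ _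
    rw [e, QQ_smul]
    unfold QQ
    simp only [map_smul, smul_eq_mul, map_mul, Complex.conj_I]
    ring
  simp only [h6]
  rw [Finset.sum_add_distrib, ← Finset.mul_sum, ← Finset.mul_sum, ← map_sum, piola b hΩ hf v hx,
    ← QQ_sum, ← map_sum, cof_apply, QQ_smul]
  simp only [map_zero, mul_zero, zero_add]
  ring

lemma exists_complex_linear (T : E →L[ℝ] ℂ) (hT : ∀ v, T (Complex.I • v) = Complex.I * T v) :
    ∃ S : E →L[ℂ] ℂ, S.restrictScalars ℝ = T := by
  refine ⟨⟨⟨⟨T, map_add T⟩, ?_⟩, T.continuous⟩, rfl⟩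
  intro c y
  have h1 : c • y = c.re • y + c.im • (Complex.I • y) := by
    conv_lhs => rw [← Complex.re_add_im c]
    rw [add_smul, mul_smul]
    rfl
  simp only [h1, map_add, map_smul, hT, RingHom.id_apply, smul_eq_mul, Complex.real_smul]
  conv_rhs => rw [← Complex.re_add_im c]
  ring

/-- the pushforward kernel -/
noncomputable def HH (Ω : Set E) (f : E → E) (g : E → ℂ) (ρ : E → ℝ) (a : E) : ℂ :=
  ∫ x in Ω, g x * conj ((fderiv ℂ f x).det) * (ρ (f x - a) : ℂ) ∂μ

theorem HH_hol {Ω W V : Set E} (hΩ : IsOpen Ω) {f : E → E} (hf : DifferentiableOn ℂ f Ω)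
    (hprop : ∀ K ⊆ W, IsCompact K → IsCompact (f ⁻¹' K ∩ Ω))
    {g : E → ℂ} (hg : DifferentiableOn ℂ g Ω) {ρ : E → ℝ}
    (hρ : ContDiff ℝ 1 ρ) (hρs : HasCompactSupport ρ) (hV : IsOpen V)
    (hVW : ∀ a ∈ V, ∀ y ∈ tsupport ρ, a + y ∈ W) :
    DifferentiableOn ℂ (HH μ Ω f g ρ) V := by
  have : ProperSpace E := FiniteDimensional.proper ℂ E
  intro a₀ ha₀
  apply DifferentiableAt.differentiableWithinAt
  obtain ⟨r, hr, hrV⟩ := Metric.nhds_basis_closedBall.mem_iff.1 (hV.mem_nhds ha₀)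
  set K : Set E := (fun p : E × E => p.1 + p.2) '' (closedBall a₀ r ×ˢ tsupport ρ) with hK
  have hKc : IsCompact K := ((isCompact_closedBall a₀ r).prod hρs).image (by fun_prop)
  have hKW : K ⊆ W := by
    rintro _ ⟨p, ⟨h1, h2⟩, rfl⟩
    exact hVW _ (hrV h1) _ h2
  set L := f ⁻¹' K ∩ Ω with hLdef
  have hL : IsCompact L := hprop K hKW hKc
  have hLΩ : L ⊆ Ω := inter_subset_right
  have hnot : ∀ a ∈ ball a₀ r, ∀ x ∈ Ω, x ∉ L → f x - a ∉ tsupport ρ := by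
    intro a ha x hx hxL h
    exact hxL ⟨⟨(a, f x - a), ⟨ball_subset_closedBall ha, h⟩, by simp⟩, hx⟩
  set G : E → ℂ := fun x => g x * conj ((fderiv ℂ f x).det) with hG
  have hJ := jac_differentiableOn hΩ hf
  have hGc : ContinuousOn G Ω :=
    hg.continuousOn.mul (Complex.continuous_conj.comp_continuousOn hJ.continuousOn)
  obtain ⟨M, hM⟩ := hL.exists_bound_of_continuousOn (hGc.mono hLΩ)
  have hρ'c : Continuous (fderiv ℝ ρ) := hρ.continuous_fderiv (by norm_num)
  obtain ⟨B, hB⟩ := hρ'c.bounded_above_of_compact_support (hρs.fderiv (𝕜 := ℝ))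
  have hB0 : 0 ≤ B := (norm_nonneg _).trans (hB 0)
  have hcont : ∀ a, ContinuousOn (fun x => f x - a) Ω := fun a => hf.continuousOn.sub continuousOn_const
  let F' : E → E → E →L[ℝ] ℂ := fun a x =>
    G x • (Complex.ofRealCLM ∘L (-(fderiv ℝ ρ (f x - a))))
  have hF'c : ∀ a, ContinuousOn (F' a) Ω := by
    intro a
    refine hGc.smul ?_
    have h1 : ContinuousOn (fun x => -(fderiv ℝ ρ (f x - a))) Ω :=
      (hρ'c.comp_continuousOn (hcont a)).neg
    exact ((ContinuousLinearMap.compL ℝ E ℝ ℂ Complex.ofRealCLM).continuous.comp_continuousOn h1)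
  have hFc : ∀ a, ContinuousOn (fun x => G x * (ρ (f x - a) : ℂ)) Ω := fun a =>
    hGc.mul (Complex.continuous_ofReal.comp_continuousOn (hρ.continuous.comp_continuousOn (hcont a)))
  have hF'0 : ∀ a ∈ ball a₀ r, ∀ x ∈ Ω, x ∉ L → F' a x = 0 := by
    intro a ha x hx hxL
    have h1 : fderiv ℝ ρ (f x - a) = 0 := by
      have h2 := hnot a ha x hx hxL
      by_contra h3
      exact h2 (support_fderiv_subset ℝ h3)
    simp [F', h1]
  have hF'b : ∀ a ∈ ball a₀ r, ∀ x ∈ Ω, ‖F' a x‖ ≤ L.indicator (fun _ => M * B) x := by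
    intro a ha x hx
    by_cases hxL : x ∈ L
    · rw [indicator_of_mem hxL]
      simp only [F']
      rw [norm_smul]
      have hM0 : 0 ≤ M := (norm_nonneg _).trans (hM x hxL)
      refine mul_le_mul (hM x hxL) ?_ (norm_nonneg _) hM0
      refine (ContinuousLinearMap.opNorm_comp_le _ _).trans ?_
      rw [norm_neg, Complex.ofRealCLM_norm, one_mul]
      exact hB _
    · rw [indicator_of_notMem hxL, hF'0 a ha x hx hxL, norm_zero]
  have hbi : Integrable (L.indicator (fun _ => M * B)) (μ.restrict Ω) := by
    refine Integrable.mono_measure ?_ Measure.restrict_le_self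
    rw [integrable_indicator_iff hL.isClosed.measurableSet]
    exact integrableOn_const hL.measure_lt_top.ne
  have hF'i : Integrable (F' a₀) (μ.restrict Ω) := by
    refine hbi.mono' ((hF'c a₀).aestronglyMeasurable hΩ.measurableSet) ?_
    exact (ae_restrict_iff' hΩ.measurableSet).2 (Eventually.of_forall (hF'b a₀ (mem_ball_self hr)))
  have hFi : Integrable (fun x => G x * (ρ (f x - a₀) : ℂ)) (μ.restrict Ω) := by
    obtain ⟨B', hB'⟩ := hρ.continuous.bounded_above_of_compact_support hρs
    have : Integrable (L.indicator (fun _ => M * B')) (μ.restrict Ω) := by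
      refine Integrable.mono_measure ?_ Measure.restrict_le_self
      rw [integrable_indicator_iff hL.isClosed.measurableSet]
      exact integrableOn_const hL.measure_lt_top.ne
    refine this.mono' ((hFc a₀).aestronglyMeasurable hΩ.measurableSet) ?_
    refine (ae_restrict_iff' hΩ.measurableSet).2 (Eventually.of_forall fun x hx => ?_)
    by_cases hxL : x ∈ L
    · rw [indicator_of_mem hxL, norm_mul]
      have hM0 : 0 ≤ M := (norm_nonneg _).trans (hM x hxL)
      refine mul_le_mul (hM x hxL) ?_ (norm_nonneg _) hM0
      rw [Complex.norm_real]; exact hB' _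
    · rw [indicator_of_notMem hxL]
      have := image_eq_zero_of_notMem_tsupport (hnot a₀ (mem_ball_self hr) x hx hxL)
      simp [this]
  have key := hasFDerivAt_integral_of_dominated_of_fderiv_le (𝕜 := ℝ) (μ := μ.restrict Ω)
    (F := fun a x => G x * (ρ (f x - a) : ℂ)) (F' := F') (x₀ := a₀) (s := ball a₀ r)
    (bound := L.indicator (fun _ => M * B)) (ball_mem_nhds _ hr)
    (Eventually.of_forall fun a => (hFc a).aestronglyMeasurable hΩ.measurableSet)
    hFi ((hF'c a₀).aestronglyMeasurable hΩ.measurableSet)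
    ((ae_restrict_iff' hΩ.measurableSet).2 (Eventually.of_forall fun x hx a ha => hF'b a ha x hx))
    hbi ?_
  · have hlin : ∀ v, (∫ x in Ω, F' a₀ x ∂μ) (Complex.I • v) = Complex.I * (∫ x in Ω, F' a₀ x ∂μ) v := by
      intro v
      rw [← sub_eq_zero, ContinuousLinearMap.integral_apply hF'i, ContinuousLinearMap.integral_apply hF'i,
        ← integral_const_mul, ← integral_sub (hF'i.apply_continuousLinearMap _)
          ((hF'i.apply_continuousLinearMap _).const_mul _)]
      let b := Module.finBasis ℂ E
      let P : Fin (Module.finrank ℂ E) → E → ℂ := fun k y =>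
        g y * conj (cof b f v k y) * (ρ (f y - a₀) : ℂ)
      have hP : ∀ k, ContDiffOn ℝ 1 (P k) Ω := by
        intro k
        have hgR : ContDiffOn ℝ 1 g Ω := by
          have := (contDiffOn_of_hol hΩ 1 hg).restrict_scalars ℝ
          exact_mod_cast this
        have hfR : ContDiffOn ℝ 1 f Ω := by
          have := (contDiffOn_of_hol hΩ 1 hf).restrict_scalars ℝ
          exact_mod_cast this
        have hcR : ContDiffOn ℝ 1 (cof b f v k) Ω := by
          have := (contDiffOn_of_hol hΩ 1 (cof_differentiableOn b hΩ hf v k)).restrict_scalars ℝ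
          exact_mod_cast this
        refine (hgR.mul ((Complex.conjCLE.contDiff (n := 1)).comp_contDiffOn hcR)).mul ?_
        exact Complex.ofRealCLM.contDiff.comp_contDiffOn
          (hρ.comp_contDiffOn (hfR.sub contDiffOn_const))
      have hP0 : ∀ k, ∀ x ∈ Ω, x ∉ L → P k x = 0 := by
        intro k x hx hxL
        have := image_eq_zero_of_notMem_tsupport (hnot a₀ (mem_ball_self hr) x hx hxL)
        simp [P, this]
      have hid : ∀ x ∈ Ω, F' a₀ x (Complex.I • v) - Complex.I * F' a₀ x v =
          - ∑ k, (fderiv ℝ (P k) x (Complex.I • b k) - Complex.I * fderiv ℝ (P k) x (b k)) := by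
        intro x hx
        rw [integrand_id b hΩ hf hg hρ a₀ v hx]
        simp only [F', QQ, hG]
        simp
        ring
      rw [setIntegral_congr_fun hΩ.measurableSet hid, integral_neg, integral_finsetSum]
      · rw [neg_eq_zero]
        refine Finset.sum_eq_zero fun k _ => ?_
        have s1 := stokes μ hΩ hL hLΩ (hP k) (hP0 k) (Complex.I • b k)
        have s2 := stokes μ hΩ hL hLΩ (hP k) (hP0 k) (b k)
        rw [integral_sub s1.1 (s2.1.const_mul _), integral_const_mul, s1.2, s2.2]
        simp
      · intro k _
        have s1 := stokes μ hΩ hL hLΩ (hP k) (hP0 k) (Complex.I • b k)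
        have s2 := stokes μ hΩ hL hLΩ (hP k) (hP0 k) (b k)
        exact Integrable.sub s1.1 (s2.1.const_mul _)
    obtain ⟨S, hS⟩ := exists_complex_linear _ hlin
    exact (hasFDerivAt_of_restrictScalars ℝ key hS).differentiableAt
  · refine (ae_restrict_iff' hΩ.measurableSet).2 (Eventually.of_forall fun x hx a ha => ?_)
    have h1 : HasFDerivAt ρ (fderiv ℝ ρ (f x - a)) (f x - a) :=
      (hρ.contDiffAt.differentiableAt (by norm_num)).hasFDerivAt
    have h2 : HasFDerivAt (fun a => f x - a) (-(ContinuousLinearMap.id ℝ E)) a := by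
      simpa using (hasFDerivAt_id a).const_sub (f x)
    have h3 := (Complex.ofRealCLM.hasFDerivAt.comp a (h1.comp a h2)).const_mul (G x)
    have e : F' a x = G x • (Complex.ofRealCLM ∘L (fderiv ℝ ρ (f x - a) ∘L (-(ContinuousLinearMap.id ℝ E)))) := by
      ext v
      simp [F']
    rw [e]
    exact h3

end stokes
end FBHProof
end

section
open Set Filter Topology MeasureTheory Metric
open scoped Nat ComplexConjugate
set_option linter.unusedSectionVars false
namespace FBHProof

section lemmaU
variable {E : Type*} [NormedAddCommGroup E] [NormedSpace ℂ E] [FiniteDimensional ℂ E]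
  [MeasurableSpace E] [BorelSpace E] (μ : Measure E) [μ.IsAddHaarMeasure]

/-- `g * conj J` -/
noncomputable def GG (f : E → E) (g : E → ℂ) (x : E) : ℂ := g x * conj ((fderiv ℂ f x).det)

lemma GG_cont {Ω : Set E} (hΩ : IsOpen Ω) {f : E → E} (hf : DifferentiableOn ℂ f Ω)
    {g : E → ℂ} (hg : DifferentiableOn ℂ g Ω) : ContinuousOn (GG f g) Ω :=
  hg.continuousOn.mul (Complex.continuous_conj.comp_continuousOn (jac_differentiableOn hΩ hf).continuousOn)

lemma fubini_HH {Ω W K : Set E} (hΩ : IsOpen Ω) {f : E → E} (hf : DifferentiableOn ℂ f Ω)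
    (hprop : ∀ K ⊆ W, IsCompact K → IsCompact (f ⁻¹' K ∩ Ω))
    {g : E → ℂ} (hg : DifferentiableOn ℂ g Ω) {ρ : E → ℝ}
    (hρ : Continuous ρ) (hρs : HasCompactSupport ρ) (hK : IsCompact K) {Φ : E → ℂ} (hΦ : Continuous Φ)
    (hΦK : ∀ x, x ∉ K → Φ x = 0)
    (hVW : ∀ a ∈ K, ∀ y ∈ tsupport ρ, a + y ∈ W) :
    Integrable (fun a => Φ a * HH μ Ω f g ρ a) μ ∧
    IntegrableOn (fun x => GG f g x * ∫ a, Φ a * (ρ (f x - a) : ℂ) ∂μ) Ω μ ∧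
    ∫ a, Φ a * HH μ Ω f g ρ a ∂μ = ∫ x in Ω, GG f g x * ∫ a, Φ a * (ρ (f x - a) : ℂ) ∂μ ∂μ := by
  have : ProperSpace E := FiniteDimensional.proper ℂ E
  set K' : Set E := (fun p : E × E => p.1 + p.2) '' (K ×ˢ tsupport ρ) with hK'
  have hKc : IsCompact K' := (hK.prod hρs).image (by fun_prop)
  have hKW : K' ⊆ W := by
    rintro _ ⟨p, ⟨h1, h2⟩, rfl⟩
    exact hVW _ h1 _ h2
  set L := f ⁻¹' K' ∩ Ω with hLdef
  have hL : IsCompact L := hprop K' hKW hKc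
  have hLΩ : L ⊆ Ω := inter_subset_right
  have hGc := GG_cont hΩ hf hg
  obtain ⟨M, hM⟩ := hL.exists_bound_of_continuousOn (hGc.mono hLΩ)
  obtain ⟨B, hB⟩ := hρ.bounded_above_of_compact_support hρs
  obtain ⟨A, hA⟩ := hΦ.bounded_above_of_compact_support (HasCompactSupport.intro hK hΦK)
  have hA0 : 0 ≤ A := (norm_nonneg _).trans (hA 0)
  have hB0 : 0 ≤ B := (norm_nonneg _).trans (hB 0)
  let P : E × E → ℂ := fun p => Φ p.2 * (GG f g p.1 * (ρ (f p.1 - p.2) : ℂ))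
  have hPc : ContinuousOn P (Ω ×ˢ univ) := by
    have h1 : ContinuousOn (fun p : E × E => f p.1) (Ω ×ˢ univ) :=
      hf.continuousOn.comp continuous_fst.continuousOn (fun p hp => hp.1)
    have h2 : ContinuousOn (fun p : E × E => GG f g p.1) (Ω ×ˢ univ) :=
      hGc.comp continuous_fst.continuousOn (fun p hp => hp.1)
    exact (hΦ.comp continuous_snd).continuousOn.mul (h2.mul
      (Complex.continuous_ofReal.comp_continuousOn (hρ.comp_continuousOn (h1.sub continuous_snd.continuousOn))))
  have hmeas : (μ.restrict Ω).prod μ = (μ.prod μ).restrict (Ω ×ˢ univ) := by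
    rw [← Measure.prod_restrict, Measure.restrict_univ]
  have hPm : AEStronglyMeasurable P ((μ.restrict Ω).prod μ) := by
    rw [hmeas]
    exact hPc.aestronglyMeasurable (hΩ.measurableSet.prod MeasurableSet.univ)
  have hPi : Integrable P ((μ.restrict Ω).prod μ) := by
    have hi : Integrable ((L ×ˢ K).indicator fun _ => A * (M * B)) ((μ.restrict Ω).prod μ) := by
      rw [hmeas]
      refine Integrable.mono_measure ?_ Measure.restrict_le_self
      rw [integrable_indicator_iff (hL.isClosed.measurableSet.prod hK.isClosed.measurableSet)]
      exact integrableOn_const (hL.prod hK).measure_lt_top.ne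
    refine hi.mono' hPm ?_
    rw [hmeas]
    refine (ae_restrict_iff' (hΩ.measurableSet.prod MeasurableSet.univ)).2 (Eventually.of_forall ?_)
    rintro ⟨x, a⟩ ⟨hx, -⟩
    by_cases ha : a ∈ K
    · by_cases hxL : x ∈ L
      · rw [indicator_of_mem (mk_mem_prod hxL ha)]
        simp only [P, norm_mul, Complex.norm_real]
        have hM0 : 0 ≤ M := (norm_nonneg _).trans (hM x hxL)
        exact mul_le_mul (hA a) (mul_le_mul (hM x hxL) (hB _) (norm_nonneg _) hM0)
          (by positivity) hA0
      · have : ρ (f x - a) = 0 := by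
          apply image_eq_zero_of_notMem_tsupport
          intro h
          exact hxL ⟨⟨(a, f x - a), ⟨ha, h⟩, by simp⟩, hx⟩
        rw [indicator_of_notMem (fun h => hxL h.1)]
        simp [P, this]
    · rw [indicator_of_notMem (fun h => ha h.2)]
      simp [P, hΦK a ha]
  have e1 : ∀ a, Φ a * HH μ Ω f g ρ a = ∫ x in Ω, P (x, a) ∂μ := by
    intro a
    simp only [P, integral_const_mul]
    rfl
  have e2 : ∀ x, GG f g x * ∫ a, Φ a * (ρ (f x - a) : ℂ) ∂μ = ∫ a, P (x, a) ∂μ := by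
    intro x
    rw [← integral_const_mul]
    congr 1
    funext a
    simp only [P]
    ring
  simp only [e1, e2]
  refine ⟨hPi.integral_prod_right, hPi.integral_prod_left, ?_⟩
  exact (integral_integral_swap (f := fun x a => P (x, a)) hPi).symm

/-- a sequence of bumps -/
noncomputable def bj (E : Type*) [NormedAddCommGroup E] (j : ℕ) : ContDiffBump (0 : E) where
  rIn := 1 / ((j : ℝ) + 2)
  rOut := 1 / ((j : ℝ) + 1)
  rIn_pos := by positivity
  rIn_lt_rOut := by
    apply one_div_lt_one_div_of_lt
    · positivity
    · linarith

/-- normalized bumps -/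
noncomputable def rj (j : ℕ) : E → ℝ := (bj E j).normed μ

lemma rj_nonneg (j : ℕ) (x : E) : 0 ≤ rj μ j x := (bj E j).nonneg_normed x
lemma rj_int (j : ℕ) : ∫ x, rj μ j x ∂μ = 1 := (bj E j).integral_normed
lemma rj_integrable (j : ℕ) : Integrable (rj μ j) μ := (bj E j).integrable_normed
lemma rj_contDiff (j : ℕ) : ContDiff ℝ 1 (rj μ j) := by
  have := (bj E j).contDiff_normed (μ := μ) (n := 1)
  exact_mod_cast this
lemma rj_tsupport (j : ℕ) : tsupport (rj μ j) = closedBall 0 (1 / ((j : ℝ) + 1)) :=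
  (bj E j).tsupport_normed_eq
lemma rj_compact (j : ℕ) : HasCompactSupport (rj μ j) := (bj E j).hasCompactSupport_normed

lemma rj_int_shift (j : ℕ) (y : E) : ∫ a, rj μ j (y - a) ∂μ = 1 := by
  rw [integral_sub_left_eq_self (rj μ j) μ y]
  exact rj_int μ j

lemma rj_integrable_shift (j : ℕ) (y : E) : Integrable (fun a => rj μ j (y - a)) μ := by
  exact (rj_integrable μ j).comp_sub_left y

lemma conv_bound (j : ℕ) {Φ : E → ℂ} (hΦ : Continuous Φ) {ε : ℝ} (y : E)
    (h : ∀ a, dist a y ≤ 1 / ((j : ℝ) + 1) → ‖Φ a - Φ y‖ ≤ ε) :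
    ‖∫ a, Φ a * (rj μ j (y - a) : ℂ) ∂μ - Φ y‖ ≤ ε := by
  have : ProperSpace E := FiniteDimensional.proper ℂ E
  have hsupp : ∀ ψ : E → ℂ, Continuous ψ → Integrable (fun a => ψ a * (rj μ j (y - a) : ℂ)) μ := by
    intro ψ hψ
    apply Continuous.integrable_of_hasCompactSupport
    · exact hψ.mul (Complex.continuous_ofReal.comp ((rj_contDiff μ j).continuous.comp (by fun_prop)))
    · apply HasCompactSupport.intro (isCompact_closedBall y (1 / ((j : ℝ) + 1)))
      intro a ha
      have : rj μ j (y - a) = 0 := by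
        apply image_eq_zero_of_notMem_tsupport
        rw [rj_tsupport]
        simpa [dist_eq_norm, norm_sub_rev] using ha
      simp [this]
  have e1 : Φ y = ∫ a, Φ y * (rj μ j (y - a) : ℂ) ∂μ := by
    rw [integral_const_mul, integral_complex_ofReal, rj_int_shift]
    simp
  rw [e1, ← integral_sub (hsupp Φ hΦ) (hsupp _ continuous_const)]
  have e2 : ε = ∫ a, ε * rj μ j (y - a) ∂μ := by
    rw [integral_const_mul, rj_int_shift, mul_one]
  rw [e2]
  refine norm_integral_le_of_norm_le ((rj_integrable_shift μ j y).const_mul ε) (Eventually.of_forall fun a => ?_)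
  rw [← sub_mul, norm_mul, Complex.norm_real, Real.norm_of_nonneg (rj_nonneg μ j _)]
  by_cases ha : dist a y ≤ 1 / ((j : ℝ) + 1)
  · exact mul_le_mul_of_nonneg_right (h a ha) (rj_nonneg μ j _)
  · have : rj μ j (y - a) = 0 := by
      apply image_eq_zero_of_notMem_tsupport
      rw [rj_tsupport]
      rw [dist_eq_norm, norm_sub_rev] at ha
      simpa using ha
    simp [this]

lemma exists_margin {W K : Set E} (hW : IsOpen W) (hK : IsCompact K) (hKW : K ⊆ W) :
    ∃ δ > 0, IsCompact (cthickening δ K) ∧ cthickening δ K ⊆ W ∧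
      ∀ᶠ j : ℕ in atTop, 1 / ((j : ℝ) + 1) ≤ δ / 2 := by
  have : ProperSpace E := FiniteDimensional.proper ℂ E
  obtain ⟨δ, hδ, h⟩ := hK.exists_cthickening_subset_open hW hKW
  refine ⟨δ, hδ, hK.cthickening, h, ?_⟩
  exact (tendsto_one_div_add_atTop_nhds_zero_nat (𝕜 := ℝ)).eventually_le_const (half_pos hδ)

lemma T_tendsto {Ω W K : Set E} (hΩ : IsOpen Ω) (hW : IsOpen W) {f : E → E} (hf : DifferentiableOn ℂ f Ω)
    (hprop : ∀ K ⊆ W, IsCompact K → IsCompact (f ⁻¹' K ∩ Ω))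
    {g : E → ℂ} (hg : DifferentiableOn ℂ g Ω) (hK : IsCompact K) (hKW : K ⊆ W) {Φ : E → ℂ}
    (hΦ : Continuous Φ) (hΦK : ∀ x, x ∉ K → Φ x = 0) :
    IntegrableOn (fun x => GG f g x * Φ (f x)) Ω μ ∧
    Tendsto (fun j => ∫ a, Φ a * HH μ Ω f g (rj μ j) a ∂μ) atTop (𝓝 (∫ x in Ω, GG f g x * Φ (f x) ∂μ)) := by
  have : ProperSpace E := FiniteDimensional.proper ℂ E
  obtain ⟨δ, hδ, hcK, hKδ, hj⟩ := exists_margin hW hK hKW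
  set L := f ⁻¹' (cthickening δ K) ∩ Ω with hLdef
  have hL : IsCompact L := hprop _ hKδ hcK
  have hLΩ : L ⊆ Ω := inter_subset_right
  have hGc := GG_cont hΩ hf hg
  have hGi : IntegrableOn (fun x => ‖GG f g x‖) L μ :=
    ((hGc.mono hLΩ).norm).integrableOn_compact hL
  have hΦu : UniformContinuous Φ := hΦ.uniformContinuous_of_tendsto_cocompact
    (HasCompactSupport.intro hK hΦK).is_zero_at_infty
  have hi0 : IntegrableOn (fun x => GG f g x * Φ (f x)) Ω μ := by
    have h1 : IntegrableOn (fun x => GG f g x * Φ (f x)) L μ :=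
      ((hGc.mul (hΦ.comp_continuousOn hf.continuousOn)).mono hLΩ).integrableOn_compact hL
    refine IntegrableOn.of_forall_sdiff_eq_zero h1 hΩ.measurableSet ?_
    rintro x ⟨hx, hxL⟩
    have : Φ (f x) = 0 := hΦK _ fun h => hxL ⟨self_subset_cthickening K h, hx⟩
    simp [this]
  refine ⟨hi0, ?_⟩
  rw [Metric.tendsto_nhds]
  intro ε hε
  set I := ∫ x in L, ‖GG f g x‖ ∂μ with hI
  have hI0 : 0 ≤ I := integral_nonneg fun x => norm_nonneg _
  set ε' := ε / (2 * (I + 1)) with hε'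
  have hε'0 : 0 < ε' := by positivity
  obtain ⟨η, hη, hηΦ⟩ := Metric.uniformContinuous_iff.1 hΦu ε' hε'0
  have hjη : ∀ᶠ j : ℕ in atTop, 1 / ((j : ℝ) + 1) < η :=
    (tendsto_one_div_add_atTop_nhds_zero_nat (𝕜 := ℝ)).eventually_lt_const hη
  filter_upwards [hj, hjη] with j hj hjη
  have hmar : ∀ a ∈ K, ∀ y ∈ tsupport (rj μ j), a + y ∈ cthickening δ K := by
    intro a ha y hy
    rw [rj_tsupport] at hy
    apply mem_cthickening_of_dist_le _ a _ _ ha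
    rw [mem_closedBall_zero_iff] at hy
    simp only [dist_self_add_left]
    linarith
  obtain ⟨-, h2, h3⟩ := fubini_HH μ hΩ hf hprop hg (rj_contDiff μ j).continuous (rj_compact μ j) hK hΦ hΦK
    (fun a ha y hy => hKδ (hmar a ha y hy))
  rw [h3, dist_eq_norm, ← integral_sub h2 hi0]
  have hb : ‖∫ x in Ω, (GG f g x * ∫ a, Φ a * (rj μ j (f x - a) : ℂ) ∂μ) - GG f g x * Φ (f x) ∂μ‖ ≤
      ∫ x in Ω, L.indicator (fun x => ‖GG f g x‖ * ε') x ∂μ := by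
    refine norm_integral_le_of_norm_le ?_ ?_
    · rw [integrable_indicator_iff hL.isClosed.measurableSet]
      exact (hGi.mono_measure Measure.restrict_le_self).mul_const _
    · refine (ae_restrict_iff' hΩ.measurableSet).2 (Eventually.of_forall fun x hx => ?_)
      by_cases hxL : x ∈ L
      · rw [indicator_of_mem hxL, ← mul_sub, norm_mul]
        refine mul_le_mul_of_nonneg_left ?_ (norm_nonneg _)
        apply conv_bound μ j hΦ
        intro a ha
        rw [← dist_eq_norm]
        exact (hηΦ (ha.trans_lt hjη)).le
      · rw [indicator_of_notMem hxL]
        have h4 : Φ (f x) = 0 := hΦK _ fun h => hxL ⟨self_subset_cthickening K h, hx⟩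
        have h5 : ∀ a, Φ a * (rj μ j (f x - a) : ℂ) = 0 := by
          intro a
          by_cases ha : a ∈ K
          · have : rj μ j (f x - a) = 0 := by
              apply image_eq_zero_of_notMem_tsupport
              intro h
              apply hxL
              refine ⟨?_, hx⟩
              have := hmar a ha _ h
              simpa using this
            simp [this]
          · simp [hΦK a ha]
        simp [h4, h5]
  refine hb.trans_lt ?_
  rw [integral_indicator hL.isClosed.measurableSet, Measure.restrict_restrict hL.isClosed.measurableSet,
    inter_eq_self_of_subset_left hLΩ, integral_mul_const, ← hI, hε']
  rw [mul_div_assoc', div_lt_iff₀ (by positivity)]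
  nlinarith

end lemmaU
end FBHProof
end

section
open Set Filter Topology MeasureTheory Metric
open scoped Nat ComplexConjugate
set_option linter.unusedSectionVars false
namespace FBHProof

section lemmaU
variable {E : Type*} [NormedAddCommGroup E] [NormedSpace ℂ E] [FiniteDimensional ℂ E]
  [MeasurableSpace E] [BorelSpace E] (μ : Measure E) [μ.IsAddHaarMeasure]

/-- cone function -/
noncomputable def cone (ε : ℝ) (x : E) : ℝ := max 0 (ε - ‖x‖)

lemma cone_cont (ε : ℝ) : Continuous (cone (E := E) ε) := by
  unfold cone; fun_prop

lemma cone_nonneg (ε : ℝ) (x : E) : 0 ≤ cone ε x := le_max_left _ _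

lemma cone_le {ε : ℝ} (hε : 0 ≤ ε) (x : E) : cone ε x ≤ ε :=
  max_le hε (by linarith [norm_nonneg x])

lemma cone_zero {ε : ℝ} {x : E} (hx : x ∉ closedBall (0 : E) ε) : cone ε x = 0 := by
  rw [mem_closedBall_zero_iff, not_le] at hx
  exact max_eq_left (by linarith)

lemma cone_int_pos {ε : ℝ} (hε : 0 < ε) : 0 < ∫ x, cone (E := E) ε x ∂μ := by
  have : ProperSpace E := FiniteDimensional.proper ℂ E
  refine Continuous.integral_pos_of_hasCompactSupport_nonneg_nonzero (x := 0) (cone_cont ε)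
    (HasCompactSupport.intro (isCompact_closedBall 0 ε) fun x hx => cone_zero hx) (cone_nonneg ε) ?_
  simp [cone, hε.le, hε.ne']

lemma HH_bound {Ω W : Set E} (hΩ : IsOpen Ω) {f : E → E} (hf : DifferentiableOn ℂ f Ω)
    (hprop : ∀ K ⊆ W, IsCompact K → IsCompact (f ⁻¹' K ∩ Ω)) {ε : ℝ} (hε : 0 < ε)
    (hεW : closedBall 0 (4 * ε) ⊆ W)
    {g : E → ℂ} (hg : DifferentiableOn ℂ g Ω) {M : ℝ}
    (hM : ∀ x ∈ f ⁻¹' (closedBall 0 (4 * ε)) ∩ Ω, ‖g x‖ ≤ M) (j : ℕ) (hj : 1 / ((j : ℝ) + 1) ≤ ε)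
    (a : E) (ha : ‖a‖ ≤ ε) :
    ‖HH μ Ω f g (rj μ j) a‖ ≤
      (ε * (∫ x in f ⁻¹' (closedBall 0 (4 * ε)) ∩ Ω, ‖(fderiv ℂ f x).det‖ ∂μ) /
        ∫ x, cone (E := E) ε x ∂μ) * M := by
  have : ProperSpace E := FiniteDimensional.proper ℂ E
  set L := f ⁻¹' (closedBall 0 (4 * ε)) ∩ Ω with hLdef
  have hL : IsCompact L := hprop _ hεW (isCompact_closedBall _ _)
  have hLΩ : L ⊆ Ω := inter_subset_right
  have hJ := jac_differentiableOn hΩ hf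
  have hJi : IntegrableOn (fun x => ‖(fderiv ℂ f x).det‖) L μ :=
    ((hJ.continuousOn.mono hLΩ).norm).integrableOn_compact hL
  have hpos := cone_int_pos (E := E) μ hε
  have hts : ∀ y ∈ tsupport (rj (E := E) μ j), ‖y‖ ≤ ε := by
    intro y hy
    rw [rj_tsupport, mem_closedBall_zero_iff] at hy
    linarith
  have hH : DifferentiableOn ℂ (HH μ Ω f g (rj μ j)) (ball 0 (3 * ε)) := by
    refine HH_hol μ hΩ hf hprop hg (rj_contDiff μ j) (rj_compact μ j) isOpen_ball ?_
    intro b hb y hy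
    apply hεW
    rw [mem_ball_zero_iff] at hb
    rw [mem_closedBall_zero_iff]
    have := norm_add_le b y
    have := hts y hy
    linarith
  let Φ : E → ℂ := fun b => (cone ε (b - a) : ℂ)
  have hΦ : Continuous Φ := Complex.continuous_ofReal.comp ((cone_cont ε).comp (by fun_prop))
  have hΦ0 : ∀ x, x ∉ closedBall (0:E) (2 * ε) → Φ x = 0 := by
    intro x hx
    have : cone ε (x - a) = 0 := by
      apply cone_zero
      rw [mem_closedBall_zero_iff, not_le] at hx ⊢
      have := norm_le_norm_sub_add x a
      linarith
    simp [Φ, this]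
  obtain ⟨h1, h2, h3⟩ := fubini_HH μ hΩ hf hprop hg (rj_contDiff μ j).continuous (rj_compact μ j)
    (isCompact_closedBall (0:E) (2 * ε)) hΦ hΦ0 (by
      intro b hb y hy
      apply hεW
      rw [mem_closedBall_zero_iff] at hb ⊢
      have := norm_add_le b y
      have := hts y hy
      linarith)
  have hshift : Integrable (fun x => (cone ε x : ℂ) * HH μ Ω f g (rj μ j) (a + x)) μ := by
    have := h1.comp_add_left a
    simpa [Φ] using this
  have hmv := mean_value μ isOpen_ball hH a (ρ := fun x => (cone ε x : ℂ))
    (by intro θ x; simp [cone, norm_smul]) (by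
      intro x hx ζ hζ
      have hx' : x ∈ closedBall (0:E) ε := by
        by_contra h
        exact hx (by simp [cone_zero h])
      rw [mem_closedBall_zero_iff] at hx'
      rw [mem_ball_zero_iff]
      have h4 := norm_add_le a (ζ • x)
      rw [norm_smul] at h4
      have h5 : ‖ζ‖ * ‖x‖ ≤ 1 * ε := mul_le_mul hζ hx' (norm_nonneg _) zero_le_one
      linarith) hshift
  have e1 : ∫ x, (cone ε x : ℂ) * HH μ Ω f g (rj μ j) (a + x) ∂μ = ∫ b, Φ b * HH μ Ω f g (rj μ j) b ∂μ := by
    rw [← integral_add_left_eq_self (fun b => Φ b * HH μ Ω f g (rj μ j) b) a]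
    simp [Φ]
  have hb : ‖∫ x in Ω, GG f g x * ∫ b, Φ b * (rj μ j (f x - b) : ℂ) ∂μ ∂μ‖ ≤
      ∫ x in Ω, L.indicator (fun x => ‖(fderiv ℂ f x).det‖ * (M * ε)) x ∂μ := by
    refine norm_integral_le_of_norm_le ?_ ?_
    · rw [integrable_indicator_iff hL.isClosed.measurableSet]
      exact (hJi.mono_measure Measure.restrict_le_self).mul_const _
    · refine (ae_restrict_iff' hΩ.measurableSet).2 (Eventually.of_forall fun x hx => ?_)
      by_cases hxL : x ∈ L
      · rw [indicator_of_mem hxL, norm_mul, GG, norm_mul, RCLike.norm_conj]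
        have h6 : ‖∫ b, Φ b * (rj μ j (f x - b) : ℂ) ∂μ‖ ≤ ε := by
          have e2 : ε = ∫ b, ε * rj μ j (f x - b) ∂μ := by
            rw [integral_const_mul, rj_int_shift, mul_one]
          conv_rhs => rw [e2]
          refine norm_integral_le_of_norm_le ((rj_integrable_shift μ j _).const_mul ε)
            (Eventually.of_forall fun b => ?_)
          rw [norm_mul, Complex.norm_real, Complex.norm_real, Real.norm_of_nonneg (rj_nonneg μ j _),
            Real.norm_of_nonneg (cone_nonneg _ _)]
          exact mul_le_mul_of_nonneg_right (cone_le hε.le _) (rj_nonneg μ j _)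
        have h7 := hM x hxL
        have h8 := mul_le_mul h7 h6 (norm_nonneg _) ((norm_nonneg _).trans h7)
        calc _ = ‖(fderiv ℂ f x).det‖ * (‖g x‖ * ‖∫ b, Φ b * (rj μ j (f x - b) : ℂ) ∂μ‖) := by ring
          _ ≤ _ := mul_le_mul_of_nonneg_left h8 (norm_nonneg _)
      · rw [indicator_of_notMem hxL]
        have h5 : ∀ b, Φ b * (rj μ j (f x - b) : ℂ) = 0 := by
          intro b
          by_cases hb : b ∈ closedBall (0:E) (2 * ε)
          · have : rj μ j (f x - b) = 0 := by
              apply image_eq_zero_of_notMem_tsupport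
              intro h
              apply hxL
              refine ⟨?_, hx⟩
              have h9 := hts _ h
              rw [mem_closedBall_zero_iff] at hb
              have := norm_le_norm_sub_add (f x) b
              simp only [mem_preimage, mem_closedBall_zero_iff]
              linarith
            simp [this]
          · simp [hΦ0 b hb]
        simp [h5]
  rw [integral_indicator hL.isClosed.measurableSet, Measure.restrict_restrict hL.isClosed.measurableSet,
    inter_eq_self_of_subset_left hLΩ, integral_mul_const, ← h3, ← e1, hmv, norm_mul,
    integral_complex_ofReal, Complex.norm_real, Real.norm_of_nonneg hpos.le] at hb
  rw [div_mul_eq_mul_div, le_div_iff₀ hpos]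
  linarith

/-- data for the test functions -/
structure TestData (W K : Set E) (k : ℕ) (Φ : E → ℂ) : Prop where
  comp : IsCompact K
  sub : K ⊆ W
  bal : ∀ x ∈ K, ∀ ζ : ℂ, ‖ζ‖ ≤ 1 → ζ • x ∈ K
  cont : Continuous Φ
  zero : ∀ x, x ∉ K → Φ x = 0
  rot : ∀ (θ : ℝ) x, Φ (circleMap 0 1 θ • x) = ((circleMap 0 1 θ) ^ k)⁻¹ * Φ x

lemma TestData.key {Ω W K : Set E} {k : ℕ} {Φ : E → ℂ} (hT : TestData W K k Φ) (hΩ : IsOpen Ω) (hW : IsOpen W)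
    {f : E → E} (hf : DifferentiableOn ℂ f Ω)
    (hprop : ∀ K ⊆ W, IsCompact K → IsCompact (f ⁻¹' K ∩ Ω)) {g : E → ℂ} (hg : DifferentiableOn ℂ g Ω) :
    ∀ᶠ j : ℕ in atTop, ∫ a, Φ a * HH μ Ω f g (rj μ j) a ∂μ =
      ∫ a, Φ a * hp k (HH μ Ω f g (rj μ j)) a ∂μ := by
  have : ProperSpace E := FiniteDimensional.proper ℂ E
  obtain ⟨δ, hδ, hcK, hKδ, hj⟩ := exists_margin hW hT.comp hT.sub
  filter_upwards [hj] with j hj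
  have hmar : ∀ a ∈ thickening (δ / 2) K, ∀ y ∈ tsupport (rj μ j), a + y ∈ W := by
    intro a ha y hy
    rw [rj_tsupport] at hy
    apply hKδ
    rw [mem_thickening_iff] at ha
    obtain ⟨z, hz, hza⟩ := ha
    apply mem_cthickening_of_dist_le _ z _ _ hz
    rw [mem_closedBall_zero_iff] at hy
    have h1 := dist_triangle (a + y) a z
    simp only [dist_self_add_left] at h1
    linarith
  have hH : DifferentiableOn ℂ (HH μ Ω f g (rj μ j)) (thickening (δ / 2) K) :=
    HH_hol μ hΩ hf hprop hg (rj_contDiff μ j) (rj_compact μ j) isOpen_thickening hmar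
  obtain ⟨h1, -, -⟩ := fubini_HH μ hΩ hf hprop hg (rj_contDiff μ j).continuous (rj_compact μ j)
    hT.comp hT.cont hT.zero (fun a ha => hmar a (self_subset_thickening (half_pos hδ) _ ha))
  refine int_hom μ k isOpen_thickening hH hT.rot ?_ h1
  intro x hx ζ hζ
  refine self_subset_thickening (half_pos hδ) _ (hT.bal x ?_ ζ hζ)
  by_contra h
  exact hx (hT.zero x h)

/-- Lemma U, bound -/
theorem lemmaU_bound {Ω W : Set E} (hΩ : IsOpen Ω) (hW : IsOpen W) (h0 : (0 : E) ∈ W)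
    {f : E → E} (hf : DifferentiableOn ℂ f Ω)
    (hprop : ∀ K ⊆ W, IsCompact K → IsCompact (f ⁻¹' K ∩ Ω)) :
    ∃ L : Set E, IsCompact L ∧ L ⊆ Ω ∧ ∃ C ε : ℝ, 0 ≤ C ∧ 0 < ε ∧ ∀ g : E → ℂ, DifferentiableOn ℂ g Ω →
      ∀ M : ℝ, (∀ x ∈ L, ‖g x‖ ≤ M) → ∀ (k : ℕ) (Φ : E → ℂ) (K : Set E), TestData W K k Φ →
        ‖∫ x in Ω, GG f g x * Φ (f x) ∂μ‖ ≤ C * M * ∫ y, ‖Φ y‖ * (‖y‖ / ε) ^ k ∂μ := by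
  have : ProperSpace E := FiniteDimensional.proper ℂ E
  obtain ⟨r, hr, hrW⟩ := Metric.nhds_basis_closedBall.mem_iff.1 (hW.mem_nhds h0)
  set ε := r / 4 with hε
  have hε0 : 0 < ε := by positivity
  have hεW : closedBall 0 (4 * ε) ⊆ W := by
    have : 4 * ε = r := by rw [hε]; ring
    rwa [this]
  set L := f ⁻¹' (closedBall 0 (4 * ε)) ∩ Ω with hLdef
  have hL : IsCompact L := hprop _ hεW (isCompact_closedBall _ _)
  have hLΩ : L ⊆ Ω := inter_subset_right
  set C := ε * (∫ x in L, ‖(fderiv ℂ f x).det‖ ∂μ) / ∫ x, cone (E := E) ε x ∂μ with hC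
  have hC0 : 0 ≤ C := by
    have := cone_int_pos (E := E) μ hε0
    have : 0 ≤ ∫ x in L, ‖(fderiv ℂ f x).det‖ ∂μ := integral_nonneg fun x => norm_nonneg _
    positivity
  refine ⟨L, hL, hLΩ, C, ε, hC0, hε0, ?_⟩
  intro g hg M hM k Φ K hT
  have hlim := (T_tendsto μ hΩ hW hf hprop hg hT.comp hT.sub hT.cont hT.zero).2
  refine le_of_tendsto hlim.norm ?_
  have hjε : ∀ᶠ j : ℕ in atTop, 1 / ((j : ℝ) + 1) ≤ ε :=
    (tendsto_one_div_add_atTop_nhds_zero_nat (𝕜 := ℝ)).eventually_le_const hε0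
  filter_upwards [hT.key μ hΩ hW hf hprop hg, hjε] with j hkey hj
  rw [hkey, ← integral_const_mul]
  refine norm_integral_le_of_norm_le ?_ ?_
  · apply Integrable.const_mul
    apply Continuous.integrable_of_hasCompactSupport
    · have := hT.cont
      fun_prop
    · apply HasCompactSupport.intro hT.comp
      intro x hx
      simp [hT.zero x hx]
  · refine Eventually.of_forall fun y => ?_
    rw [norm_mul]
    have hH : DifferentiableOn ℂ (HH μ Ω f g (rj μ j)) (ball 0 (3 * ε)) := by
      refine HH_hol μ hΩ hf hprop hg (rj_contDiff μ j) (rj_compact μ j) isOpen_ball ?_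
      intro b hb y hy
      apply hεW
      rw [mem_ball_zero_iff] at hb
      rw [mem_closedBall_zero_iff]
      have := norm_add_le b y
      rw [rj_tsupport, mem_closedBall_zero_iff] at hy
      linarith
    have hhp : ‖hp k (HH μ Ω f g (rj μ j)) y‖ ≤ C * M * (‖y‖ / ε) ^ k := by
      by_cases hy : y = 0
      · have hb : ‖hp k (HH μ Ω f g (rj μ j)) 0‖ ≤ C * M := by
          refine hp_norm_le k isOpen_ball hH (x := 0) ?_ ?_
          · intro ζ _; simpa using hε0
          · intro ζ _
            exact HH_bound μ hΩ hf hprop hε0 hεW hg hM j hj _ (by simpa using hε0.le)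
        rw [hy]
        rcases k with _ | k
        · simpa using hb
        · have := hp_smul (k + 1) (HH μ Ω f g (rj μ j)) 0 (0 : E)
          rw [smul_zero] at this
          rw [this]
          simp
      · have hny : 0 < ‖y‖ := norm_pos_iff.2 hy
        set c : ℂ := ((‖y‖ / ε : ℝ) : ℂ) with hc
        set y' : E := ((ε / ‖y‖ : ℝ) : ℂ) • y with hy'
        have hyy : y = c • y' := by
          rw [hc, hy', smul_smul, ← Complex.ofReal_mul]
          have : ‖y‖ / ε * (ε / ‖y‖) = 1 := by field_simp
          rw [this]; simp
        have hny' : ‖y'‖ = ε := by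
          rw [hy', norm_smul, Complex.norm_real, Real.norm_of_nonneg (by positivity)]
          field_simp
        have hb : ‖hp k (HH μ Ω f g (rj μ j)) y'‖ ≤ C * M := by
          refine hp_norm_le k isOpen_ball hH (x := y') ?_ ?_
          · intro ζ hζ
            rw [mem_ball_zero_iff, norm_smul, hny']
            nlinarith
          · intro ζ hζ
            exact HH_bound μ hΩ hf hprop hε0 hεW hg hM j hj _ (by rw [norm_smul, hζ, hny', one_mul])
        rw [hyy, hp_smul, norm_mul, norm_pow, ← hyy, hc, Complex.norm_real,
          Real.norm_of_nonneg (by positivity : 0 ≤ ‖y‖ / ε), mul_comm]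
        exact mul_le_mul_of_nonneg_right hb (by positivity)
    calc _ ≤ ‖Φ y‖ * (C * M * (‖y‖ / ε) ^ k) := mul_le_mul_of_nonneg_left hhp (norm_nonneg _)
      _ = _ := by ring

/-- Lemma U, degree zero -/
theorem lemmaU_zero {Ω W K K1 : Set E} (hΩ : IsOpen Ω) (hW : IsOpen W)
    {f : E → E} (hf : DifferentiableOn ℂ f Ω)
    (hprop : ∀ K ⊆ W, IsCompact K → IsCompact (f ⁻¹' K ∩ Ω)) {g : E → ℂ} (hg : DifferentiableOn ℂ g Ω)
    {Φ Φ1 : E → ℂ} (hT : TestData W K 0 Φ) (hT1 : TestData W K1 0 Φ1) :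
    (∫ x in Ω, GG f g x * Φ (f x) ∂μ) * (∫ y, Φ1 y ∂μ) =
      (∫ x in Ω, GG f g x * Φ1 (f x) ∂μ) * (∫ y, Φ y ∂μ) := by
  have hlim := (T_tendsto μ hΩ hW hf hprop hg hT.comp hT.sub hT.cont hT.zero).2
  have hlim1 := (T_tendsto μ hΩ hW hf hprop hg hT1.comp hT1.sub hT1.cont hT1.zero).2
  refine tendsto_nhds_unique (hlim.mul_const _) ?_
  refine (hlim1.mul_const _).congr' ?_
  filter_upwards [hT.key μ hΩ hW hf hprop hg, hT1.key μ hΩ hW hf hprop hg] with j h1 h2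
  rw [h1, h2]
  simp only [hp, iteratedDeriv_zero, zero_smul, integral_mul_const]
  ring

end lemmaU
end FBHProof
end

section
open Set Filter Topology MeasureTheory Metric
open scoped Nat ComplexConjugate
set_option linter.unusedSectionVars false
namespace FBHProof

section ltwo
variable {E : Type*} [NormedAddCommGroup E] [NormedSpace ℂ E] [FiniteDimensional ℂ E]

lemma CC.exhaust {W : Set E} (hW : CC W) (hne : Wᶜ.Nonempty) :
    ∃ ψ : ℕ → E → ℝ, (∀ N, Continuous (ψ N)) ∧ (∀ N x, 0 ≤ ψ N x) ∧ (∀ N x, ψ N x ≤ 1) ∧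
      (∀ N (ζ : ℂ) x, ‖ζ‖ = 1 → ψ N (ζ • x) = ψ N x) ∧
      (∀ N, ∃ K, IsCompact K ∧ K ⊆ W ∧ (∀ x ∈ K, ∀ ζ : ℂ, ‖ζ‖ ≤ 1 → ζ • x ∈ K) ∧ ∀ x, x ∉ K → ψ N x = 0) ∧
      ∀ x ∈ W, ∀ᶠ N in atTop, ψ N x = 1 := by
  have : ProperSpace E := FiniteDimensional.proper ℂ E
  have hcl : IsClosed Wᶜ := hW.isOpen.isClosed_compl
  have hdc : Continuous fun x => infDist x Wᶜ := continuous_infDist_pt Wᶜ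
  refine ⟨fun N y => min 1 (max 0 (N * infDist y Wᶜ - 1)) * min 1 (max 0 (N - ‖y‖)), ?_, ?_, ?_, ?_, ?_, ?_⟩
  · intro N; fun_prop
  · intro N x; positivity
  · intro N x
    exact mul_le_one₀ (min_le_left _ _) (by positivity) (min_le_left _ _)
  · intro N ζ x hζ
    have hζ0 : ζ ≠ 0 := by rw [← norm_ne_zero_iff, hζ]; exact one_ne_zero
    have hiso : Isometry fun y : E => ζ • y := by
      refine Isometry.of_dist_eq fun a b => ?_
      rw [dist_eq_norm, ← smul_sub, norm_smul, hζ, one_mul, dist_eq_norm]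
    have him : (fun y : E => ζ • y) '' Wᶜ = Wᶜ := by
      ext y
      constructor
      · rintro ⟨z, hz, rfl⟩ h
        apply hz
        have := hW.smul _ h ζ⁻¹ (by simp [hζ])
        simpa [hζ0] using this
      · intro hy
        refine ⟨ζ⁻¹ • y, fun h => hy ?_, by simp [hζ0]⟩
        have := hW.smul _ h ζ hζ.le
        simpa [hζ0] using this
    have h1 : infDist (ζ • x) Wᶜ = infDist x Wᶜ := by
      conv_lhs => rw [← him]
      exact infDist_image hiso
    simp only [h1, norm_smul, hζ, one_mul]
  · intro N
    set K0 : Set E := {y | 1 ≤ N * infDist y Wᶜ} ∩ closedBall 0 N with hK0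
    have hK0c : IsCompact K0 :=
      (isCompact_closedBall (0:E) N).inter_left (isClosed_le continuous_const (by fun_prop))
    have hK0W : K0 ⊆ W := by
      rintro y ⟨hy, -⟩
      by_contra h
      have : infDist y Wᶜ = 0 := infDist_zero_of_mem h
      simp only [mem_ofPred_eq, this, mul_zero] at hy
      linarith
    refine ⟨(fun p : ℂ × E => p.1 • p.2) '' (closedBall 0 1 ×ˢ K0),
      ((isCompact_closedBall (0:ℂ) 1).prod hK0c).image (by fun_prop), ?_, ?_, ?_⟩
    · rintro _ ⟨⟨ζ, y⟩, ⟨h1, h2⟩, rfl⟩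
      exact hW.smul _ (hK0W h2) _ (by simpa using h1)
    · rintro _ ⟨⟨ζ, y⟩, ⟨h1, h2⟩, rfl⟩ ξ hξ
      refine ⟨(ξ * ζ, y), ⟨?_, h2⟩, by simp [mul_smul]⟩
      simp only [mem_closedBall_zero_iff, norm_mul] at h1 ⊢
      exact mul_le_one₀ hξ (norm_nonneg _) h1
    · intro x hx
      have hx0 : x ∉ K0 := fun h => hx ⟨(1, x), ⟨by simp, h⟩, by simp⟩
      beta_reduce
      by_cases h1 : 1 ≤ N * infDist x Wᶜ
      · have h2 : (N:ℝ) < ‖x‖ := by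
          by_contra h
          exact hx0 ⟨h1, by simpa using h⟩
        rw [max_eq_left (by linarith : (N:ℝ) - ‖x‖ ≤ 0)]
        simp
      · rw [max_eq_left (by linarith : N * infDist x Wᶜ - 1 ≤ 0)]
        simp
  · intro x hx
    have hd : 0 < infDist x Wᶜ := (hcl.notMem_iff_infDist_pos hne).1 (fun h => h hx)
    have e1 : ∀ᶠ N : ℕ in atTop, 2 ≤ N * infDist x Wᶜ :=
      (tendsto_natCast_atTop_atTop.atTop_mul_const hd).eventually_ge_atTop 2
    have e2 : ∀ᶠ N : ℕ in atTop, 1 + ‖x‖ ≤ N := tendsto_natCast_atTop_atTop.eventually_ge_atTop _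
    filter_upwards [e1, e2] with N h1 h2
    rw [max_eq_right (by linarith), max_eq_right (by linarith), min_eq_left (by linarith),
      min_eq_left (by linarith), one_mul]

variable [MeasurableSpace E] [BorelSpace E] (μ : Measure E) [μ.IsAddHaarMeasure]

/-- `L²` bounds -/
theorem l2_bound {Ω W : Set E} (hΩ : IsOpen Ω) (hW : CC W) (hne : Wᶜ.Nonempty)
    (hmom : ∀ k : ℕ, IntegrableOn (fun y : E => ‖y‖ ^ k) W μ)
    {f : E → E} (hf : DifferentiableOn ℂ f Ω) (hmaps : MapsTo f Ω W)
    (hprop : ∀ K ⊆ W, IsCompact K → IsCompact (f ⁻¹' K ∩ Ω)) :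
    ∃ L : Set E, IsCompact L ∧ L ⊆ Ω ∧ ∀ (ℓ : E →L[ℂ] ℂ) (k : ℕ),
      IntegrableOn (fun x => ‖(fderiv ℂ f x).det * (ℓ (f x)) ^ k‖ ^ 2) Ω μ ∧
      ∃ C : ℝ, 0 ≤ C ∧ ∀ g : E → ℂ, DifferentiableOn ℂ g Ω → IntegrableOn (fun x => ‖g x‖ ^ 2) Ω μ →
        ∀ M : ℝ, 0 ≤ M → (∀ x ∈ L, ‖g x‖ ≤ M) →
        ‖∫ x in Ω, g x * conj ((fderiv ℂ f x).det * (ℓ (f x)) ^ k) ∂μ‖ ≤ C * M := by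
  have : ProperSpace E := FiniteDimensional.proper ℂ E
  obtain ⟨L, hL, hLΩ, C, ε, hC, hε, hU⟩ := lemmaU_bound μ hΩ hW.isOpen hW.zero hf hprop
  obtain ⟨ψ, hψc, hψ0, hψ1, hψr, hψK, hψlim⟩ := hW.exhaust hne
  refine ⟨L, hL, hLΩ, fun ℓ k => ?_⟩
  have hJ := jac_differentiableOn hΩ hf
  have hfc := hf.continuousOn
  set F : E → ℂ := fun x => (fderiv ℂ f x).det * (ℓ (f x)) ^ k with hF
  have hFc : ContinuousOn F Ω := hJ.continuousOn.mul ((ℓ.continuous.comp_continuousOn hfc).pow k)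
  have hℓ : ∀ y, ‖ℓ y‖ ^ k ≤ ‖ℓ‖ ^ k * ‖y‖ ^ k := by
    intro y
    rw [← mul_pow]
    exact pow_le_pow_left₀ (norm_nonneg _) (ℓ.le_opNorm y) k
  have hψW : ∀ N y, y ∉ W → ψ N y = 0 := by
    intro N y hy
    obtain ⟨K, -, hKW, -, hK⟩ := hψK N
    exact hK y fun h => hy (hKW h)
  -- part a
  have hsq : IntegrableOn (fun x => ‖F x‖ ^ 2) Ω μ := by
    obtain ⟨M, hM⟩ := hL.exists_bound_of_continuousOn (hJ.continuousOn.mono hLΩ)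
    set B : ℝ := C * M * ∫ y in W, (‖ℓ‖ ^ k) ^ 2 * ‖y‖ ^ (2 * k) ∂μ with hB
    have hmi : IntegrableOn (fun y : E => (‖ℓ‖ ^ k) ^ 2 * ‖y‖ ^ (2 * k)) W μ := (hmom _).const_mul _
    have hbd : ∀ N, IntegrableOn (fun x => ‖F x‖ ^ 2 * ψ N (f x)) Ω μ ∧
        ∫ x in Ω, ‖F x‖ ^ 2 * ψ N (f x) ∂μ ≤ |B| := by
      intro N
      obtain ⟨K, hK, hKW, hKb, hK0⟩ := hψK N
      let Φ : E → ℂ := fun y => ((‖ℓ y ^ k‖ ^ 2 * ψ N y : ℝ) : ℂ)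
      have hT : TestData W K 0 Φ := by
        refine ⟨hK, hKW, hKb, ?_, ?_, ?_⟩
        · have := hψc N
          fun_prop
        · intro x hx; simp [Φ, hK0 x hx]
        · intro θ x
          simp [Φ, hψr N _ x (norm_circle θ)]
      have hi := (T_tendsto μ hΩ hW.isOpen hf hprop hJ hT.comp hT.sub hT.cont hT.zero).1
      have e : ∀ x, GG f (fun x => (fderiv ℂ f x).det) x * Φ (f x) = ((‖F x‖ ^ 2 * ψ N (f x) : ℝ) : ℂ) := by
        intro x
        simp only [GG, Φ, hF]
        rw [Complex.mul_conj', norm_mul]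
        push_cast
        ring
      have h1 := hU _ hJ M hM 0 Φ K hT
      simp only [e] at hi h1
      have hi' : IntegrableOn (fun x => ‖F x‖ ^ 2 * ψ N (f x)) Ω μ := by
        have := hi.re
        simp only [RCLike.re_eq_complex_re, Complex.ofReal_re] at this
        exact this
      refine ⟨hi', ?_⟩
      rw [integral_complex_ofReal, Complex.norm_real, Real.norm_eq_abs] at h1
      refine (le_abs_self _).trans (h1.trans ((le_abs_self _).trans ?_))
      rw [hB, abs_mul, abs_mul (C * M)]
      refine mul_le_mul_of_nonneg_left ?_ (abs_nonneg _)
      rw [abs_of_nonneg (integral_nonneg fun y => by positivity),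
        abs_of_nonneg (integral_nonneg fun y => by positivity), ← integral_indicator hW.isOpen.measurableSet]
      refine integral_mono ?_ ((integrable_indicator_iff hW.isOpen.measurableSet).2 hmi) ?_
      · simp only [pow_zero, mul_one]
        exact (hT.cont.integrable_of_hasCompactSupport (HasCompactSupport.intro hK hT.zero)).norm
      · intro y
        simp only [pow_zero, mul_one]
        by_cases hy : y ∈ W
        · rw [indicator_of_mem hy]
          simp only [Φ, Complex.norm_real]
          rw [Real.norm_of_nonneg (mul_nonneg (by positivity) (hψ0 N y)), norm_pow]
          calc (‖ℓ y‖ ^ k) ^ 2 * ψ N y ≤ (‖ℓ y‖ ^ k) ^ 2 * 1 :=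
                mul_le_mul_of_nonneg_left (hψ1 N y) (by positivity)
            _ ≤ (‖ℓ‖ ^ k * ‖y‖ ^ k) ^ 2 := by
                rw [mul_one]
                exact pow_le_pow_left₀ (by positivity) (hℓ y) 2
            _ = _ := by ring
        · rw [indicator_of_notMem hy]
          simp [Φ, hψW N y hy]
    refine ⟨(hFc.norm.pow 2).aestronglyMeasurable hΩ.measurableSet, ?_⟩
    rw [hasFiniteIntegral_iff_ofReal (Eventually.of_forall fun x => by positivity)]
    have hle : ∫⁻ x in Ω, ENNReal.ofReal (‖F x‖ ^ 2) ∂μ ≤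
        liminf (fun N => ∫⁻ x in Ω, ENNReal.ofReal (‖F x‖ ^ 2 * ψ N (f x)) ∂μ) atTop := by
      refine le_trans ?_ (lintegral_liminf_le' ?_)
      · refine lintegral_mono_ae ?_
        refine (ae_restrict_iff' hΩ.measurableSet).2 (Eventually.of_forall fun x hx => ?_)
        refine le_of_eq (Tendsto.liminf_eq ?_).symm
        refine tendsto_const_nhds.congr' ?_
        filter_upwards [hψlim (f x) (hmaps hx)] with N hN
        rw [hN, mul_one]
      · intro N
        exact (hbd N).1.aestronglyMeasurable.aemeasurable.ennreal_ofReal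
    refine hle.trans_lt ?_
    refine lt_of_le_of_lt (b := ENNReal.ofReal |B|) ?_ ENNReal.ofReal_lt_top
    refine liminf_le_of_le ?_ ?_
    · isBoundedDefault
    · intro b hb
      obtain ⟨N, hN⟩ := hb.exists
      refine hN.trans ?_
      rw [← ofReal_integral_eq_lintegral_ofReal (hbd N).1
        (Eventually.of_forall fun x => mul_nonneg (by positivity) (hψ0 N _))]
      exact ENNReal.ofReal_le_ofReal (hbd N).2
  refine ⟨hsq, C * ∫ y in W, ‖ℓ‖ ^ k * ‖y‖ ^ k * (‖y‖ / ε) ^ k ∂μ, ?_, ?_⟩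
  · exact mul_nonneg hC (integral_nonneg fun y => by positivity)
  intro g hg hgi M hM0 hM
  have hmi : IntegrableOn (fun y : E => ‖ℓ‖ ^ k * ‖y‖ ^ k * (‖y‖ / ε) ^ k) W μ := by
    have := (hmom (k + k)).const_mul (‖ℓ‖ ^ k / ε ^ k)
    refine this.congr (Eventually.of_forall fun y => ?_)
    simp only [div_pow, pow_add]
    ring
  have hgF : Integrable (fun x => ‖g x‖ * ‖F x‖) (μ.restrict Ω) := by
    refine ((Integrable.add hgi hsq).div_const 2).mono'
      ((hg.continuousOn.norm.mul hFc.norm).aestronglyMeasurable hΩ.measurableSet) ?_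
    refine Eventually.of_forall fun x => ?_
    simp only [Pi.add_apply]
    rw [Real.norm_of_nonneg (by positivity)]
    nlinarith [sq_nonneg (‖g x‖ - ‖F x‖)]
  have hlim : Tendsto (fun N => ∫ x in Ω, g x * conj (F x) * (ψ N (f x) : ℂ) ∂μ) atTop
      (𝓝 (∫ x in Ω, g x * conj (F x) ∂μ)) := by
    refine tendsto_integral_of_dominated_convergence _ ?_ hgF ?_ ?_
    · intro N
      refine ContinuousOn.aestronglyMeasurable ?_ hΩ.measurableSet
      exact (hg.continuousOn.mul (Complex.continuous_conj.comp_continuousOn hFc)).mul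
        (Complex.continuous_ofReal.comp_continuousOn ((hψc N).comp_continuousOn hfc))
    · intro N
      refine Eventually.of_forall fun x => ?_
      rw [norm_mul, norm_mul, RCLike.norm_conj, Complex.norm_real, Real.norm_of_nonneg (hψ0 _ _)]
      exact mul_le_of_le_one_right (by positivity) (hψ1 _ _)
    · refine (ae_restrict_iff' hΩ.measurableSet).2 (Eventually.of_forall fun x hx => ?_)
      refine tendsto_const_nhds.congr' ?_
      filter_upwards [hψlim (f x) (hmaps hx)] with N hN
      simp [hN]
  refine le_of_tendsto hlim.norm (Eventually.of_forall fun N => ?_)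
  obtain ⟨K, hK, hKW, hKb, hK0⟩ := hψK N
  let Φ : E → ℂ := fun y => conj (ℓ y ^ k) * (ψ N y : ℂ)
  have hT : TestData W K k Φ := by
    refine ⟨hK, hKW, hKb, ?_, ?_, ?_⟩
    · have := hψc N
      exact (Complex.continuous_conj.comp (by fun_prop)).mul (Complex.continuous_ofReal.comp this)
    · intro x hx; simp [Φ, hK0 x hx]
    · intro θ x
      have h1 : conj (circleMap 0 1 θ) = (circleMap 0 1 θ)⁻¹ :=
        (Complex.inv_eq_conj (norm_circle θ)).symm
      simp only [Φ, hψr N _ x (norm_circle θ), map_smul, smul_eq_mul, mul_pow, map_mul, map_pow, h1, inv_pow]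
      ring
  have h1 := hU g hg M hM k Φ K hT
  have e : ∀ x, GG f g x * Φ (f x) = g x * conj (F x) * (ψ N (f x) : ℂ) := by
    intro x
    simp only [GG, Φ, hF, map_mul]
    ring
  simp only [e] at h1
  refine h1.trans ?_
  rw [mul_right_comm]
  refine mul_le_mul_of_nonneg_right (mul_le_mul_of_nonneg_left ?_ hC) hM0
  rw [← integral_indicator hW.isOpen.measurableSet]
  refine integral_mono ?_ ((integrable_indicator_iff hW.isOpen.measurableSet).2 hmi) ?_
  · apply Continuous.integrable_of_hasCompactSupport
    · have := hT.cont
      fun_prop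
    · exact HasCompactSupport.intro hK fun y hy => by simp [hT.zero y hy]
  · intro y
    by_cases hy : y ∈ W
    · rw [indicator_of_mem hy]
      refine mul_le_mul_of_nonneg_right ?_ (by positivity)
      simp only [Φ, norm_mul, RCLike.norm_conj, Complex.norm_real, norm_pow]
      rw [Real.norm_of_nonneg (hψ0 _ _)]
      exact (mul_le_of_le_one_right (by positivity) (hψ1 _ _)).trans (hℓ y)
    · rw [indicator_of_notMem hy]
      simp [Φ, hψW N y hy]

end ltwo
end FBHProof
end

section
open Set Filter Topology MeasureTheory Metric
open scoped Nat ComplexConjugate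
set_option linter.unusedSectionVars false
namespace FBHProof

section jac
variable {E : Type*} [NormedAddCommGroup E] [NormedSpace ℂ E] [FiniteDimensional ℂ E]

lemma exists_small_noneig (A : E →L[ℂ] E) {η : ℝ} (hη : 0 < η) :
    ∃ ε : ℝ, 0 < ε ∧ ε < η ∧ ∀ v, A v + (ε : ℂ) • v = 0 → v = 0 := by
  have hfin : Set.Finite {c : ℂ | Module.End.HasEigenvalue (A : E →ₗ[ℂ] E) c} :=
    Module.End.finite_hasEigenvalue _
  have hinf : (Ioo (0:ℝ) η).Infinite := Ioo_infinite hη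
  have hinj : InjOn (fun ε : ℝ => -(ε : ℂ)) (Ioo (0:ℝ) η) := by
    intro a _ b _ h
    simpa using h
  obtain ⟨_, ⟨ε, hε, rfl⟩, hnot⟩ := ((hinf.image hinj).sdiff hfin).nonempty
  refine ⟨ε, hε.1, hε.2, fun v hv => ?_⟩
  by_contra hv0
  apply hnot
  refine Module.End.hasEigenvalue_of_hasEigenvector (x := v) ⟨?_, hv0⟩
  rw [Module.End.mem_eigenspace_iff]
  rw [neg_smul]
  exact eq_neg_of_add_eq_zero_left hv

lemma det_ne_zero_of_inj {F : Type*} [NormedAddCommGroup F] [NormedSpace ℂ F] [FiniteDimensional ℂ F]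
    (A : F →L[ℂ] F) (h : ∀ v, A v = 0 → v = 0) : A.det ≠ 0 := by
  intro h0
  have h1 : ¬ IsUnit (LinearMap.det (A : F →ₗ[ℂ] F)) := by
    rw [isUnit_iff_ne_zero]; simpa [ContinuousLinearMap.det] using h0
  apply h1
  have hinj : LinearMap.ker (A : F →ₗ[ℂ] F) = ⊥ := by
    rw [LinearMap.ker_eq_bot']
    exact h
  exact LinearEquiv.isUnit_det' (LinearEquiv.ofInjectiveEndo (A : F →ₗ[ℂ] F) (LinearMap.ker_eq_bot.1 hinj))

lemma exists_ker_of_det {F : Type*} [NormedAddCommGroup F] [NormedSpace ℂ F] [FiniteDimensional ℂ F]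
    (A : F →L[ℂ] F) (h : A.det = 0) : ∃ v, v ≠ 0 ∧ A v = 0 := by
  by_contra hc
  push Not at hc
  exact det_ne_zero_of_inj A (fun v hv => by
    by_contra h0
    exact hc v h0 hv) h

theorem jac_not_zero {Ω : Set E} (hΩ : IsOpen Ω) {f : E → E} (hf : DifferentiableOn ℂ f Ω) {q₀ : E}
    (hq : q₀ ∈ Ω) (hK : IsCompact (f ⁻¹' {f q₀} ∩ Ω)) : ∃ x ∈ Ω, (fderiv ℂ f x).det ≠ 0 := by
  have : ProperSpace E := FiniteDimensional.proper ℂ E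
  let _ : MeasurableSpace E := borel E
  have _ : BorelSpace E := ⟨rfl⟩
  let b := Module.finBasis ℝ E
  let μ : Measure E := b.addHaar
  by_contra hcon
  push Not at hcon
  set K := f ⁻¹' {f q₀} ∩ Ω with hKdef
  have hKΩ : K ⊆ Ω := inter_subset_right
  obtain ⟨δ, hδ, hδΩ⟩ := hK.exists_cthickening_subset_open hΩ hKΩ
  set C := cthickening δ K with hC
  set U := thickening δ K with hU
  have hCc : IsCompact C := hK.cthickening
  have hUC : U ⊆ C := thickening_subset_cthickening _ _
  have hqU : q₀ ∈ U := self_subset_thickening hδ _ ⟨rfl, hq⟩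
  have hUo : IsOpen U := isOpen_thickening
  -- lower bound on boundary
  obtain ⟨η₀, hη₀, hlow⟩ : ∃ η₀ > 0, ∀ x ∈ C, x ∉ U → η₀ ≤ ‖f x - f q₀‖ := by
    have hcomp : IsCompact (C \ U) := hCc.diff hUo
    rcases (C \ U).eq_empty_or_nonempty with he | hne
    · refine ⟨1, one_pos, fun x hx hxU => ?_⟩
      have : x ∈ C \ U := ⟨hx, hxU⟩
      rw [he] at this
      exact this.elim
    · have hc : ContinuousOn (fun x => ‖f x - f q₀‖) (C \ U) :=
        ((hf.continuousOn.mono (sdiff_subset.trans hδΩ)).sub continuousOn_const).norm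
      obtain ⟨x, hx, hmin⟩ := hcomp.exists_isMinOn hne hc
      refine ⟨‖f x - f q₀‖, ?_, fun y hy hyU => hmin ⟨hy, hyU⟩⟩
      refine norm_pos_iff.2 (sub_ne_zero.2 ?_)
      intro h
      exact hx.2 (self_subset_thickening hδ _ ⟨h, hδΩ hx.1⟩)
  obtain ⟨R, hR⟩ : ∃ R : ℝ, ∀ x ∈ C, ‖x - q₀‖ ≤ R :=
    hCc.exists_bound_of_continuousOn (by fun_prop)
  have hR0 : 0 ≤ R := (norm_nonneg _).trans (hR q₀ (hUC hqU))
  set η : ℝ := min (1 / 2) (η₀ / (2 * (R + 1))) with hη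
  have hη0 : 0 < η := by positivity
  have hη1 : η ≤ 1 / 2 := min_le_left _ _
  have hη2 : η * (R + 1) < η₀ := by
    have : η ≤ η₀ / (2 * (R + 1)) := min_le_right _ _
    rw [le_div_iff₀ (by positivity)] at this
    nlinarith
  let F : E × ℂ → E × ℂ := fun p => (f p.1 - f q₀ + p.2 • (p.1 - q₀), p.2)
  have hFder : ∀ p : E × ℂ, p.1 ∈ Ω → ∃ A : E × ℂ →L[ℂ] E × ℂ, HasFDerivAt F A p ∧
      ∀ v t, A (v, t) = (fderiv ℂ f p.1 v + (p.2 • v + t • (p.1 - q₀)), t) := by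
    intro p hp
    have h1 : HasFDerivAt (fun p : E × ℂ => f p.1) ((fderiv ℂ f p.1).comp (ContinuousLinearMap.fst ℂ E ℂ)) p :=
      ((hf.differentiableAt (hΩ.mem_nhds hp)).hasFDerivAt).comp p hasFDerivAt_fst
    have h2 : HasFDerivAt (fun p : E × ℂ => p.1 - q₀) (ContinuousLinearMap.fst ℂ E ℂ) p :=
      hasFDerivAt_fst.sub_const q₀
    have h3 : HasFDerivAt (fun p : E × ℂ => p.2) (ContinuousLinearMap.snd ℂ E ℂ) p := hasFDerivAt_snd
    have h4 := ((h1.sub_const (f q₀)).add (h3.smul h2)).prodMk h3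
    refine ⟨_, h4, ?_⟩
    intro v t
    simp
  have hFd : DifferentiableOn ℂ F (Ω ×ˢ univ) := by
    intro p hp
    obtain ⟨A, hA, -⟩ := hFder p hp.1
    exact hA.differentiableAt.differentiableWithinAt
  have hΩ1 : IsOpen (Ω ×ˢ (univ : Set ℂ)) := hΩ.prod isOpen_univ
  have hJ := (jac_differentiableOn hΩ1 hFd).continuousOn
  set J : E × ℂ → ℂ := fun p => (fderiv ℂ F p).det with hJdef
  have hJ0 : ∀ x ∈ Ω, J (x, 0) = 0 := by
    intro x hx
    obtain ⟨A, hA, hAv⟩ := hFder (x, 0) hx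
    obtain ⟨v, hv, hfv⟩ := exists_ker_of_det _ (hcon x hx)
    simp only [hJdef, hA.fderiv]
    by_contra hne
    have hu : IsUnit (LinearMap.det (A : E × ℂ →ₗ[ℂ] E × ℂ)) := by
      rw [isUnit_iff_ne_zero]; simpa [ContinuousLinearMap.det] using hne
    have hinj := (LinearEquiv.ofIsUnitDet (f := (A : E × ℂ →ₗ[ℂ] E × ℂ))
      (v := Module.finBasis ℂ (E × ℂ)) (v' := Module.finBasis ℂ (E × ℂ))
      (by rwa [LinearMap.det_toMatrix])).injective
    have : (v, (0:ℂ)) = 0 := by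
      apply hinj
      rw [map_zero]
      show A (v, 0) = 0
      rw [hAv]
      simp [hfv]
    exact hv (congrArg Prod.fst this)
  set Ω' : Set (E × ℂ) := U ×ˢ ball 0 1 with hΩ'
  have hΩ'o : IsOpen Ω' := hUo.prod isOpen_ball
  have hΩ'1 : Ω' ⊆ Ω ×ˢ univ := fun p hp => ⟨hδΩ (hUC hp.1), trivial⟩
  set W : Set (E × ℂ) := ball 0 η with hW
  have hprop : ∀ T ⊆ W, IsCompact T → IsCompact (F ⁻¹' T ∩ Ω') := by
    intro T hTW hT
    have hD : IsCompact (C ×ˢ closedBall (0:ℂ) (1/2)) := hCc.prod (isCompact_closedBall _ _)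
    have he : F ⁻¹' T ∩ Ω' = (C ×ˢ closedBall (0:ℂ) (1/2)) ∩ F ⁻¹' T := by
      ext ⟨x, ε⟩
      constructor
      · rintro ⟨h1, h2⟩
        have h3 := hTW h1
        simp only [hW, F, mem_ball_zero_iff, Prod.norm_def, sup_lt_iff] at h3
        exact ⟨⟨hUC h2.1, by simpa using h3.2.le.trans hη1⟩, h1⟩
      · rintro ⟨⟨h1, h2⟩, h3⟩
        have h4 := hTW h3
        simp only [hW, F, mem_ball_zero_iff, Prod.norm_def, sup_lt_iff] at h4
        refine ⟨h3, ?_, ?_⟩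
        · by_contra hxU
          have h5 := hlow x h1 hxU
          have h6 := norm_le_norm_add_norm_sub' (f x - f q₀) (f x - f q₀ + ε • (x - q₀))
          have h7 : ‖f x - f q₀ - (f x - f q₀ + ε • (x - q₀))‖ ≤ η * R := by
            rw [sub_add_cancel_left, norm_neg, norm_smul]
            exact mul_le_mul h4.2.le (hR x h1) (norm_nonneg _) hη0.le
          nlinarith [h4.1]
        · rw [mem_ball_zero_iff]
          have : ‖ε‖ < η := h4.2
          show ‖ε‖ < 1
          linarith
    rw [he]
    have hFc : ContinuousOn F (C ×ˢ closedBall (0:ℂ) (1/2)) :=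
      hFd.continuousOn.mono fun p hp => ⟨hδΩ hp.1, trivial⟩
    exact hD.of_isClosed_subset (hFc.preimage_isClosed_of_isClosed hD.isClosed hT.isClosed) inter_subset_left
  let ν : Measure (E × ℂ) := μ.prod volume
  let Φ : ℝ → E × ℂ → ℂ := fun d p => ((cone (η / 2) p.1 * cone d p.2 : ℝ) : ℂ)
  have hTest : ∀ d, 0 < d → d ≤ η / 2 → TestData W (closedBall 0 (η / 2)) 0 (Φ d) := by
    intro d hd hd2
    refine ⟨isCompact_closedBall _ _, closedBall_subset_ball (by linarith), ?_, ?_, ?_, ?_⟩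
    · intro x hx ζ hζ
      rw [mem_closedBall_zero_iff] at hx ⊢
      rw [norm_smul]
      nlinarith [norm_nonneg x]
    · exact Complex.continuous_ofReal.comp (((cone_cont _).comp continuous_fst).mul ((cone_cont _).comp continuous_snd))
    · rintro ⟨x, ε⟩ hx
      simp only [mem_closedBall_zero_iff, Prod.norm_def, sup_le_iff, not_and_or, not_le] at hx
      rcases hx with hx | hx
      · have : cone (η / 2) x = 0 := cone_zero (by simpa using hx)
        simp [Φ, this]
      · have : cone d ε = 0 := cone_zero (by
          rw [mem_closedBall_zero_iff, not_le]
          exact hd2.trans_lt hx)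
        simp [Φ, this]
    · intro θ p
      simp [Φ, cone, norm_smul]
  have hFd' : DifferentiableOn ℂ F Ω' := hFd.mono hΩ'1
  have hJd' : DifferentiableOn ℂ J Ω' := (jac_differentiableOn hΩ1 hFd).mono hΩ'1
  have hGG : ∀ d p, GG F J p * Φ d (F p) =
      ((‖J p‖ ^ 2 * (cone (η / 2) (F p).1 * cone d p.2) : ℝ) : ℂ) := by
    intro d p
    simp only [GG, Φ, F]
    rw [Complex.mul_conj']
    push_cast
    rfl
  have hη4 : 0 < η / 2 := by positivity
  set A := ∫ y, cone (E := E) (η / 2) y ∂μ with hA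
  have hApos : 0 < A := cone_int_pos μ hη4
  have hB : ∀ d, 0 < d → 0 < ∫ y, cone (E := ℂ) d y := fun d hd => cone_int_pos volume hd
  have hintg : ∀ d, ∫ p, Φ d p ∂ν = ((A * ∫ y, cone (E := ℂ) d y : ℝ) : ℂ) := by
    intro d
    simp only [Φ]
    rw [integral_complex_ofReal, integral_prod_mul (f := cone (E := E) (η / 2)) (g := cone (E := ℂ) d)]
  set T1 := ∫ p in Ω', ‖J p‖ ^ 2 * (cone (η / 2) (F p).1 * cone (η / 2) p.2) ∂ν with hT1
  have hT1i : IntegrableOn (fun p => ‖J p‖ ^ 2 * (cone (η / 2) (F p).1 * cone (η / 2) p.2)) Ω' ν := by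
    have h := (T_tendsto ν hΩ'o isOpen_ball hFd' hprop hJd' (hTest _ hη4 le_rfl).comp (hTest _ hη4 le_rfl).sub
      (hTest _ hη4 le_rfl).cont (hTest _ hη4 le_rfl).zero).1
    simp only [hGG] at h
    have := h.re
    simp only [RCLike.re_eq_complex_re, Complex.ofReal_re] at this
    exact this
  -- upper bound: T1 = 0
  have hsmall : ∀ s > 0, |T1| * A ≤ s * (μ.real C * (η / 2) * (A * ∫ y, cone (E := ℂ) (η / 2) y)) := by
    intro s hs
    obtain ⟨u, v, huo, hvo, hCu, h0v, huv⟩ := generalized_tube_lemma hCc (isCompact_singleton (x := (0:ℂ)))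
      (n := (Ω ×ˢ univ) ∩ (fun p => ‖J p‖ ^ 2) ⁻¹' (Iio s))
      ((hJ.norm.pow 2).isOpen_inter_preimage hΩ1 isOpen_Iio) (by
        rintro ⟨x, ε⟩ ⟨hx, hε⟩
        obtain rfl : ε = 0 := hε
        refine ⟨⟨hδΩ hx, trivial⟩, ?_⟩
        simp [hJ0 x (hδΩ hx), hs])
    obtain ⟨d0, hd0, hd0v⟩ := Metric.nhds_basis_closedBall.mem_iff.1 (hvo.mem_nhds (h0v rfl))
    set d := min d0 (η / 2) with hd
    have hdpos : 0 < d := lt_min hd0 hη4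
    have hBd := hB d hdpos
    have hz := lemmaU_zero ν hΩ'o isOpen_ball hFd' hprop hJd' (hTest d hdpos (min_le_right _ _))
      (hTest _ hη4 le_rfl)
    simp only [hGG, hintg] at hz
    rw [integral_complex_ofReal, integral_complex_ofReal] at hz
    norm_cast at hz
    have hTd : ‖∫ p in Ω', ‖J p‖ ^ 2 * (cone (η / 2) (F p).1 * cone d p.2) ∂ν‖ ≤
        s * (μ.real C * (η / 2) * ∫ y, cone (E := ℂ) d y) := by
      have e : s * (μ.real C * (η / 2) * ∫ y, cone (E := ℂ) d y) =
          ∫ p : E × ℂ, (C.indicator (fun _ => s * (η / 2)) p.1) * cone d p.2 ∂ν := by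
        rw [integral_prod_mul (f := C.indicator (fun _ => s * (η / 2))) (g := cone (E := ℂ) d),
          integral_indicator hCc.isClosed.measurableSet, setIntegral_const, smul_eq_mul]
        ring
      have hnn : ∀ p : E × ℂ, 0 ≤ (C.indicator (fun _ => s * (η / 2)) p.1) * cone d p.2 := fun p =>
        mul_nonneg (indicator_nonneg (fun _ _ => by positivity) _) (cone_nonneg _ _)
      have hii : Integrable (fun p : E × ℂ => (C.indicator (fun _ => s * (η / 2)) p.1) * cone d p.2) ν := by
        apply Integrable.mul_prod
        · rw [integrable_indicator_iff hCc.isClosed.measurableSet]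
          exact integrableOn_const hCc.measure_lt_top.ne
        · exact (cone_cont d).integrable_of_hasCompactSupport
            (HasCompactSupport.intro (isCompact_closedBall 0 d) fun x hx => cone_zero hx)
      rw [e]
      refine le_trans (norm_integral_le_of_norm_le (hii.mono_measure Measure.restrict_le_self) ?_)
        (setIntegral_le_integral hii (Eventually.of_forall hnn))
      refine (ae_restrict_iff' hΩ'o.measurableSet).2 (Eventually.of_forall ?_)
      rintro ⟨x, ε⟩ ⟨hx, hε⟩
      by_cases hεd : ε ∈ closedBall (0:ℂ) d
      · have h1 : ‖J (x, ε)‖ ^ 2 < s := (huv ⟨hCu (hUC hx), hd0v (closedBall_subset_closedBall (min_le_left _ _) hεd)⟩).2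
        rw [indicator_of_mem (hUC hx), norm_mul, norm_mul, norm_pow, norm_norm,
          Real.norm_of_nonneg (cone_nonneg _ _), Real.norm_of_nonneg (cone_nonneg _ _), ← mul_assoc]
        refine mul_le_mul_of_nonneg_right ?_ (cone_nonneg _ _)
        exact mul_le_mul h1.le (cone_le hη4.le _) (cone_nonneg _ _) hs.le
      · simp [cone_zero hεd]
    rw [Real.norm_eq_abs] at hTd
    have h5 := congrArg abs hz
    rw [abs_mul, ← hT1, abs_of_pos (mul_pos hApos (hB _ hη4)), abs_mul, abs_of_pos (mul_pos hApos hBd)] at h5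
    have h6 := mul_le_mul_of_nonneg_right hTd (mul_pos hApos (hB _ hη4)).le
    rw [h5] at h6
    refine le_of_mul_le_mul_right (a := ∫ y, cone (E := ℂ) d y) ?_ hBd
    calc _ = |T1| * (A * ∫ y, cone (E := ℂ) d y) := by ring
      _ ≤ _ := h6
      _ = _ := by ring
  have hT10 : T1 = 0 := by
    set Q := μ.real C * (η / 2) * (A * ∫ y, cone (E := ℂ) (η / 2) y) with hQ
    have hQ0 : 0 ≤ Q := by
      have := hB _ hη4
      positivity
    have h1 : |T1| * A ≤ 0 := by
      refine le_of_forall_pos_le_add fun s hs => ?_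
      rw [zero_add]
      refine (hsmall (s / (Q + 1)) (by positivity)).trans ?_
      rw [div_mul_eq_mul_div, div_le_iff₀ (by positivity)]
      nlinarith
    have h2 : |T1| ≤ 0 := by
      by_contra h
      push Not at h
      nlinarith [mul_pos h hApos]
    exact abs_nonpos_iff.1 h2
  -- positivity
  obtain ⟨ε, hε0, hεη, hinj⟩ := exists_small_noneig (fderiv ℂ f q₀) hη4
  have hJne : J (q₀, (ε:ℂ)) ≠ 0 := by
    obtain ⟨B, hB, hBv⟩ := hFder (q₀, (ε:ℂ)) hq
    simp only [hJdef, hB.fderiv]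
    apply det_ne_zero_of_inj
    rintro ⟨v, t⟩ hv
    rw [hBv] at hv
    simp only [Prod.mk_eq_zero, sub_self, smul_zero, add_zero] at hv
    rw [Prod.mk_eq_zero]
    exact ⟨hinj v hv.1, hv.2⟩
  have hmem : (q₀, (ε:ℂ)) ∈ Ω' := ⟨hqU, by
    rw [mem_ball_zero_iff, Complex.norm_real, Real.norm_of_nonneg hε0.le]; linarith⟩
  set I : E × ℂ → ℝ := fun p => ‖J p‖ ^ 2 * (cone (η / 2) (F p).1 * cone (η / 2) p.2) with hI
  have hInn : ∀ p, 0 ≤ I p := fun p =>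
    mul_nonneg (by positivity) (mul_nonneg (cone_nonneg _ _) (cone_nonneg _ _))
  have hIc : ContinuousOn I Ω' := by
    refine (hJd'.continuousOn.norm.pow 2).mul (ContinuousOn.mul ?_ ?_)
    · exact (cone_cont _).comp_continuousOn (continuous_fst.comp_continuousOn hFd'.continuousOn)
    · exact ((cone_cont _).comp continuous_snd).continuousOn
  have hIpos : 0 < I (q₀, (ε:ℂ)) := by
    have h1 : 0 < ‖J (q₀, (ε:ℂ))‖ := norm_pos_iff.2 hJne
    have h2 : 0 < cone (η / 2) (F (q₀, (ε:ℂ))).1 := by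
      simp only [F, cone, sub_self, smul_zero, add_zero, norm_zero, sub_zero]
      exact lt_max_of_lt_right hη4
    have h3 : 0 < cone (η / 2) (ε:ℂ) := by
      unfold cone
      rw [Complex.norm_real, Real.norm_of_nonneg hε0.le]
      exact lt_max_of_lt_right (by linarith)
    simp only [hI]
    positivity
  have hpos : 0 < ∫ p in Ω', I p ∂ν := by
    rw [setIntegral_pos_iff_support_of_nonneg_ae (Eventually.of_forall hInn) hT1i]
    have hop : IsOpen (Ω' ∩ I ⁻¹' (Ioi 0)) := hIc.isOpen_inter_preimage hΩ'o isOpen_Ioi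
    refine (hop.measure_pos ν ⟨_, hmem, hIpos⟩).trans_le (measure_mono ?_)
    rintro p ⟨h1, h2⟩
    exact ⟨ne_of_gt h2, h1⟩
  exact hpos.ne' hT10

end jac
end FBHProof
end

section
open Set Filter Topology MeasureTheory Metric
open scoped Nat ComplexConjugate
set_option linter.unusedSectionVars false
namespace FBHProof

section ext1
variable {E : Type*} [NormedAddCommGroup E] [NormedSpace ℂ E] [FiniteDimensional ℂ E]

lemma CC.dil {Ω : Set E} (h : CC Ω) {L : Set E} (hL : IsCompact L) (hLΩ : L ⊆ Ω) :
    ∃ t : ℝ, 1 < t ∧ ∀ x ∈ L, (t : ℂ) • x ∈ Ω := by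
  obtain ⟨δ, hδ, hδU⟩ := hL.exists_cthickening_subset_open h.isOpen hLΩ
  obtain ⟨R, hR⟩ := hL.isBounded.exists_norm_le
  have hR' : 0 < |R| + 1 := by positivity
  refine ⟨1 + δ / (|R| + 1), by simp; positivity, fun x hx => hδU ?_⟩
  apply mem_cthickening_of_dist_le _ x _ _ hx
  rw [dist_eq_norm]
  have : ((1 + δ / (|R| + 1) : ℝ) : ℂ) • x - x = ((δ / (|R| + 1) : ℝ) : ℂ) • x := by
    push_cast; rw [add_smul, one_smul]; abel
  rw [this, norm_smul, Complex.norm_real, Real.norm_of_nonneg (by positivity)]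
  calc δ / (|R| + 1) * ‖x‖ ≤ δ / (|R| + 1) * (|R| + 1) := by
        gcongr; linarith [hR x hx, le_abs_self R]
    _ = δ := by field_simp

lemma hp_growth {Ω : Set E} (h : CC Ω) {F : E → ℂ} (hF : DifferentiableOn ℂ F Ω) :
    ∃ C ε : ℝ, 0 ≤ C ∧ 0 < ε ∧ ∀ l x, ‖hp l F x‖ ≤ C * (‖x‖ / ε) ^ l := by
  have : ProperSpace E := FiniteDimensional.proper ℂ E
  obtain ⟨ε, hε, hεΩ⟩ := Metric.nhds_basis_closedBall.mem_iff.1 (h.isOpen.mem_nhds h.zero)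
  obtain ⟨C, hC⟩ := (isCompact_closedBall (0:E) ε).exists_bound_of_continuousOn
    (hF.continuousOn.mono hεΩ)
  have hC0 : 0 ≤ C := (norm_nonneg _).trans (hC 0 (by simp [hε.le]))
  refine ⟨C, ε, hC0, hε, fun l x => ?_⟩
  have hx : x = ((‖x‖ / ε : ℝ) : ℂ) • (((ε / ‖x‖ : ℝ) : ℂ) • x) := by
    rcases eq_or_ne x 0 with rfl | hx
    · simp
    · rw [smul_smul, ← Complex.ofReal_mul]
      have : ‖x‖ / ε * (ε / ‖x‖) = 1 := by
        have := norm_ne_zero_iff.2 hx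
        field_simp
      rw [this]; simp
  have hy : ‖((ε / ‖x‖ : ℝ) : ℂ) • x‖ ≤ ε := by
    rw [norm_smul, Complex.norm_real, Real.norm_of_nonneg (by positivity)]
    rcases eq_or_ne x 0 with rfl | hx
    · simp [hε.le]
    · have := norm_ne_zero_iff.2 hx
      field_simp; rfl
  have hsub : ∀ ζ : ℂ, ‖ζ‖ ≤ 1 → ζ • (((ε / ‖x‖ : ℝ) : ℂ) • x) ∈ closedBall (0:E) ε := by
    intro ζ hζ
    rw [mem_closedBall_zero_iff, norm_smul]
    calc ‖ζ‖ * _ ≤ 1 * ε := by gcongr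
      _ = ε := one_mul _
  have h1 : ‖hp l F (((ε / ‖x‖ : ℝ) : ℂ) • x)‖ ≤ C :=
    hp_norm_le l h.isOpen hF (fun ζ hζ => hεΩ (hsub ζ hζ)) (fun ζ hζ => hC _ (hsub ζ hζ.le))
  conv_lhs => rw [hx]
  rw [hp_smul, norm_mul, norm_pow, Complex.norm_real, Real.norm_of_nonneg (by positivity), mul_comm]
  gcongr

variable [MeasurableSpace E] [BorelSpace E] (μ : Measure E) [μ.IsAddHaarMeasure]

lemma hp_sq_int {Ω : Set E} (h : CC Ω) (hmom : ∀ k : ℕ, IntegrableOn (fun y => ‖y‖ ^ k) Ω μ)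
    {F : E → ℂ} (hF : DifferentiableOn ℂ F Ω) (l : ℕ) :
    IntegrableOn (fun x => ‖hp l F x‖ ^ 2) Ω μ := by
  obtain ⟨C, ε, hC, hε, hb⟩ := hp_growth h hF
  have hd := hp_differentiable h hF l
  refine Integrable.mono' (((hmom (l * 2)).const_mul (C ^ 2 * ((ε ^ l) ^ 2)⁻¹)))
    (by have := hd.continuous; fun_prop) (Eventually.of_forall fun x => ?_)
  rw [norm_pow, norm_norm]
  calc ‖hp l F x‖ ^ 2 ≤ (C * (‖x‖ / ε) ^ l) ^ 2 := by gcongr; exact hb l x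
    _ = _ := by rw [div_pow, pow_mul]; field_simp

lemma hp_pair {Ω : Set E} (h : CC Ω) (hmom : ∀ k : ℕ, IntegrableOn (fun y => ‖y‖ ^ k) Ω μ)
    {F : E → ℂ} (hF : DifferentiableOn ℂ F Ω) (hF2 : IntegrableOn (fun x => ‖F x‖ ^ 2) Ω μ)
    (l : ℕ) :
    ‖∫ x in Ω, hp l F x * conj (F x) ∂μ‖ = ∫ x in Ω, ‖hp l F x‖ ^ 2 ∂μ := by
  have hm := h.isOpen.measurableSet
  have hd := hp_differentiable h hF l
  have hrot : ∀ (θ : ℝ) x, (circleMap 0 1 θ • x ∈ Ω ↔ x ∈ Ω) := by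
    intro θ x
    constructor
    · intro hx
      have := h.smul _ hx (circleMap 0 1 θ)⁻¹ (by rw [norm_inv, norm_circle]; simp)
      rwa [inv_smul_smul₀ (circle_ne θ)] at this
    · intro hx; exact h.smul _ hx _ (norm_circle θ).le
  have key := int_hom μ l h.isOpen (Φ := Ω.indicator (fun x => conj (hp l F x))) hF ?_ ?_ ?_
  · have e1 : (fun x => Ω.indicator (fun x => conj (hp l F x)) x * F x) =
        Ω.indicator (fun x => conj (hp l F x) * F x) := by
      funext x; by_cases hx : x ∈ Ω <;> simp [hx]
    have e2 : (fun x => Ω.indicator (fun x => conj (hp l F x)) x * hp l F x) =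
        Ω.indicator (fun x => ((‖hp l F x‖ ^ 2 : ℝ) : ℂ)) := by
      funext x; by_cases hx : x ∈ Ω
      · simp [hx, Complex.conj_mul']
      · simp [hx]
    rw [e1, e2, integral_indicator hm, integral_indicator hm, integral_complex_ofReal] at key
    have e3 : ∫ x in Ω, hp l F x * conj (F x) ∂μ = conj (∫ x in Ω, conj (hp l F x) * F x ∂μ) := by
      rw [← integral_conj]; simp
    rw [e3, RCLike.norm_conj, key, Complex.norm_real, Real.norm_of_nonneg]
    exact integral_nonneg fun x => by positivity
  · intro θ x
    by_cases hx : x ∈ Ω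
    · rw [indicator_of_mem hx, indicator_of_mem ((hrot θ x).2 hx), hp_smul, map_mul, map_pow]
      congr 1
      rw [← inv_pow]
      congr 1
      have : conj (circleMap 0 1 θ) * circleMap 0 1 θ = 1 := by
        rw [Complex.conj_mul', norm_circle]; simp
      exact eq_inv_of_mul_eq_one_left this
    · rw [indicator_of_notMem hx, indicator_of_notMem (fun hh => hx ((hrot θ x).1 hh)), mul_zero]
  · intro x hx ζ hζ
    exact h.smul x (mem_of_indicator_ne_zero hx) ζ hζ
  · have e1 : (fun x => Ω.indicator (fun x => conj (hp l F x)) x * F x) =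
        Ω.indicator (fun x => conj (hp l F x) * F x) := by
      funext x; by_cases hx : x ∈ Ω <;> simp [hx]
    rw [e1, integrable_indicator_iff hm]
    refine Integrable.mono' ((hp_sq_int μ h hmom hF l).add hF2) ?_ (Eventually.of_forall fun x => ?_)
    · refine AEStronglyMeasurable.mul ?_ (hF.continuousOn.aestronglyMeasurable hm)
      exact (Complex.continuous_conj.comp hd.continuous).aestronglyMeasurable
    · simp only [norm_mul, RCLike.norm_conj, Pi.add_apply]
      nlinarith [sq_nonneg (‖hp l F x‖ - ‖F x‖), sq_nonneg (‖hp l F x‖), sq_nonneg (‖F x‖)]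

theorem ext_scalar {Ω : Set E} (h : CC Ω)
    (hmom : ∀ k : ℕ, IntegrableOn (fun y => ‖y‖ ^ k) Ω μ) {L : Set E} (hL : IsCompact L)
    (hLΩ : L ⊆ Ω) :
    ∃ s : ℝ, 0 < s ∧ s < 1 ∧ ∀ F : E → ℂ, DifferentiableOn ℂ F Ω →
      IntegrableOn (fun x => ‖F x‖ ^ 2) Ω μ →
      (∃ C, 0 ≤ C ∧ ∀ g : E → ℂ, DifferentiableOn ℂ g Ω → IntegrableOn (fun x => ‖g x‖ ^ 2) Ω μ →
        ∀ M, 0 ≤ M → (∀ x ∈ L, ‖g x‖ ≤ M) → ‖∫ x in Ω, g x * conj (F x) ∂μ‖ ≤ C * M) →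
      ∃ F' : E → ℂ, DifferentiableOn ℂ F' {x | (s : ℂ) • x ∈ Ω} ∧ EqOn F' F Ω := by
  have : ProperSpace E := FiniteDimensional.proper ℂ E
  obtain ⟨t, ht, htL⟩ := h.dil hL hLΩ
  set r := t⁻¹ with hr
  have hr0 : 0 < r := by positivity
  have hr1 : r < 1 := inv_lt_one_of_one_lt₀ ht
  have hs0 : 0 < (1 + r) / 2 := by positivity
  have hrs : r < (1 + r) / 2 := by linarith
  generalize hs : (1 + r) / 2 = s at hs0 hrs
  refine ⟨s, hs0, by linarith, ?_⟩
  intro F hF hF2 ⟨C, hC, hCg⟩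
  obtain ⟨C1, hC1, hC1g⟩ := sq_le_int μ h.isOpen
    (hL.image (continuous_const_smul (t : ℂ))) (by rintro _ ⟨x, hx, rfl⟩; exact htL x hx)
  set N : ℕ → ℝ := fun l => ∫ x in Ω, ‖hp l F x‖ ^ 2 ∂μ with hN
  have hd := fun l => (hp_differentiable h hF l)
  have hsqi := hp_sq_int μ h hmom hF
  have hN0 : ∀ l, 0 ≤ N l := fun l => integral_nonneg fun x => by positivity
  have hNl : ∀ l, N l ≤ C * (r ^ l * Real.sqrt (C1 * N l)) := by
    intro l
    rw [hN]
    simp only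
    rw [← hp_pair μ h hmom hF hF2 l]
    refine hCg _ (hd l).differentiableOn (hsqi l) _ (by positivity) ?_
    intro x hx
    have e : x = (r : ℂ) • ((t : ℂ) • x) := by
      rw [smul_smul, ← Complex.ofReal_mul, hr, inv_mul_cancel₀ (by linarith)]; simp
    conv_lhs => rw [e]
    rw [hp_smul, norm_mul, norm_pow, Complex.norm_real, Real.norm_of_nonneg hr0.le]
    gcongr
    apply Real.le_sqrt_of_sq_le
    rw [hp_pair μ h hmom hF hF2 l]
    exact hC1g _ (hd l).differentiableOn (hsqi l) _ ⟨x, hx, rfl⟩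
  have hsN : ∀ l, Real.sqrt (N l) ≤ C * Real.sqrt C1 * r ^ l := by
    intro l
    have h1 := hNl l
    rw [Real.sqrt_mul hC1] at h1
    have h2 := Real.mul_self_sqrt (hN0 l)
    rcases (Real.sqrt_nonneg (N l)).eq_or_lt with h0 | h0
    · rw [← h0]; positivity
    · by_contra! hcon
      nlinarith
  set Ωs : Set E := {x | (s : ℂ) • x ∈ Ω} with hΩs
  have hΩso : IsOpen Ωs := h.isOpen.preimage (continuous_const_smul (s:ℂ))
  have hq0 : 0 ≤ r / s := by positivity
  have hq1 : r / s < 1 := by rw [div_lt_one hs0]; exact hrs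
  refine ⟨fun x => ∑' l, hp l F x, ?_, fun x hx => (hp_hasSum h hF hx).tsum_eq⟩
  intro p hp'
  obtain ⟨δ, hδ, hδΩ⟩ := Metric.nhds_basis_closedBall.mem_iff.1 (hΩso.mem_nhds hp')
  obtain ⟨C2, hC2, hC2g⟩ := sq_le_int μ h.isOpen
    ((isCompact_closedBall p δ).image (continuous_const_smul (s : ℂ)))
    (by rintro _ ⟨x, hx, rfl⟩; exact hδΩ hx)
  have hbd : ∀ l, ∀ x ∈ ball p δ, ‖hp l F x‖ ≤ Real.sqrt C2 * (C * Real.sqrt C1) * (r / s) ^ l := by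
    intro l x hx
    have h1 := hC2g _ (hd l).differentiableOn (hsqi l) _ ⟨x, ball_subset_closedBall hx, rfl⟩
    have h2 := Real.le_sqrt_of_sq_le h1
    simp only at h2
    rw [hp_smul, norm_mul, norm_pow, Complex.norm_real, Real.norm_of_nonneg hs0.le,
      Real.sqrt_mul hC2] at h2
    have h3 : s ^ l * ‖hp l F x‖ ≤ Real.sqrt C2 * (C * Real.sqrt C1 * r ^ l) :=
      h2.trans (by gcongr; exact hsN l)
    rw [div_pow, ← mul_div_assoc, le_div_iff₀ (by positivity)]
    linarith
  have hsum : Summable fun l : ℕ => Real.sqrt C2 * (C * Real.sqrt C1) * (r / s) ^ l :=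
    (summable_geometric_of_lt_one hq0 hq1).mul_left _
  have hbi : Integrable (fun l : ℕ => Real.sqrt C2 * (C * Real.sqrt C1) * (r / s) ^ l)
      (Measure.count : Measure ℕ) := by
    rw [integrable_count_iff]; exact hsum.norm
  have hDI := differentiableOn_integral (ν := (Measure.count : Measure ℕ)) (U := ball p δ)
    (F := fun x l => hp l F x) isOpen_ball
    (fun x _ => (measurable_from_nat (f := fun l => hp l F x)).aestronglyMeasurable)
    (Eventually.of_forall fun l x hx => hbd l x hx) hbi
    (Eventually.of_forall fun l => (hd l).differentiableOn)
  have hD2 : DifferentiableOn ℂ (fun x => ∑' l, hp l F x) (ball p δ) := by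
    refine hDI.congr fun x hx => ?_
    have hi : Integrable (fun l => hp l F x) (Measure.count : Measure ℕ) := by
      rw [integrable_count_iff]
      exact Summable.of_nonneg_of_le (fun _ => norm_nonneg _) (fun l => hbd l x hx) hsum
    rw [integral_countable hi]
    simp
  exact (hD2.differentiableAt (ball_mem_nhds p hδ)).differentiableWithinAt
end ext1
end FBHProof
end

section
open Set Filter Topology MeasureTheory Metric
open scoped Nat ComplexConjugate
set_option linter.unusedSectionVars false
namespace FBHProof

lemma pow_le_trick {x y K : ℝ} (hx : 0 ≤ x) (hy : 0 ≤ y)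
    (h : ∀ k : ℕ, y ^ (k + 1) ≤ K * x ^ k) : y ≤ x := by
  by_contra! hxy
  have hy0 : 0 < y := hx.trans_lt hxy
  have h1 : ∀ k : ℕ, y ≤ K * (x / y) ^ k := by
    intro k
    have := h k
    rw [div_pow, ← mul_div_assoc, le_div_iff₀ (by positivity)]
    rw [pow_succ] at this; linarith
  have h2 : Tendsto (fun k : ℕ => K * (x / y) ^ k) atTop (𝓝 (K * 0)) :=
    (tendsto_pow_atTop_nhds_zero_of_lt_one (by positivity)
      ((div_lt_one hy0).2 hxy)).const_mul K
  have := ge_of_tendsto' h2 h1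
  linarith

lemma div1_bound {δ : ℝ} (hδ : 0 < δ) {a b : ℂ → ℂ} {bk : ℕ → ℂ → ℂ}
    (ha : ContinuousOn a (closedBall 0 δ)) (hb : ContinuousOn b (closedBall 0 δ))
    (hbk : ∀ k, DiffContOnCl ℂ (bk k) (ball 0 δ))
    (hne : ∀ ζ ∈ sphere (0:ℂ) δ, a ζ ≠ 0)
    (hk : ∀ k, ∀ ζ ∈ closedBall (0:ℂ) δ, a ζ ^ k * bk k ζ = b ζ ^ (k + 1)) :
    ∃ m, 0 ≤ m ∧ ∀ ζ ∈ closedBall (0:ℂ) δ, ‖b ζ‖ ≤ m * ‖a ζ‖ := by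
  have hsub : sphere (0:ℂ) δ ⊆ closedBall 0 δ := sphere_subset_closedBall
  obtain ⟨A, hA⟩ := (isCompact_sphere (0:ℂ) δ).exists_bound_of_continuousOn (ha.mono hsub)
  obtain ⟨m, hm⟩ := (isCompact_sphere (0:ℂ) δ).exists_bound_of_continuousOn
    ((hb.mono hsub).div (ha.mono hsub) hne)
  have hpt : (δ : ℂ) ∈ sphere (0:ℂ) δ := by simp [abs_of_pos hδ]
  have hm0 : 0 ≤ m := (norm_nonneg _).trans (hm _ hpt)
  have hA0 : 0 ≤ A := (norm_nonneg _).trans (hA _ hpt)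
  refine ⟨m, hm0, fun ζ hζ => ?_⟩
  apply pow_le_trick (K := A * m) (by positivity) (norm_nonneg _)
  intro k
  have h1 : ∀ z ∈ frontier (ball (0:ℂ) δ), ‖bk k z‖ ≤ A * m ^ (k + 1) := by
    intro z hz
    rw [frontier_ball _ hδ.ne'] at hz
    have e : bk k z = a z * (b z / a z) ^ (k + 1) := by
      have := hk k z (hsub hz)
      have h0 := hne z hz
      rw [div_pow, ← this]
      field_simp
      ring
    rw [e, norm_mul, norm_pow]
    gcongr
    · exact hA z hz
    · exact hm z hz
  have h2 := Complex.norm_le_of_forall_mem_frontier_norm_le isBounded_ball (hbk k) h1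
    (z := ζ) (by rwa [closure_ball _ hδ.ne'])
  rw [← norm_pow, ← hk k ζ hζ, norm_mul, norm_pow]
  calc ‖a ζ‖ ^ k * ‖bk k ζ‖ ≤ ‖a ζ‖ ^ k * (A * m ^ (k + 1)) := by gcongr
    _ = A * m * (m * ‖a ζ‖) ^ k := by rw [mul_pow]; ring

lemma div1 {δ δ' : ℝ} (hδ : 0 < δ) (hδ' : δ < δ') {a b : ℂ → ℂ} {bk : ℕ → ℂ → ℂ}
    (ha : DifferentiableOn ℂ a (ball 0 δ')) (hb : DifferentiableOn ℂ b (ball 0 δ'))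
    (hbk : ∀ k, DifferentiableOn ℂ (bk k) (ball 0 δ'))
    (hne : ∀ ζ ∈ sphere (0:ℂ) δ, a ζ ≠ 0)
    (hk : ∀ k, ∀ ζ ∈ ball (0:ℂ) δ', a ζ ^ k * bk k ζ = b ζ ^ (k + 1)) :
    a 0 * Real.circleAverage (fun ζ => b ζ / a ζ) 0 δ = b 0 := by
  have hcb : closedBall (0:ℂ) δ ⊆ ball 0 δ' := closedBall_subset_ball hδ'
  obtain ⟨m, hm0, hm⟩ := div1_bound hδ (ha.continuousOn.mono hcb) (hb.continuousOn.mono hcb)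
    (fun k => by
      apply DifferentiableOn.diffContOnCl
      rw [closure_ball _ hδ.ne']
      exact (hbk k).mono hcb) hne (fun k ζ hζ => hk k ζ (hcb hζ))
  set c : ℂ → ℂ := fun ζ => limUnder (𝓝[≠] ζ) (fun z => b z / a z) with hc
  have hca : ∀ ζ ∈ ball (0:ℂ) δ', a ζ ≠ 0 → c ζ = b ζ / a ζ := by
    intro ζ hζ h0
    have hn := isOpen_ball.mem_nhds hζ
    have : ContinuousAt (fun z => b z / a z) ζ :=
      (hb.continuousOn.continuousAt hn).div (ha.continuousOn.continuousAt hn) h0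
    exact (this.tendsto.mono_left nhdsWithin_le_nhds).limUnder_eq
  have hnz : ∀ ζ ∈ ball (0:ℂ) δ', ∀ᶠ z in 𝓝[≠] ζ, a z ≠ 0 := by
    intro ζ hζ
    rcases (ha.analyticAt (isOpen_ball.mem_nhds hζ)).eventually_eq_zero_or_eventually_ne_zero
      with h | h
    · exfalso
      have := hol_identity isOpen_ball (convex_ball (0:ℂ) δ').isPreconnected ha hζ h
      have hpt : (δ : ℂ) ∈ sphere (0:ℂ) δ := by simp [abs_of_pos hδ]
      exact hne _ hpt (this (hcb (sphere_subset_closedBall hpt)))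
    · exact h
  have hloc : ∀ ζ ∈ closedBall (0:ℂ) δ, DifferentiableAt ℂ c ζ ∧ a ζ * c ζ = b ζ := by
    intro ζ hζ
    have hζ' := hcb hζ
    have hn := isOpen_ball.mem_nhds hζ'
    by_cases h0 : a ζ = 0
    · have hζb : ζ ∈ ball (0:ℂ) δ := by
        rcases (mem_closedBall.1 hζ).lt_or_eq with h | h
        · exact h
        · exact absurd h0 (hne ζ h)
      obtain ⟨ρ, hρ, hρs⟩ := Metric.mem_nhdsWithin_iff.1 (hnz ζ hζ')
      set S := ball ζ ρ ∩ ball (0:ℂ) δ with hS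
      have hSo : IsOpen S := isOpen_ball.inter isOpen_ball
      have hζS : ζ ∈ S := ⟨mem_ball_self hρ, hζb⟩
      have hSn : S ∈ 𝓝 ζ := hSo.mem_nhds hζS
      have hSne : ∀ z ∈ S \ {ζ}, a z ≠ 0 := fun z hz => hρs ⟨hz.1.1, hz.2⟩
      have hSb : S ⊆ ball 0 δ' := fun z hz => hcb (ball_subset_closedBall hz.2)
      have hdiff : DifferentiableOn ℂ (fun z => b z / a z) (S \ {ζ}) :=
        (hb.mono (sdiff_subset.trans hSb)).div (ha.mono (sdiff_subset.trans hSb)) hSne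
      have hbound : ∀ z ∈ S \ {ζ}, ‖b z / a z‖ ≤ m := by
        intro z hz
        rw [norm_div, div_le_iff₀ (norm_pos_iff.2 (hSne z hz))]
        exact hm z (ball_subset_closedBall hz.1.2)
      have hbdd : BddAbove (norm ∘ (fun z => b z / a z) '' (S \ {ζ})) := by
        refine ⟨m, ?_⟩
        rintro _ ⟨z, hz, rfl⟩
        exact hbound z hz
      have hup := Complex.differentiableOn_update_limUnder_of_bddAbove hSn hdiff hbdd
      have heq : EqOn c (Function.update (fun z => b z / a z) ζ
          (limUnder (𝓝[≠] ζ) (fun z => b z / a z))) S := by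
        intro z hz
        by_cases hzz : z = ζ
        · subst hzz; simp [hc]
        · rw [Function.update_of_ne hzz]
          exact hca z (hSb hz) (hSne z ⟨hz, hzz⟩)
      have hcd : DifferentiableOn ℂ c S := hup.congr heq
      have hcat := hcd.differentiableAt hSn
      refine ⟨hcat, ?_⟩
      have t1 : Tendsto (fun z => a z * c z) (𝓝[≠] ζ) (𝓝 (a ζ * c ζ)) :=
        ((ha.continuousOn.continuousAt hn).mul hcat.continuousAt).tendsto.mono_left
          nhdsWithin_le_nhds
      have t2 : Tendsto b (𝓝[≠] ζ) (𝓝 (b ζ)) :=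
        (hb.continuousOn.continuousAt hn).tendsto.mono_left nhdsWithin_le_nhds
      refine tendsto_nhds_unique (t1.congr' ?_) t2
      filter_upwards [hnz ζ hζ', nhdsWithin_le_nhds hn] with z hz hzb
      rw [hca z hzb hz]; field_simp
    · have hne' : ∀ᶠ z in 𝓝 ζ, a z ≠ 0 := (ha.continuousOn.continuousAt hn).eventually_ne h0
      refine ⟨?_, ?_⟩
      · have : (fun z => b z / a z) =ᶠ[𝓝 ζ] c := by
          filter_upwards [hne', hn] with z hz hzb
          exact (hca z hzb hz).symm
        exact this.differentiableAt_iff.1 ((hb.differentiableAt hn).div (ha.differentiableAt hn) h0)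
      · rw [hca ζ hζ' h0]; field_simp
  have hav : Real.circleAverage c 0 δ = c 0 := by
    apply DiffContOnCl.circleAverage
    apply DifferentiableOn.diffContOnCl
    rw [abs_of_pos hδ, closure_ball _ hδ.ne']
    exact fun z hz => (hloc z hz).1.differentiableWithinAt
  have heq : Real.circleAverage (fun ζ => b ζ / a ζ) 0 δ = Real.circleAverage c 0 δ := by
    unfold Real.circleAverage
    congr 2
    funext θ
    have hs : circleMap 0 δ θ ∈ sphere (0:ℂ) δ := circleMap_mem_sphere 0 hδ.le θ
    exact (hca _ (hcb (sphere_subset_closedBall hs)) (hne _ hs)).symm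
  rw [heq, hav]
  exact (hloc 0 (mem_closedBall_self hδ.le)).2

section divn
variable {E : Type*} [NormedAddCommGroup E] [NormedSpace ℂ E] [FiniteDimensional ℂ E]

theorem divn {U : Set E} (hU : IsOpen U) (hUc : IsPreconnected U) {A B : E → ℂ} {Bk : ℕ → E → ℂ}
    (hA : DifferentiableOn ℂ A U) (hB : DifferentiableOn ℂ B U)
    (hBk : ∀ k, DifferentiableOn ℂ (Bk k) U)
    (hk : ∀ k, ∀ x ∈ U, A x ^ k * Bk k x = B x ^ (k + 1))
    (hA0 : ∃ x ∈ U, A x ≠ 0) {p : E} (hp : p ∈ U) :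
    ∃ N, IsOpen N ∧ p ∈ N ∧ N ⊆ U ∧ ∃ Ψ : E → ℂ, DifferentiableOn ℂ Ψ N ∧ ∀ x ∈ N, A x * Ψ x = B x := by
  have : ProperSpace E := FiniteDimensional.proper ℂ E
  obtain ⟨R, hR, hRU⟩ := Metric.isOpen_iff.1 hU p hp
  have hq : ∃ q ∈ ball p R, A q ≠ 0 := by
    by_contra! hcon
    obtain ⟨x, hx, hx0⟩ := hA0
    exact hx0 (hol_identity hU hUc hA hp
      (Filter.eventually_of_mem (ball_mem_nhds p hR) hcon) hx)
  obtain ⟨q, hqb, hqA⟩ := hq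
  set v := q - p with hv
  have hlin : ∀ x : E, Differentiable ℂ (fun ζ : ℂ => x + ζ • v) := fun x => by fun_prop
  set V : Set ℂ := (fun ζ : ℂ => p + ζ • v) ⁻¹' ball p R with hV
  have hVo : IsOpen V := isOpen_ball.preimage (hlin p).continuous
  have hVc : IsPreconnected V := by
    apply Convex.isPreconnected
    have e : V = (fun ζ : ℂ => ζ • v) ⁻¹' ball 0 R := by
      ext ζ; simp [hV]
    rw [e]
    exact (convex_ball (0:E) R).is_linear_preimage
      ⟨fun x y => add_smul x y v, fun c x => smul_assoc c x v⟩
  have h0V : (0:ℂ) ∈ V := by simp [hV, hR]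
  have h1V : (1:ℂ) ∈ V := by simpa [hV, hv] using hqb
  have hAV : DifferentiableOn ℂ (fun ζ : ℂ => A (p + ζ • v)) V :=
    hA.comp (hlin p).differentiableOn (fun ζ hζ => hRU hζ)
  have hpn : ∀ᶠ ζ in 𝓝[≠] (0:ℂ), A (p + ζ • v) ≠ 0 := by
    rcases (hAV.analyticAt (hVo.mem_nhds h0V)).eventually_eq_zero_or_eventually_ne_zero with h | h
    · exfalso
      have := hol_identity hVo hVc hAV h0V h h1V
      simp [hv] at this
      exact hqA this
    · exact h
  obtain ⟨ρ, hρ, hρs⟩ := Metric.mem_nhdsWithin_iff.1 hpn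
  obtain ⟨ρ', hρ', hρV⟩ := Metric.isOpen_iff.1 hVo 0 h0V
  obtain ⟨δ, hδ, hδρ, hδρ'⟩ : ∃ δ, 0 < δ ∧ δ < ρ ∧ 2 * δ < ρ' :=
    ⟨min (ρ / 2) (ρ' / 3), by positivity, by linarith [min_le_left (ρ/2) (ρ'/3)],
      by linarith [min_le_right (ρ/2) (ρ'/3)]⟩
  set K1 : Set E := (fun ζ : ℂ => p + ζ • v) '' sphere 0 δ
  set K2 : Set E := (fun ζ : ℂ => p + ζ • v) '' closedBall 0 (2 * δ)
  have hK1 : IsCompact K1 := (isCompact_sphere _ _).image (hlin p).continuous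
  have hK2 : IsCompact K2 := (isCompact_closedBall _ _).image (hlin p).continuous
  have hU1 : IsOpen (U ∩ A ⁻¹' {0}ᶜ) := hA.continuousOn.isOpen_inter_preimage hU isOpen_compl_singleton
  have hs1 : K1 ⊆ U ∩ A ⁻¹' {0}ᶜ := by
    rintro _ ⟨ζ, hζ, rfl⟩
    have hz : ‖ζ‖ = δ := by simpa using hζ
    refine ⟨hRU (hρV ?_), hρs ⟨?_, ?_⟩⟩
    · simp [hz]; linarith
    · simp [hz, hδρ]
    · intro h; simp at h; rw [h] at hz; simp at hz; linarith
  have hs2 : K2 ⊆ U := by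
    rintro _ ⟨ζ, hζ, rfl⟩
    have hz : ‖ζ‖ ≤ 2 * δ := by simpa using hζ
    refine hRU (hρV ?_)
    simp; linarith
  obtain ⟨η1, hη1, hηs1⟩ := hK1.exists_cthickening_subset_open hU1 hs1
  obtain ⟨η2, hη2, hηs2⟩ := hK2.exists_cthickening_subset_open hU hs2
  have hK1' : IsCompact (cthickening η1 K1) := hK1.cthickening
  obtain ⟨M, hM⟩ := hK1'.exists_bound_of_continuousOn (f := fun x => B x / A x)
    ((hB.continuousOn.mono (hηs1.trans inter_subset_left)).div
      (hA.continuousOn.mono (hηs1.trans inter_subset_left)) (fun x hx => (hηs1 hx).2))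
  set N := ball p (min (min η1 η2) R) with hN
  have hmin : 0 < min (min η1 η2) R := by positivity
  have hdist : ∀ x ∈ N, ∀ ζ : ℂ, dist (x + ζ • v) (p + ζ • v) < min (min η1 η2) R := by
    intro x hx ζ
    rw [dist_add_right]; exact hx
  have hin1 : ∀ x ∈ N, ∀ ζ ∈ sphere (0:ℂ) δ, x + ζ • v ∈ cthickening η1 K1 := by
    intro x hx ζ hζ
    apply mem_cthickening_of_dist_le _ (p + ζ • v) _ _ (mem_image_of_mem (fun ζ : ℂ => p + ζ • v) hζ)
    exact (hdist x hx ζ).le.trans ((min_le_left _ _).trans (min_le_left _ _))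
  have hin2 : ∀ x ∈ N, ∀ ζ ∈ closedBall (0:ℂ) (2 * δ), x + ζ • v ∈ U := by
    intro x hx ζ hζ
    apply hηs2
    apply mem_cthickening_of_dist_le _ (p + ζ • v) _ _ (mem_image_of_mem (fun ζ : ℂ => p + ζ • v) hζ)
    exact (hdist x hx ζ).le.trans ((min_le_left _ _).trans (min_le_right _ _))
  refine ⟨N, isOpen_ball, mem_ball_self hmin, (ball_subset_ball (min_le_right _ _)).trans hRU,
    fun x => Real.circleAverage (fun ζ => B (x + ζ • v) / A (x + ζ • v)) 0 δ, ?_, ?_⟩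
  · unfold Real.circleAverage
    apply DifferentiableOn.const_smul
    simp_rw [intervalIntegral.integral_of_le Real.two_pi_pos.le]
    have hcs : ∀ θ, circleMap (0:ℂ) δ θ ∈ sphere (0:ℂ) δ := circleMap_mem_sphere 0 hδ.le
    refine differentiableOn_integral (bound := fun _ => M) isOpen_ball ?_ ?_ ?_ ?_
    · intro x hx
      apply Continuous.aestronglyMeasurable
      have hco : ContinuousOn (fun y => B y / A y) (cthickening η1 K1) :=
        ((hB.continuousOn.mono (hηs1.trans inter_subset_left)).div
          (hA.continuousOn.mono (hηs1.trans inter_subset_left)) (fun x hx => (hηs1 hx).2))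
      exact hco.comp_continuous (f := fun θ => x + circleMap 0 δ θ • v)
        ((hlin x).continuous.comp (continuous_circleMap 0 δ)) (fun θ => hin1 x hx _ (hcs θ))
    · exact Eventually.of_forall fun θ x hx => hM _ (hin1 x hx _ (hcs θ))
    · exact integrable_const _
    · refine Eventually.of_forall fun θ => ?_
      have ht : DifferentiableOn ℂ (fun x : E => x + circleMap 0 δ θ • v) N := by fun_prop
      have hmt : MapsTo (fun x : E => x + circleMap 0 δ θ • v) N U :=
        fun x hx => (hηs1 (hin1 x hx _ (hcs θ))).1
      simp_rw [div_eq_mul_inv]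
      exact DifferentiableOn.mul (hB.comp ht hmt) <| DifferentiableOn.inv (hA.comp ht hmt)
        (fun x hx => (hηs1 (hin1 x hx _ (hcs θ))).2)
  · intro x hx
    have hm : MapsTo (fun ζ : ℂ => x + ζ • v) (ball 0 (2 * δ)) U :=
      fun ζ hζ => hin2 x hx ζ (ball_subset_closedBall hζ)
    have := div1 hδ (by linarith : δ < 2 * δ) (a := fun ζ => A (x + ζ • v))
      (b := fun ζ => B (x + ζ • v)) (bk := fun k ζ => Bk k (x + ζ • v))
      (hA.comp (hlin x).differentiableOn hm) (hB.comp (hlin x).differentiableOn hm)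
      (fun k => (hBk k).comp (hlin x).differentiableOn hm)
      (fun ζ hζ => (hηs1 (hin1 x hx ζ hζ)).2)
      (fun k ζ hζ => hk k _ (hm hζ))
    simpa using this

end divn
end FBHProof
end

section
open Set Filter Topology MeasureTheory Metric
open scoped Nat ComplexConjugate
set_option linter.unusedSectionVars false
namespace FBHProof

section extmap
variable {E : Type*} [NormedAddCommGroup E] [NormedSpace ℂ E] [FiniteDimensional ℂ E]

lemma CC.isPathConnected {Ω : Set E} (h : CC Ω) : IsPathConnected Ω := by
  refine StarConvex.isPathConnected (a := 0) ?_ h.zero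
  rw [starConvex_zero_iff]
  intro x hx a ha0 ha1
  have := h.smul x hx (a : ℂ) (by rw [Complex.norm_real, Real.norm_of_nonneg ha0]; exact ha1)
  rwa [Complex.coe_smul] at this

lemma CC.shrink {Ω : Set E} (h : CC Ω) (s : ℝ) : CC {x | (s : ℂ) • x ∈ Ω} where
  isOpen := h.isOpen.preimage (continuous_const_smul (s:ℂ))
  zero := by simp [h.zero]
  smul x hx ζ hζ := by
    have := h.smul _ hx ζ hζ
    rw [smul_comm] at this
    exact this

variable [MeasurableSpace E] [BorelSpace E] (μ : Measure E) [μ.IsAddHaarMeasure]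

theorem ext_map {Ω W : Set E} (hΩ : CC Ω) (hW : CC W) (hne : Wᶜ.Nonempty)
    (hmomΩ : ∀ k : ℕ, IntegrableOn (fun y => ‖y‖ ^ k) Ω μ)
    (hmom : ∀ k : ℕ, IntegrableOn (fun y => ‖y‖ ^ k) W μ)
    {f : E → E} (hf : DifferentiableOn ℂ f Ω) (hmaps : MapsTo f Ω W)
    (hprop : ∀ K ⊆ W, IsCompact K → IsCompact (f ⁻¹' K ∩ Ω)) :
    ∃ s : ℝ, 0 < s ∧ s < 1 ∧ ∀ p : E, (s : ℂ) • p ∈ Ω → ∃ N, IsOpen N ∧ p ∈ N ∧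
      ∃ f' : E → E, DifferentiableOn ℂ f' N ∧ EqOn f' f (N ∩ Ω) := by
  obtain ⟨L, hL, hLΩ, hLb⟩ := l2_bound μ hΩ.isOpen hW hne hmom hf hmaps hprop
  obtain ⟨s, hs0, hs1, hext⟩ := ext_scalar μ hΩ hmomΩ hL hLΩ
  refine ⟨s, hs0, hs1, fun p hp => ?_⟩
  have hJ := jac_differentiableOn hΩ.isOpen hf
  have hX : ∀ (ℓ : E →L[ℂ] ℂ) (k : ℕ), ∃ F' : E → ℂ,
      DifferentiableOn ℂ F' {x | (s : ℂ) • x ∈ Ω} ∧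
      EqOn F' (fun x => (fderiv ℂ f x).det * (ℓ (f x)) ^ k) Ω := by
    intro ℓ k
    obtain ⟨h1, h2⟩ := hLb ℓ k
    refine hext _ ?_ h1 h2
    exact hJ.mul ((ℓ.differentiable.comp_differentiableOn hf).pow k)
  choose X hXd hXe using hX
  have hcs := hΩ.shrink s
  set Ωs : Set E := {x | (s : ℂ) • x ∈ Ω}
  have hΩΩs : Ω ⊆ Ωs := fun x hx => hΩ.smul x hx s
    (by rw [Complex.norm_real, Real.norm_of_nonneg hs0.le]; exact hs1.le)
  have hprec : IsPreconnected Ωs := hcs.isPathConnected.isConnected.isPreconnected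
  have hprecΩ : IsPreconnected Ω := hΩ.isPathConnected.isConnected.isPreconnected
  have hJ0 : ∃ x ∈ Ω, (fderiv ℂ f x).det ≠ 0 :=
    jac_not_zero hΩ.isOpen hf hΩ.zero
      (hprop {f 0} (by simpa using hmaps hΩ.zero) isCompact_singleton)
  have hrel : ∀ (ℓ : E →L[ℂ] ℂ) (k : ℕ), ∀ x ∈ Ωs,
      X 0 0 x ^ k * X ℓ (k + 1) x = X ℓ 1 x ^ (k + 1) := by
    intro ℓ k x hx
    have hd : DifferentiableOn ℂ (fun x => X 0 0 x ^ k * X ℓ (k + 1) x - X ℓ 1 x ^ (k + 1)) Ωs :=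
      (((hXd 0 0).pow k).mul (hXd ℓ (k+1))).sub ((hXd ℓ 1).pow (k+1))
    have := hol_identity hcs.isOpen hprec hd hcs.zero ?_ hx
    · exact sub_eq_zero.1 this
    · filter_upwards [hΩ.isOpen.mem_nhds hΩ.zero] with y hy
      rw [hXe 0 0 hy, hXe ℓ _ hy, hXe ℓ _ hy]
      simp
      ring
  have hdiv : ∀ ℓ : E →L[ℂ] ℂ, _ := fun ℓ =>
    divn hcs.isOpen hprec (hXd 0 0) (hXd ℓ 1) (fun k => hXd ℓ (k + 1)) (hrel ℓ)
      (by obtain ⟨x, hx, h⟩ := hJ0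
          exact ⟨x, hΩΩs hx, by rw [hXe 0 0 hx]; simpa using h⟩) hp
  choose N hNo hpN _ Ψ hΨd hΨ using hdiv
  let bas := Module.finBasis ℂ E
  let ℓ : Fin (Module.finrank ℂ E) → (E →L[ℂ] ℂ) := fun i => LinearMap.toContinuousLinearMap (bas.coord i)
  refine ⟨⋂ i, N (ℓ i), isOpen_iInter_of_finite fun i => hNo _, mem_iInter.2 fun i => hpN _,
    fun x => ∑ i, Ψ (ℓ i) x • bas i, ?_, ?_⟩
  · apply DifferentiableOn.fun_sum
    intro i _
    exact ((hΨd (ℓ i)).mono (iInter_subset _ i)).smul_const _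
  · intro x hx
    have key : ∀ i, Ψ (ℓ i) x = ℓ i (f x) := by
      intro i
      by_contra hcon
      have hN' : IsOpen (N (ℓ i) ∩ Ω) := (hNo _).inter hΩ.isOpen
      have hxN : x ∈ N (ℓ i) ∩ Ω := ⟨mem_iInter.1 hx.1 i, hx.2⟩
      have hc1 : ContinuousAt (fun y => Ψ (ℓ i) y - ℓ i (f y)) x := by
        have h1 := (hΨd (ℓ i)).continuousOn.continuousAt ((hNo _).mem_nhds hxN.1)
        have h2 := hf.continuousOn.continuousAt (hΩ.isOpen.mem_nhds hx.2)
        exact h1.sub ((ℓ i).continuous.continuousAt.comp h2)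
      have hev := hc1.eventually_ne (sub_ne_zero.2 hcon)
      have hJz : (fun y => (fderiv ℂ f y).det) =ᶠ[𝓝 x] 0 := by
        filter_upwards [hev, hN'.mem_nhds hxN] with y hy hyN
        have e := hΨ (ℓ i) y hyN.1
        rw [hXe 0 0 hyN.2, hXe _ 1 hyN.2] at e
        simp only [pow_zero, mul_one, pow_one] at e
        have e2 : (fderiv ℂ f y).det * (Ψ (ℓ i) y - ℓ i (f y)) = 0 := by rw [mul_sub, e, sub_self]
        exact (mul_eq_zero.1 e2).resolve_right hy
      obtain ⟨y, hy, hy0⟩ := hJ0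
      exact hy0 (hol_identity hΩ.isOpen hprecΩ hJ hx.2 hJz hy)
    simp only [key]
    exact bas.sum_repr (f x)

end extmap
end FBHProof
end

section
open Set Filter Topology MeasureTheory Metric
open scoped Nat ComplexConjugate
set_option linter.unusedSectionVars false
namespace FBHProof

section DDdef
variable {Z X : Type*} [NormedAddCommGroup Z] [InnerProductSpace ℂ Z] [FiniteDimensional ℂ Z]
  [NormedAddCommGroup X] [InnerProductSpace ℂ X] [FiniteDimensional ℂ X]

/-- The domain, over abstract Hermitian spaces. -/
def DD (Z X : Type*) [NormedAddCommGroup Z] [NormedAddCommGroup X] (μ : ℝ) : Set (Z × X) :=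
  {p | ‖p.2‖ ^ 2 < Real.exp (-μ * ‖p.1‖ ^ 2)}

lemma mem_DD {μ : ℝ} {p : Z × X} : p ∈ DD Z X μ ↔ ‖p.2‖ ^ 2 < Real.exp (-μ * ‖p.1‖ ^ 2) := Iff.rfl

lemma DD_CC {μ : ℝ} (hμ : 0 < μ) : CC (DD Z X μ) where
  isOpen := isOpen_lt (by fun_prop) (by fun_prop)
  zero := by simp [mem_DD]
  smul p hp ζ hζ := by
    rw [mem_DD] at hp ⊢
    simp only [Prod.smul_snd, Prod.smul_fst, norm_smul]
    have h1 : ‖ζ‖ ^ 2 ≤ 1 := pow_le_one₀ (norm_nonneg _) hζ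
    calc (‖ζ‖ * ‖p.2‖) ^ 2 = ‖ζ‖ ^ 2 * ‖p.2‖ ^ 2 := by ring
      _ ≤ 1 * ‖p.2‖ ^ 2 := by gcongr
      _ < Real.exp (-μ * ‖p.1‖ ^ 2) := by rw [one_mul]; exact hp
      _ ≤ _ := by
        rw [Real.exp_le_exp]
        have : ‖ζ‖ ^ 2 * ‖p.1‖ ^ 2 ≤ 1 * ‖p.1‖ ^ 2 := by gcongr
        nlinarith

lemma DD_scale {μ : ℝ} (hμ : 0 < μ) {p : Z × X} (hp : ‖p.2‖ ^ 2 ≤ Real.exp (-μ * ‖p.1‖ ^ 2))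
    {s : ℝ} (hs0 : 0 < s) (hs1 : s < 1) : (s : ℂ) • p ∈ DD Z X μ := by
  rw [mem_DD]
  simp only [Prod.smul_snd, Prod.smul_fst, norm_smul, Complex.norm_real,
    Real.norm_of_nonneg hs0.le]
  have h1 : s ^ 2 < 1 := pow_lt_one₀ hs0.le hs1 (by norm_num)
  calc (s * ‖p.2‖) ^ 2 = s ^ 2 * ‖p.2‖ ^ 2 := by ring
    _ ≤ s ^ 2 * Real.exp (-μ * ‖p.1‖ ^ 2) := by gcongr
    _ < 1 * Real.exp (-μ * ‖p.1‖ ^ 2) := by gcongr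
    _ = Real.exp (-μ * ‖p.1‖ ^ 2) := one_mul _
    _ ≤ _ := by
      rw [Real.exp_le_exp]
      have : s ^ 2 * ‖p.1‖ ^ 2 ≤ 1 * ‖p.1‖ ^ 2 := by gcongr
      nlinarith

lemma DD_compl [Nontrivial X] {μ : ℝ} : (DD Z X μ)ᶜ.Nonempty := by
  obtain ⟨x, hx⟩ := exists_ne (0 : X)
  refine ⟨(0, ((2 / ‖x‖ : ℝ) : ℂ) • x), ?_⟩
  rw [mem_compl_iff, mem_DD]
  have := norm_ne_zero_iff.2 hx
  simp only [norm_smul, Complex.norm_real, norm_div, Real.norm_ofNat, norm_norm]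
  rw [div_mul_cancel₀ _ this]
  simp

lemma exp_poly_bound {μ : ℝ} (hμ : 0 < μ) (N : ℕ) :
    ∃ C, 0 ≤ C ∧ ∀ t : ℝ, 0 ≤ t → (1 + t) ^ N * Real.exp (-μ * t ^ 2) ≤ C := by
  refine ⟨N ! * Real.exp (1 + 1 / (4 * μ)), by positivity, fun t ht => ?_⟩
  have h1 := Real.pow_div_factorial_le_exp (1 + t) (by linarith) N
  rw [div_le_iff₀ (by positivity)] at h1
  have h2 : 1 + t ≤ 1 + 1 / (4 * μ) + μ * t ^ 2 := by
    have : 0 ≤ μ * (t - 1 / (2 * μ)) ^ 2 := by positivity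
    have e : μ * (t - 1 / (2 * μ)) ^ 2 = μ * t ^ 2 - t + 1 / (4 * μ) := by field_simp; ring
    linarith
  calc (1 + t) ^ N * Real.exp (-μ * t ^ 2)
      ≤ (Real.exp (1 + 1 / (4 * μ) + μ * t ^ 2) * N !) * Real.exp (-μ * t ^ 2) := by
        gcongr
        exact h1.trans (by gcongr)
    _ = _ := by
      rw [Real.exp_add _ (μ * t ^ 2), mul_right_comm, mul_assoc (Real.exp (1 + 1 / (4 * μ))),
        ← Real.exp_add]
      simp [mul_comm]

variable [MeasurableSpace Z] [BorelSpace Z] [MeasurableSpace X] [BorelSpace X]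

lemma DD_mom_prod [Nontrivial X] {μ : ℝ} (hμ : 0 < μ) (ν₁ : Measure Z) (ν₂ : Measure X) [ν₁.IsAddHaarMeasure]
    [ν₂.IsAddHaarMeasure] (k : ℕ) :
    IntegrableOn (fun y => ‖y‖ ^ k) (DD Z X μ) (ν₁.prod ν₂) := by
  have : ProperSpace Z := FiniteDimensional.proper ℂ Z
  have : ProperSpace X := FiniteDimensional.proper ℂ X
  have : FiniteDimensional ℝ Z := FiniteDimensional.complexToReal Z
  have : FiniteDimensional ℝ X := FiniteDimensional.complexToReal X
  have hDo : IsOpen (DD Z X μ) := (DD_CC hμ).isOpen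
  have hmeas : MeasurableSet (DD Z X μ) := hDo.measurableSet
  refine ⟨by fun_prop, ?_⟩
  have hr1 : ∀ z : Z, Real.exp (-(μ / 2) * ‖z‖ ^ 2) ≤ 1 := fun z => by
    rw [Real.exp_le_one_iff]; nlinarith [sq_nonneg ‖z‖]
  have hsub : ∀ z x, (z, x) ∈ DD Z X μ → ‖x‖ < Real.exp (-(μ / 2) * ‖z‖ ^ 2) := by
    intro z x h
    rw [mem_DD] at h
    simp only at h
    refine lt_of_pow_lt_pow_left₀ 2 (Real.exp_pos _).le (h.trans_eq ?_)
    rw [← Real.exp_nat_mul]; congr 1; push_cast; ring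
  set N := Module.finrank ℝ Z + 1
  obtain ⟨C, hC, hCb⟩ := exp_poly_bound (show 0 < μ / 2 by positivity) (k + N)
  have hdecay : ∀ z : Z, (1 + ‖z‖) ^ k * Real.exp (-(μ / 2) * ‖z‖ ^ 2) ≤ C * (1 + ‖z‖) ^ (-(N : ℝ)) := by
    intro z
    have := hCb ‖z‖ (norm_nonneg z)
    rw [Real.rpow_neg (by positivity), Real.rpow_natCast, ← div_eq_mul_inv, le_div_iff₀ (by positivity)]
    rw [pow_add] at this; linarith
  have hintg : Integrable (fun z : Z => C * (1 + ‖z‖) ^ (-(N : ℝ))) ν₁ :=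
    (integrable_one_add_norm (by simp [N])).const_mul C
  rw [HasFiniteIntegral, ← lintegral_indicator hmeas, lintegral_prod]
  · have hle : ∀ z : Z, ∫⁻ x, (DD Z X μ).indicator (fun y => ‖‖y‖ ^ k‖ₑ) (z, x) ∂ν₂ ≤
        ENNReal.ofReal (C * (1 + ‖z‖) ^ (-(N : ℝ))) * ν₂ (ball 0 1) := by
      intro z
      calc ∫⁻ x, (DD Z X μ).indicator (fun y => ‖‖y‖ ^ k‖ₑ) (z, x) ∂ν₂
          ≤ ∫⁻ x, (ball (0:X) (Real.exp (-(μ / 2) * ‖z‖ ^ 2))).indicator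
              (fun _ => ENNReal.ofReal ((1 + ‖z‖) ^ k)) x ∂ν₂ := by
            apply lintegral_mono
            intro x
            by_cases hx : (z, x) ∈ DD Z X μ
            · have hx2 := hsub z x hx
              simp only
              rw [indicator_of_mem hx, indicator_of_mem (by simpa using hx2)]
              rw [Real.enorm_of_nonneg (by positivity)]
              apply ENNReal.ofReal_le_ofReal
              gcongr
              rw [Prod.norm_def]
              apply max_le
              · simp
              · simp only
                linarith [hr1 z, norm_nonneg z]
            · simp only
              rw [indicator_of_notMem hx]; positivity
        _ = ENNReal.ofReal ((1 + ‖z‖) ^ k) * ν₂ (ball (0:X) (Real.exp (-(μ / 2) * ‖z‖ ^ 2))) := by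
            rw [lintegral_indicator_const measurableSet_ball]
        _ ≤ ENNReal.ofReal ((1 + ‖z‖) ^ k) *
              (ENNReal.ofReal (Real.exp (-(μ / 2) * ‖z‖ ^ 2)) * ν₂ (ball 0 1)) := by
            gcongr
            rw [Measure.addHaar_ball ν₂ _ (Real.exp_pos _).le]
            gcongr
            apply pow_le_of_le_one (Real.exp_pos _).le (hr1 z)
            exact (Module.finrank_pos (R := ℝ) (M := X)).ne'
        _ ≤ _ := by
            rw [← mul_assoc, ← ENNReal.ofReal_mul (by positivity)]
            exact mul_le_mul_left (ENNReal.ofReal_le_ofReal (hdecay z)) _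
    refine (lintegral_mono hle).trans_lt ?_
    rw [lintegral_mul_const]
    · refine ENNReal.mul_lt_top ?_ measure_ball_lt_top
      have := hintg.2
      rw [HasFiniteIntegral] at this
      refine lt_of_le_of_lt (lintegral_mono fun z => ?_) this
      rw [Real.enorm_of_nonneg (by positivity)]
    · fun_prop
  · refine (Measurable.indicator ?_ hmeas).aemeasurable
    fun_prop

lemma DD_mom [Nontrivial X] {μ : ℝ} (hμ : 0 < μ) (ν : Measure (Z × X)) [ν.IsAddHaarMeasure] (k : ℕ) :
    IntegrableOn (fun y => ‖y‖ ^ k) (DD Z X μ) ν := by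
  have : ProperSpace Z := FiniteDimensional.proper ℂ Z
  have : ProperSpace X := FiniteDimensional.proper ℂ X
  have : FiniteDimensional ℝ Z := FiniteDimensional.complexToReal Z
  have : FiniteDimensional ℝ X := FiniteDimensional.complexToReal X
  have h := DD_mom_prod (Z := Z) (X := X) hμ Measure.addHaar Measure.addHaar k
  rw [Measure.isAddLeftInvariant_eq_smul ν ((Measure.addHaar : Measure Z).prod (Measure.addHaar : Measure X))]
  rw [IntegrableOn, Measure.restrict_smul]
  exact h.smul_measure_nnreal
end DDdef

section extDD
variable {Z X Z' X' : Type*} [NormedAddCommGroup Z] [InnerProductSpace ℂ Z] [FiniteDimensional ℂ Z]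
  [NormedAddCommGroup X] [InnerProductSpace ℂ X] [FiniteDimensional ℂ X]
  [NormedAddCommGroup Z'] [InnerProductSpace ℂ Z'] [FiniteDimensional ℂ Z']
  [NormedAddCommGroup X'] [InnerProductSpace ℂ X'] [FiniteDimensional ℂ X']
  [Nontrivial X] [Nontrivial X']

theorem DD_ext (T : (Z' × X') ≃L[ℂ] (Z × X)) {μ μ' : ℝ} (hμ : 0 < μ) (hμ' : 0 < μ')
    {f : Z × X → Z' × X'} (hf : DifferentiableOn ℂ f (DD Z X μ))
    (hmaps : MapsTo f (DD Z X μ) (DD Z' X' μ'))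
    (hprop : ∀ K ⊆ DD Z' X' μ', IsCompact K → IsCompact (f ⁻¹' K ∩ DD Z X μ))
    {p : Z × X} (hp : ‖p.2‖ ^ 2 ≤ Real.exp (-μ * ‖p.1‖ ^ 2)) :
    ∃ N, IsOpen N ∧ p ∈ N ∧
      ∃ f' : Z × X → Z' × X', DifferentiableOn ℂ f' N ∧ EqOn f' f (N ∩ DD Z X μ) := by
  let _ : MeasurableSpace Z := borel Z
  have : BorelSpace Z := ⟨rfl⟩
  let _ : MeasurableSpace X := borel X
  have : BorelSpace X := ⟨rfl⟩
  let _ : MeasurableSpace Z' := borel Z'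
  have : BorelSpace Z' := ⟨rfl⟩
  let _ : MeasurableSpace X' := borel X'
  have : BorelSpace X' := ⟨rfl⟩
  have : ProperSpace Z := FiniteDimensional.proper ℂ Z
  have : ProperSpace X := FiniteDimensional.proper ℂ X
  have : ProperSpace Z' := FiniteDimensional.proper ℂ Z'
  have : ProperSpace X' := FiniteDimensional.proper ℂ X'
  have : FiniteDimensional ℝ Z := FiniteDimensional.complexToReal Z
  have : FiniteDimensional ℝ X := FiniteDimensional.complexToReal X
  let ν : Measure (Z × X) := (Measure.addHaar : Measure Z).prod (Measure.addHaar : Measure X)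
  have hC := DD_CC (Z := Z') (X := X') hμ'
  let W : Set (Z × X) := T.symm ⁻¹' DD Z' X' μ'
  have hW : CC W := by
    refine ⟨hC.isOpen.preimage T.symm.continuous, ?_, ?_⟩
    · simp [W, hC.zero]
    · intro x hx ζ hζ
      simp only [W, mem_preimage, map_smul]
      exact hC.smul _ hx ζ hζ
  have hne : Wᶜ.Nonempty := by
    obtain ⟨y, hy⟩ := DD_compl (Z := Z') (X := X') (μ := μ')
    exact ⟨T y, by simpa [W] using hy⟩
  have hmomW : ∀ k : ℕ, IntegrableOn (fun y => ‖y‖ ^ k) W ν := by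
    intro k
    have hmap : (ν.map T.symm).IsAddHaarMeasure := T.symm.isAddHaarMeasure_map ν
    have h1 := (DD_mom (Z := Z') (X := X') hμ' (ν.map T.symm) k).const_mul
      (‖(T : (Z' × X') →L[ℂ] (Z × X))‖ ^ k)
    have h2 : IntegrableOn (fun y => ‖T y‖ ^ k) (DD Z' X' μ') (ν.map T.symm) := by
      refine Integrable.mono' h1 ?_ (Eventually.of_forall fun y => ?_)
      · have := T.continuous
        fun_prop
      · rw [norm_pow, norm_norm, ← mul_pow]
        gcongr
        exact (T : (Z' × X') →L[ℂ] (Z × X)).le_opNorm y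
    have h3 := (T.symm.toHomeomorph.measurableEmbedding.integrableOn_map_iff).1 h2
    refine h3.congr_fun (fun y _ => ?_) (hW.isOpen.measurableSet)
    show ‖T (T.symm y)‖ ^ k = _
    simp
  obtain ⟨s, hs0, hs1, hs⟩ := ext_map ν (DD_CC hμ) hW hne (DD_mom hμ ν) hmomW
    (f := fun x => T (f x)) (T.differentiable.comp_differentiableOn hf)
    (fun x hx => by simpa [W] using hmaps hx) (by
      intro K hKW hK
      have h := hprop (T.symm '' K) (by rintro _ ⟨y, hy, rfl⟩; exact hKW hy)
        (hK.image T.symm.continuous)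
      have e : (fun x => T (f x)) ⁻¹' K = f ⁻¹' (T.symm '' K) := by
        apply Set.ext
        intro x
        simp only [mem_preimage, mem_image]
        constructor
        · intro hx; exact ⟨_, hx, by simp⟩
        · rintro ⟨y, hy, hyx⟩; rw [← hyx]; simpa using hy
      rw [e]; exact h)
  obtain ⟨N, hNo, hpN, F', hF'd, hF'⟩ := hs p (DD_scale hμ hp hs0 hs1)
  refine ⟨N, hNo, hpN, fun x => T.symm (F' x), T.symm.differentiable.comp_differentiableOn hF'd, ?_⟩
  intro x hx
  simp only
  rw [hF' hx]; simp

end extDD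
end FBHProof
end

section
open Set Filter Topology MeasureTheory Metric
open scoped Nat ComplexConjugate
set_option linter.unusedSectionVars false
namespace FBHProof

lemma pick_id (a u : ℂ) : ‖1 - conj a * u‖ ^ 2 - ‖u - a‖ ^ 2 = (1 - ‖a‖ ^ 2) * (1 - ‖u‖ ^ 2) := by
  simp only [Complex.sq_norm, Complex.normSq_apply]
  simp
  ring

lemma pick {u : ℂ → ℂ} (hu : DifferentiableOn ℂ u (ball 0 1)) (hm : MapsTo u (ball 0 1) (ball 0 1))
    {ζ : ℂ} (hζ : ‖ζ‖ < 1) : (1 - ‖ζ‖ ^ 2) * ((1 - ‖u 0‖) / 2) ≤ 1 - ‖u ζ‖ ^ 2 := by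
  set a := u 0 with ha
  have ha1 : ‖a‖ < 1 := by simpa using hm (mem_ball_self one_pos)
  have hlow : ∀ w : ℂ, ‖w‖ < 1 → 1 - ‖a‖ ≤ ‖1 - conj a * w‖ := by
    intro w hw
    have h1 := norm_sub_norm_le (1:ℂ) (conj a * w)
    rw [norm_one, norm_mul, RCLike.norm_conj] at h1
    nlinarith [norm_nonneg a, norm_nonneg w]
  have hne : ∀ w : ℂ, ‖w‖ < 1 → 1 - conj a * w ≠ 0 := by
    intro w hw h
    have := hlow w hw
    rw [h, norm_zero] at this; linarith
  have hu1 : ∀ w ∈ ball (0:ℂ) 1, ‖u w‖ < 1 := fun w hw => by simpa using hm hw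
  have hle : ∀ w : ℂ, ‖w‖ < 1 → ‖w - a‖ ≤ ‖1 - conj a * w‖ := by
    intro w hw
    refine (pow_le_pow_iff_left₀ (norm_nonneg _) (norm_nonneg _) two_ne_zero).1 ?_
    have := pick_id a w
    have h2 : 0 ≤ (1 - ‖a‖ ^ 2) * (1 - ‖w‖ ^ 2) := by
      apply mul_nonneg <;> nlinarith [norm_nonneg a, norm_nonneg w]
    linarith
  have hS : ‖(u ζ - a) / (1 - conj a * u ζ)‖ ≤ ‖ζ‖ := by
    refine Complex.norm_le_norm_of_mapsTo_ball (f := fun z => (u z - a) / (1 - conj a * u z)) (R := 1)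
      ?_ ?_ ?_ hζ
    · exact (hu.sub_const a).div ((hu.const_mul (conj a)).const_sub 1) (fun w hw => hne _ (hu1 w hw))
    · intro w hw
      rw [mem_closedBall_zero_iff, norm_div]
      exact div_le_one_of_le₀ (hle _ (hu1 w hw)) (norm_nonneg _)
    · simp [ha]
  have hz := hu1 ζ (by simpa using hζ)
  rw [norm_div, div_le_iff₀ (norm_pos_iff.2 (hne _ hz))] at hS
  have h1 := pick_id a (u ζ)
  have h2 := hlow _ hz
  have h3 : ‖u ζ - a‖ ^ 2 ≤ ‖ζ‖ ^ 2 * ‖1 - conj a * u ζ‖ ^ 2 := by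
    rw [← mul_pow]; gcongr
  have h4 : 0 < 1 - ‖ζ‖ ^ 2 := by nlinarith [norm_nonneg ζ]
  have h5 : (1 - ‖a‖) ^ 2 ≤ ‖1 - conj a * u ζ‖ ^ 2 := by
    have : 0 ≤ 1 - ‖a‖ := by linarith
    gcongr
  have h6 : (1 - ‖ζ‖ ^ 2) * (1 - ‖a‖) ^ 2 ≤ (1 - ‖a‖ ^ 2) * (1 - ‖u ζ‖ ^ 2) := by
    have : (1 - ‖ζ‖ ^ 2) * (1 - ‖a‖) ^ 2 ≤ (1 - ‖ζ‖ ^ 2) * ‖1 - conj a * u ζ‖ ^ 2 := by gcongr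
    nlinarith
  have h7 : (1 - ‖ζ‖ ^ 2) * (1 - ‖a‖) ≤ (1 + ‖a‖) * (1 - ‖u ζ‖ ^ 2) := by
    have hp : 0 < 1 - ‖a‖ := by linarith
    by_contra! hcon
    have := mul_lt_mul_of_pos_left hcon hp
    nlinarith
  have h8 : 0 ≤ 1 - ‖u ζ‖ ^ 2 := by nlinarith [norm_nonneg (u ζ)]
  nlinarith [norm_nonneg a]

section hopf
variable {Z X : Type*} [NormedAddCommGroup Z] [InnerProductSpace ℂ Z] [FiniteDimensional ℂ Z]
  [NormedAddCommGroup X] [InnerProductSpace ℂ X] [FiniteDimensional ℂ X]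

/-- defining quantity -/
noncomputable def MM (μ : ℝ) (q : Z × X) : ℝ := ‖q.2‖ ^ 2 * Real.exp (μ * ‖q.1‖ ^ 2)

lemma MM_lt {μ : ℝ} {q : Z × X} : MM μ q < 1 ↔ q ∈ DD Z X μ := by
  rw [mem_DD, MM, neg_mul, Real.exp_neg, ← one_div, lt_div_iff₀ (Real.exp_pos _)]

lemma MM_le {μ : ℝ} {q : Z × X} : MM μ q ≤ 1 ↔ ‖q.2‖ ^ 2 ≤ Real.exp (-μ * ‖q.1‖ ^ 2) := by
  rw [MM, neg_mul, Real.exp_neg, ← one_div, le_div_iff₀ (Real.exp_pos _)]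

lemma MM_cont (μ : ℝ) : Continuous (MM μ : Z × X → ℝ) := by unfold MM; fun_prop

lemma MM_smul (μ : ℝ) (c : ℂ) (z : Z) (x : X) : MM μ (z, c • x) = ‖c‖ ^ 2 * MM μ (z, x) := by
  simp only [MM, norm_smul]; ring

lemma hopf {μ : ℝ} (hμ : 0 < μ) {g : Z × X → ℂ} (hg : DifferentiableOn ℂ g (DD Z X μ))
    (hg1 : ∀ q ∈ DD Z X μ, ‖g q‖ < 1) (z₀ : Z) :
    ∃ κ > 0, ∃ δ > 0, ∀ q ∈ DD Z X μ, dist q.1 z₀ < δ → q.2 ≠ 0 →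
      ‖g q‖ ^ 2 ≤ 1 - κ * (1 - MM μ q) := by
  have hz : ∀ z : Z, ((z, 0) : Z × X) ∈ DD Z X μ := fun z => by
    rw [mem_DD]; simp [Real.exp_pos]
  set α := (1 + ‖g (z₀, 0)‖) / 2 with hα
  have hα1 : α < 1 := by have := hg1 _ (hz z₀); rw [hα]; linarith
  have hα2 : ‖g (z₀, 0)‖ < α := by have := hg1 _ (hz z₀); rw [hα]; linarith
  have hc : Continuous fun z => ‖g (z, 0)‖ := by
    refine continuous_norm.comp (hg.continuousOn.comp_continuous (by fun_prop) hz)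
  obtain ⟨δ, hδ, hδα⟩ := Metric.eventually_nhds_iff.1 (hc.continuousAt.eventually_lt_const hα2)
  refine ⟨(1 - α) / 2, by linarith, δ, hδ, ?_⟩
  rintro ⟨z, w⟩ hq hd hw
  have hM0 : 0 < MM μ (z, w) := by
    have := norm_pos_iff.2 hw
    unfold MM; positivity
  have hM1 := MM_lt.2 hq
  set τ := Real.sqrt (MM μ (z, w)) with hτ
  have hτ2 : τ ^ 2 = MM μ (z, w) := Real.sq_sqrt hM0.le
  have hτ0 : 0 < τ := Real.sqrt_pos.2 hM0
  have hτ1 : τ < 1 := by nlinarith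
  have hnorm : ‖(τ : ℂ)‖ = τ := by rw [Complex.norm_real, Real.norm_of_nonneg hτ0.le]
  have hin : ∀ ζ ∈ ball (0:ℂ) 1, ((z, ζ • ((τ : ℂ)⁻¹ • w)) : Z × X) ∈ DD Z X μ := by
    intro ζ hζ
    have hζ' : ‖ζ‖ < 1 := by simpa using hζ
    rw [← MM_lt, MM_smul, MM_smul, norm_inv, hnorm, ← hτ2, inv_pow, inv_mul_cancel₀ (by positivity),
      mul_one]
    nlinarith [norm_nonneg ζ]
  have := pick (u := fun ζ => g (z, ζ • ((τ : ℂ)⁻¹ • w)))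
    (hg.comp (by fun_prop : Differentiable ℂ fun ζ : ℂ => ((z, ζ • ((τ : ℂ)⁻¹ • w)) : Z × X)).differentiableOn hin)
    (fun ζ hζ => by simpa using hg1 _ (hin ζ hζ)) (ζ := τ) (by rw [hnorm]; exact hτ1)
  rw [hnorm, hτ2, smul_inv_smul₀ (by exact_mod_cast hτ0.ne')] at this
  simp only [zero_smul] at this
  have h3 : ‖g (z, 0)‖ < α := hδα hd
  nlinarith

end hopf

section hfun
variable {Z X : Type*} [NormedAddCommGroup Z] [InnerProductSpace ℂ Z] [FiniteDimensional ℂ Z]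
  [NormedAddCommGroup X] [InnerProductSpace ℂ X] [FiniteDimensional ℂ X]

/-- peak function -/
noncomputable def hh (μ : ℝ) (P : Z × X) (q : Z × X) : ℂ :=
  ((‖P.2‖⁻¹ * Real.exp (-(μ * ‖P.1‖ ^ 2 / 2)) : ℝ) : ℂ) *
    (inner ℂ P.2 q.2 * Complex.exp (μ * inner ℂ P.1 q.1))

lemma hh_diff (μ : ℝ) (P : Z × X) : Differentiable ℂ (hh μ P) := by
  have h1 : Differentiable ℂ fun q : Z × X => inner ℂ P.2 q.2 :=
    (innerSL ℂ P.2).differentiable.comp differentiable_snd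
  have h2 : Differentiable ℂ fun q : Z × X => inner ℂ P.1 q.1 :=
    (innerSL ℂ P.1).differentiable.comp differentiable_fst
  unfold hh
  exact (h1.mul (h2.const_mul _).cexp).const_mul _

lemma hh_norm_sq (μ : ℝ) (P q : Z × X) :
    ‖hh μ P q‖ ^ 2 = (‖P.2‖⁻¹ * ‖(inner ℂ P.2 q.2 : ℂ)‖) ^ 2 * Real.exp (μ * ‖q.1‖ ^ 2) *
      Real.exp (-(μ * ‖q.1 - P.1‖ ^ 2)) := by
  unfold hh
  rw [norm_mul, norm_mul, Complex.norm_real, Complex.norm_exp, Real.norm_of_nonneg (by positivity)]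
  have e : ‖q.1 - P.1‖ ^ 2 = ‖q.1‖ ^ 2 - 2 * (inner ℂ P.1 q.1 : ℂ).re + ‖P.1‖ ^ 2 := by
    rw [@norm_sub_sq ℂ, inner_re_symm (𝕜 := ℂ)]; simp
  have e2 : ((μ : ℂ) * inner ℂ P.1 q.1).re = μ * (inner ℂ P.1 q.1 : ℂ).re := by simp
  rw [e, e2]
  have e3 : Real.exp (μ * ‖q.1‖ ^ 2) *
      Real.exp (-(μ * (‖q.1‖ ^ 2 - 2 * (inner ℂ P.1 q.1 : ℂ).re + ‖P.1‖ ^ 2))) =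
      (Real.exp (-(μ * ‖P.1‖ ^ 2 / 2)) * Real.exp (μ * (inner ℂ P.1 q.1 : ℂ).re)) ^ 2 := by
    rw [← Real.exp_add, ← Real.exp_add, ← Real.exp_nat_mul]; congr 1; push_cast; ring
  rw [mul_assoc ((‖P.2‖⁻¹ * ‖(inner ℂ P.2 q.2 : ℂ)‖) ^ 2), e3]
  ring

lemma hh_le {μ : ℝ} (hμ : 0 < μ) (P q : Z × X) : ‖hh μ P q‖ ^ 2 ≤ MM μ q := by
  rw [hh_norm_sq, MM]
  have h1 : ‖P.2‖⁻¹ * ‖(inner ℂ P.2 q.2 : ℂ)‖ ≤ ‖q.2‖ := by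
    rcases eq_or_ne P.2 0 with h | h
    · rw [h]; simp
    · rw [inv_mul_le_iff₀ (norm_pos_iff.2 h)]; exact norm_inner_le_norm _ _
  have h2 : Real.exp (-(μ * ‖q.1 - P.1‖ ^ 2)) ≤ 1 := by
    rw [Real.exp_le_one_iff]; have : 0 ≤ μ * ‖q.1 - P.1‖ ^ 2 := by positivity
    linarith
  calc _ ≤ ‖q.2‖ ^ 2 * Real.exp (μ * ‖q.1‖ ^ 2) * 1 := by gcongr
    _ = _ := mul_one _

lemma hh_lt {μ : ℝ} (hμ : 0 < μ) (P : Z × X) {q : Z × X} (hq : q ∈ DD Z X μ) : ‖hh μ P q‖ < 1 := by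
  have h1 := hh_le hμ P q
  have h2 := MM_lt.2 hq
  nlinarith [norm_nonneg (hh μ P q)]

lemma hh_ge {μ : ℝ} (hμ : 0 < μ) (P : Z × X) (hP : P.2 ≠ 0) {q : Z × X} (hq : MM μ q = 1) :
    1 - (μ + (‖q.2‖ ^ 2)⁻¹) * ‖q - P‖ ^ 2 ≤ ‖hh μ P q‖ ^ 2 := by
  have hq2 : 0 < ‖q.2‖ ^ 2 := by
    by_contra! h
    have : MM μ q ≤ 0 := mul_nonpos_of_nonpos_of_nonneg h (Real.exp_pos _).le
    linarith
  have hPn := norm_pos_iff.2 hP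
  have e : ‖q.2 - P.2‖ ^ 2 = ‖q.2‖ ^ 2 - 2 * (inner ℂ P.2 q.2 : ℂ).re + ‖P.2‖ ^ 2 := by
    rw [@norm_sub_sq ℂ, inner_re_symm (𝕜 := ℂ)]; simp
  set I := ‖P.2‖⁻¹ * ‖(inner ℂ P.2 q.2 : ℂ)‖ with hI
  have h1 : (inner ℂ P.2 q.2 : ℂ).re ≤ ‖P.2‖ * I := by
    rw [hI, mul_inv_cancel_left₀ hPn.ne']; exact Complex.re_le_norm _
  have h2 : ‖q.2‖ ^ 2 - ‖q.2 - P.2‖ ^ 2 ≤ I ^ 2 := by nlinarith [sq_nonneg (I - ‖P.2‖)]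
  have h2a : ‖q.2 - P.2‖ ≤ ‖q - P‖ := norm_snd_le (q - P)
  have h2b : ‖q.1 - P.1‖ ≤ ‖q - P‖ := norm_fst_le (q - P)
  have hIle : I ^ 2 ≤ ‖q.2‖ ^ 2 := by
    have : I ≤ ‖q.2‖ := by
      rw [hI, inv_mul_le_iff₀ hPn]; exact norm_inner_le_norm _ _
    gcongr
  rw [hh_norm_sq]
  have hexp : Real.exp (μ * ‖q.1‖ ^ 2) = (‖q.2‖ ^ 2)⁻¹ := by
    unfold MM at hq
    exact eq_inv_of_mul_eq_one_right hq
  rw [hexp]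
  have h3 := Real.add_one_le_exp (-(μ * ‖q.1 - P.1‖ ^ 2))
  have h4 : 1 - (‖q.2‖ ^ 2)⁻¹ * ‖q.2 - P.2‖ ^ 2 ≤ I ^ 2 * (‖q.2‖ ^ 2)⁻¹ := by
    have := mul_le_mul_of_nonneg_right h2 (inv_pos.2 hq2).le
    rw [sub_mul, mul_inv_cancel₀ hq2.ne'] at this
    linarith
  have h5 : I ^ 2 * (‖q.2‖ ^ 2)⁻¹ ≤ 1 := by
    rw [← div_eq_mul_inv, div_le_one hq2]; exact hIle
  have h6 : 0 ≤ I ^ 2 * (‖q.2‖ ^ 2)⁻¹ := by positivity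
  have h7 : (‖q.2‖ ^ 2)⁻¹ * ‖q.2 - P.2‖ ^ 2 ≤ (‖q.2‖ ^ 2)⁻¹ * ‖q - P‖ ^ 2 := by gcongr
  have h8 : μ * ‖q.1 - P.1‖ ^ 2 ≤ μ * ‖q - P‖ ^ 2 := by gcongr
  have h9 : 0 ≤ μ * ‖q.1 - P.1‖ ^ 2 := by positivity
  have h10 := mul_le_mul_of_nonneg_left h3 h6
  nlinarith

lemma hh_self {μ : ℝ} {P : Z × X} (hP : MM μ P = 1) : hh μ P P = 1 := by
  have hq2 : 0 < ‖P.2‖ ^ 2 := by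
    by_contra! h
    have : MM μ P ≤ 0 := mul_nonpos_of_nonpos_of_nonneg h (Real.exp_pos _).le
    linarith
  have hPn : 0 < ‖P.2‖ := by
    rcases (norm_nonneg P.2).eq_or_lt with h | h
    · rw [← h] at hq2; simp at hq2
    · exact h
  have h1 : ‖P.2‖ * Real.exp (μ * ‖P.1‖ ^ 2 / 2) = 1 := by
    have : (‖P.2‖ * Real.exp (μ * ‖P.1‖ ^ 2 / 2)) ^ 2 = 1 := by
      rw [← hP, MM, mul_pow, ← Real.exp_nat_mul]; congr 2; push_cast; ring
    exact (pow_eq_one_iff_of_nonneg (by positivity) (by norm_num)).1 this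
  unfold hh
  rw [inner_self_eq_norm_sq_to_K, inner_self_eq_norm_sq_to_K]
  have e : (‖P.2‖⁻¹ * Real.exp (-(μ * ‖P.1‖ ^ 2 / 2))) * (‖P.2‖ ^ 2 * Real.exp (μ * ‖P.1‖ ^ 2)) = 1 := by
    have : Real.exp (-(μ * ‖P.1‖ ^ 2 / 2)) * Real.exp (μ * ‖P.1‖ ^ 2) = Real.exp (μ * ‖P.1‖ ^ 2 / 2) := by
      rw [← Real.exp_add]; congr 1; ring
    calc _ = (‖P.2‖⁻¹ * ‖P.2‖) * ‖P.2‖ * (Real.exp (-(μ * ‖P.1‖ ^ 2 / 2)) * Real.exp (μ * ‖P.1‖ ^ 2)) := by ring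
      _ = _ := by rw [this, inv_mul_cancel₀ hPn.ne', one_mul, h1]
  have := congrArg (fun x : ℝ => (x : ℂ)) e
  push_cast at this ⊢
  exact this
end hfun

section bdry
variable {Z X Z' X' : Type*} [NormedAddCommGroup Z] [InnerProductSpace ℂ Z] [FiniteDimensional ℂ Z]
  [NormedAddCommGroup X] [InnerProductSpace ℂ X] [FiniteDimensional ℂ X]
  [NormedAddCommGroup Z'] [InnerProductSpace ℂ Z'] [FiniteDimensional ℂ Z']
  [NormedAddCommGroup X'] [InnerProductSpace ℂ X'] [FiniteDimensional ℂ X']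

lemma bdry_to_bdry {μ μ' : ℝ} (hμ' : 0 < μ')
    {f f' : Z × X → Z' × X'}
    (hmaps : MapsTo f (DD Z X μ) (DD Z' X' μ'))
    (hprop : ∀ K ⊆ DD Z' X' μ', IsCompact K → IsCompact (f ⁻¹' K ∩ DD Z X μ))
    {N : Set (Z × X)} (hN : IsOpen N) (hf' : ContinuousOn f' N) (heq : EqOn f' f (N ∩ DD Z X μ))
    {q : Z × X} (hqN : q ∈ N) (hq : MM μ q = 1) : MM μ' (f' q) = 1 := by
  have : ProperSpace Z' := FiniteDimensional.proper ℂ Z'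
  have : ProperSpace X' := FiniteDimensional.proper ℂ X'
  set sq : ℕ → Z × X := fun k => (q.1, ((1 - 1 / ((k : ℝ) + 1) : ℝ) : ℂ) • q.2) with hsq
  have hseq : Tendsto sq atTop (𝓝 q) := by
    have h1 : Tendsto (fun k : ℕ => ((1 - 1 / ((k : ℝ) + 1) : ℝ) : ℂ)) atTop (𝓝 ((1 - 0 : ℝ) : ℂ)) :=
      (Complex.continuous_ofReal.tendsto _).comp
        (tendsto_const_nhds.sub tendsto_one_div_add_atTop_nhds_zero_nat)
    have h2 := h1.smul_const q.2
    simp only [sub_zero, Complex.ofReal_one, one_smul] at h2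
    exact (tendsto_const_nhds (x := q.1)).prodMk_nhds h2
  have hD : ∀ k, sq k ∈ DD Z X μ := by
    intro k
    rw [← MM_lt, hsq]
    simp only
    rw [MM_smul, Prod.mk.eta, hq, mul_one, Complex.norm_real, Real.norm_eq_abs, sq_abs]
    have h1 : 0 < 1 / ((k:ℝ) + 1) := by positivity
    have h2 : 1 / ((k:ℝ) + 1) ≤ 1 := by rw [div_le_one (by positivity)]; linarith [(k.cast_nonneg : (0:ℝ) ≤ k)]
    nlinarith
  have hfc : ContinuousAt f' q := hf'.continuousAt (hN.mem_nhds hqN)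
  have hft : Tendsto (fun k => f' (sq k)) atTop (𝓝 (f' q)) := hfc.tendsto.comp hseq
  have hNe : ∀ᶠ k in atTop, sq k ∈ N := hseq.eventually (hN.mem_nhds hqN)
  have hff : ∀ᶠ k in atTop, f' (sq k) = f (sq k) := by
    filter_upwards [hNe] with k hk using heq ⟨hk, hD k⟩
  apply le_antisymm
  · refine le_of_tendsto (((MM_cont μ').tendsto _).comp hft) ?_
    filter_upwards [hff] with k hk
    simp only [Function.comp]
    rw [hk]
    exact (MM_lt.2 (hmaps (hD k))).le
  · by_contra! hlt
    have hmem : f' q ∈ DD Z' X' μ' := MM_lt.1 hlt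
    obtain ⟨ε, hε, hεD⟩ := Metric.nhds_basis_closedBall.mem_iff.1 ((DD_CC hμ').isOpen.mem_nhds hmem)
    have hK := hprop _ hεD (isCompact_closedBall _ _)
    have hin : ∀ᶠ k in atTop, sq k ∈ f ⁻¹' (closedBall (f' q) ε) ∩ DD Z X μ := by
      filter_upwards [hff, hft.eventually (closedBall_mem_nhds _ hε)] with k hk hk2
      refine ⟨?_, hD k⟩
      rw [mem_preimage, ← hk]; exact hk2
    have := hK.isClosed.mem_of_tendsto hseq hin
    have := MM_lt.2 this.2
    linarith
end bdry
end FBHProof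
end

section
open Set Filter Topology MeasureTheory Metric
open scoped Nat ComplexConjugate
set_option linter.unusedSectionVars false
namespace FBHProof

section fam
variable {Z X : Type*} [NormedAddCommGroup Z] [InnerProductSpace ℂ Z]
  [NormedAddCommGroup X] [InnerProductSpace ℂ X]

/-- Two-parameter family of points near a boundary point. -/
noncomputable def QF (μ : ℝ) (z₀ : Z) (w₀ : X) (x : Z) (y : X) (v : ℂ × ℂ) : Z × X :=
  (z₀ + v.1 • x, (v.2 * Complex.exp (-(μ * inner ℂ z₀ x) * v.1)) • (w₀ + v.1 • y))

/-- growth factor -/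
noncomputable def NN (a ρ u : ℝ) : ℝ := (1 + ρ * u) * Real.exp (a * u)

lemma QF_MM (μ : ℝ) (z₀ : Z) (w₀ : X) (x : Z) (y : X) (hy : inner ℂ w₀ y = 0)
    (h : MM μ (z₀, w₀) = 1) (v : ℂ × ℂ) :
    MM μ (QF μ z₀ w₀ x y v) =
      ‖v.2‖ ^ 2 * NN (μ * ‖x‖ ^ 2) (‖y‖ ^ 2 * Real.exp (μ * ‖z₀‖ ^ 2)) (‖v.1‖ ^ 2) := by
  obtain ⟨ζ, τ⟩ := v
  simp only [MM, QF, NN] at *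
  have e1 : ‖z₀ + ζ • x‖ ^ 2 = ‖z₀‖ ^ 2 + 2 * (ζ * inner ℂ z₀ x).re + ‖ζ‖ ^ 2 * ‖x‖ ^ 2 := by
    rw [@norm_add_sq ℂ, inner_smul_right, norm_smul, mul_pow]; simp
  have e2 : ‖w₀ + ζ • y‖ ^ 2 = ‖w₀‖ ^ 2 + ‖ζ‖ ^ 2 * ‖y‖ ^ 2 := by
    rw [@norm_add_sq ℂ, inner_smul_right, norm_smul, mul_pow, hy]; simp
  have e3 : ‖Complex.exp (-(μ * inner ℂ z₀ x) * ζ)‖ ^ 2 = Real.exp (-(μ * (2 * (ζ * inner ℂ z₀ x).re))) := by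
    rw [Complex.norm_exp, ← Real.exp_nat_mul]
    have : -((μ:ℂ) * inner ℂ z₀ x) * ζ = ((-μ : ℝ) : ℂ) * (ζ * inner ℂ z₀ x) := by push_cast; ring
    rw [this, Complex.re_ofReal_mul]; congr 1; push_cast; ring
  rw [norm_smul, norm_mul, mul_pow, mul_pow, e1, e2, e3]
  have e4 : Real.exp (-(μ * (2 * (ζ * inner ℂ z₀ x).re))) *
      Real.exp (μ * (‖z₀‖ ^ 2 + 2 * (ζ * inner ℂ z₀ x).re + ‖ζ‖ ^ 2 * ‖x‖ ^ 2)) =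
      Real.exp (μ * ‖z₀‖ ^ 2) * Real.exp (μ * ‖x‖ ^ 2 * ‖ζ‖ ^ 2) := by
    rw [← Real.exp_add, ← Real.exp_add]; congr 1; ring
  calc _ = ‖τ‖ ^ 2 * (‖w₀‖ ^ 2 + ‖ζ‖ ^ 2 * ‖y‖ ^ 2) * (Real.exp (-(μ * (2 * (ζ * inner ℂ z₀ x).re))) *
      Real.exp (μ * (‖z₀‖ ^ 2 + 2 * (ζ * inner ℂ z₀ x).re + ‖ζ‖ ^ 2 * ‖x‖ ^ 2))) := by ring
    _ = ‖τ‖ ^ 2 * (‖w₀‖ ^ 2 * Real.exp (μ * ‖z₀‖ ^ 2) + ‖ζ‖ ^ 2 * ‖y‖ ^ 2 * Real.exp (μ * ‖z₀‖ ^ 2)) *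
      Real.exp (μ * ‖x‖ ^ 2 * ‖ζ‖ ^ 2) := by rw [e4]; ring
    _ = _ := by rw [h]; ring

lemma QF_diff (μ : ℝ) (z₀ : Z) (w₀ : X) (x : Z) (y : X) : Differentiable ℂ (QF μ z₀ w₀ x y) := by
  unfold QF; fun_prop

lemma QF_base (μ : ℝ) (z₀ : Z) (w₀ : X) (x : Z) (y : X) (τ : ℂ) :
    QF μ z₀ w₀ x y (0, τ) = (z₀, τ • w₀) := by
  simp [QF]

lemma QF_fderiv (μ : ℝ) (z₀ : Z) (w₀ : X) (x : Z) (y : X) (v : ℂ × ℂ) :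
    fderiv ℂ (QF μ z₀ w₀ x y) (0, 1) v =
      (v.1 • x, (v.2 - μ * inner ℂ z₀ x * v.1) • w₀ + v.1 • y) := by
  have h1 : HasFDerivAt (fun v : ℂ × ℂ => v.1) (ContinuousLinearMap.fst ℂ ℂ ℂ) ((0, 1) : ℂ × ℂ) :=
    hasFDerivAt_fst
  have h2 : HasFDerivAt (fun v : ℂ × ℂ => v.2) (ContinuousLinearMap.snd ℂ ℂ ℂ) ((0, 1) : ℂ × ℂ) :=
    hasFDerivAt_snd
  have h3 := (h1.const_mul (-(μ * inner ℂ z₀ x))).cexp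
  have h4 := ((h2.mul h3).smul ((h1.smul_const y).const_add w₀))
  have h5 := ((h1.smul_const x).const_add z₀).prodMk h4
  have : HasFDerivAt (QF μ z₀ w₀ x y) _ ((0, 1) : ℂ × ℂ) := h5
  rw [this.fderiv]
  simp
  module

lemma NN_ge {a ρ u : ℝ} (ha : 0 ≤ a) (hρ : 0 ≤ ρ) (hu : 0 ≤ u) : 1 + (ρ + a) * u ≤ NN a ρ u := by
  have h := Real.add_one_le_exp (a * u)
  unfold NN
  have h1 : (1 + ρ * u) * (a * u + 1) ≤ (1 + ρ * u) * Real.exp (a * u) := by gcongr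
  have : 0 ≤ (ρ * u) * (a * u) := by positivity
  nlinarith

lemma NN_hasDerivAt (a ρ : ℝ) : HasDerivAt (NN a ρ) (ρ + a) 0 := by
  unfold NN
  have h1 := ((hasDerivAt_id (0:ℝ)).const_mul ρ).const_add 1
  have h2 := ((hasDerivAt_id (0:ℝ)).const_mul a).exp
  have := h1.mul h2
  refine this.congr_deriv ?_
  simp

lemma NN_zero (a ρ : ℝ) : NN a ρ 0 = 1 := by simp [NN]

lemma NN_le {a ρ : ℝ} (hk : 0 < ρ + a) : ∀ᶠ u in 𝓝[≥] (0:ℝ), NN a ρ u ≤ 1 + 2 * (ρ + a) * u := by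
  have h := (NN_hasDerivAt a ρ).isLittleO.bound hk
  filter_upwards [nhdsWithin_le_nhds h, self_mem_nhdsWithin] with u hu hu0
  have hu0 : 0 ≤ u := hu0
  rw [NN_zero] at hu
  simp only [sub_zero, smul_eq_mul, Real.norm_eq_abs, abs_of_nonneg hu0] at hu
  have := (abs_le.1 hu).2
  linarith
end fam
end FBHProof
end

section
open Set Filter Topology MeasureTheory Metric
open scoped Nat ComplexConjugate
set_option linter.unusedSectionVars false
namespace FBHProof

section nd
variable {Z X Z' X' : Type*} [NormedAddCommGroup Z] [InnerProductSpace ℂ Z] [FiniteDimensional ℂ Z]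
  [NormedAddCommGroup X] [InnerProductSpace ℂ X] [FiniteDimensional ℂ X]
  [NormedAddCommGroup Z'] [InnerProductSpace ℂ Z'] [FiniteDimensional ℂ Z']
  [NormedAddCommGroup X'] [InnerProductSpace ℂ X'] [FiniteDimensional ℂ X']

lemma MM_one_ne {μ : ℝ} {q : Z × X} (h : MM μ q = 1) : q.2 ≠ 0 := by
  intro h0; rw [MM, h0] at h; simp at h

/-- transversal directions -/
lemma nd_case1 {μ : ℝ} {z₀ x : Z} {w₀ y : X} (hy : inner ℂ w₀ y = 0) (hp : MM μ (z₀, w₀) = 1)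
    {N : Set (Z × X)} (hN : IsOpen N) (hpN : (z₀, w₀) ∈ N) {G : Z × X → ℂ}
    (hG : DifferentiableAt ℂ G (z₀, w₀)) (hG1 : G (z₀, w₀) = 1)
    {κ δ : ℝ} (hκ : 0 < κ) (hδ : 0 < δ)
    (hop : ∀ q ∈ N ∩ DD Z X μ, dist q.1 z₀ < δ → q.2 ≠ 0 → ‖G q‖ ^ 2 ≤ 1 - κ * (1 - MM μ q))
    {s : ℂ} (hs : s ≠ 0) (hker : fderiv ℂ G (z₀, w₀) (fderiv ℂ (QF μ z₀ w₀ x y) (0, 1) (1, s)) = 0) :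
    False := by
  set Q := QF μ z₀ w₀ x y with hQ
  have hQ0 : Q (0, 1) = (z₀, w₀) := by rw [hQ, QF_base, one_smul]
  set L := (fderiv ℂ G (z₀, w₀)).comp (fderiv ℂ Q (0, 1)) with hL
  have hGQ : HasFDerivAt (fun v => G (Q v)) L (0, 1) := by
    have h1 : HasFDerivAt G (fderiv ℂ G (z₀, w₀)) (Q (0, 1)) := by rw [hQ0]; exact hG.hasFDerivAt
    exact h1.comp (0, 1) ((QF_diff μ z₀ w₀ x y).differentiableAt.hasFDerivAt)
  set e : ℂ × ℂ := (-s⁻¹, -1) with he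
  have hLe : L e = 0 := by
    have : e = (-s⁻¹) • ((1, s) : ℂ × ℂ) := by
      rw [he]; ext <;> simp [hs]
    rw [this, map_smul, hL, ContinuousLinearMap.comp_apply, hker, smul_zero]
  have heB : 0 < ‖e‖ := by
    rw [norm_pos_iff, he]; intro h; simpa using congrArg Prod.snd h
  set γ : ℝ → ℂ × ℂ := fun t => (0, 1) + (t : ℂ) • e with hγ
  have hγc : Continuous γ := by rw [hγ]; fun_prop
  have hγ0 : γ 0 = (0, 1) := by simp [hγ]
  have hγt : Tendsto γ (𝓝[>] 0) (𝓝 (0, 1)) := by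
    rw [← hγ0]; exact (hγc.tendsto 0).mono_left nhdsWithin_le_nhds
  have E1 := hγt.eventually (hGQ.isLittleO.bound (show 0 < κ / (4 * ‖e‖) by positivity))
  have hQc : Continuous Q := (QF_diff μ z₀ w₀ x y).continuous
  have hQt : Tendsto (fun t => Q (γ t)) (𝓝[>] 0) (𝓝 (z₀, w₀)) := by
    rw [← hQ0]; exact (hQc.tendsto _).comp hγt
  have E2 := hQt.eventually (hN.mem_nhds hpN)
  have E3 : ∀ᶠ t in 𝓝[>] (0:ℝ), dist (Q (γ t)).1 z₀ < δ :=
    ((continuous_fst.tendsto _).comp hQt).eventually (ball_mem_nhds _ hδ)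
  have E4 : ∀ᶠ t in 𝓝[>] (0:ℝ), (Q (γ t)).2 ≠ 0 :=
    ((continuous_snd.tendsto _).comp hQt).eventually_ne (MM_one_ne hp)
  have hMM : ∀ t : ℝ, MM μ (Q (γ t)) = (1 - t) ^ 2 *
      NN (μ * ‖x‖ ^ 2) (‖y‖ ^ 2 * Real.exp (μ * ‖z₀‖ ^ 2)) (‖s⁻¹‖ ^ 2 * t ^ 2) := by
    intro t
    rw [hQ, QF_MM μ z₀ w₀ x y hy hp]
    have h1 : (γ t).2 = ((1 - t : ℝ) : ℂ) := by simp [hγ, he, sub_eq_add_neg]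
    have h2 : ‖(γ t).1‖ ^ 2 = ‖s⁻¹‖ ^ 2 * t ^ 2 := by
      simp [hγ, he, mul_pow, mul_comm]
    rw [h1, h2, Complex.norm_real, Real.norm_eq_abs, sq_abs]
  have E5 : ∀ᶠ t in 𝓝[>] (0:ℝ), MM μ (Q (γ t)) ≤ 1 - t := by
    set a := μ * ‖x‖ ^ 2
    set ρ := ‖y‖ ^ 2 * Real.exp (μ * ‖z₀‖ ^ 2)
    have h1 : HasDerivAt (fun t : ℝ => ‖s⁻¹‖ ^ 2 * t ^ 2) 0 0 := by
      have := ((hasDerivAt_id (0:ℝ)).pow 2).const_mul (‖s⁻¹‖ ^ 2)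
      refine this.congr_deriv ?_
      simp
    have h2 : HasDerivAt (fun t : ℝ => NN a ρ (‖s⁻¹‖ ^ 2 * t ^ 2)) 0 0 := by
      have h3 : HasDerivAt (NN a ρ) (ρ + a) (‖s⁻¹‖ ^ 2 * (0:ℝ) ^ 2) := by
        simpa using NN_hasDerivAt a ρ
      have := HasDerivAt.comp (0:ℝ) h3 h1
      rw [mul_zero] at this
      exact this
    have h3 : HasDerivAt (fun t : ℝ => (1 - t) ^ 2) (-2) 0 := by
      have := ((hasDerivAt_id (0:ℝ)).const_sub 1).pow 2
      refine this.congr_deriv ?_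
      simp
    have h4 := h3.mul h2
    have h5 := h4.isLittleO.bound one_pos
    filter_upwards [nhdsWithin_le_nhds h5, self_mem_nhdsWithin] with t ht ht0
    have ht0 : 0 < t := ht0
    rw [hMM]
    simp [NN_zero, abs_of_pos ht0] at ht
    rw [norm_inv, inv_pow]
    have := (abs_le.1 ht).2
    linarith
  obtain ⟨t, h1, h2, h3, h4, h5, h0⟩ :=
    (E1.and (E2.and (E3.and (E4.and (E5.and self_mem_nhdsWithin))))).exists
  have h0 : 0 < t := h0
  have hop' := hop _ ⟨h2, MM_lt.1 (by linarith)⟩ h3 h4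
  have hsub : γ t - (0, 1) = (t : ℂ) • e := by rw [hγ]; exact add_sub_cancel_left _ _
  rw [hsub, map_smul, hLe, smul_zero, sub_zero, hQ0, hG1, norm_smul, Complex.norm_real,
    Real.norm_of_nonneg h0.le] at h1
  have h6 : κ / (4 * ‖e‖) * (t * ‖e‖) = κ / 4 * t := by field_simp
  rw [h6] at h1
  have h7 : 1 - κ / 4 * t ≤ ‖G (Q (γ t))‖ := by
    have := norm_sub_norm_le (1:ℂ) (1 - G (Q (γ t)))
    rw [norm_sub_rev (1:ℂ) (G (Q (γ t))), sub_sub_cancel, norm_one] at this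
    linarith
  have h8 : κ * t ≤ κ * (1 - MM μ (Q (γ t))) := by gcongr; linarith
  have h9 : 0 < κ * t := by positivity
  nlinarith [sq_nonneg (‖G (Q (γ t))‖ - 1)]

lemma tau_aux {τ M : ℝ} (h0 : 0 < τ) (h1 : τ < 1) (h : τ ^ 2 * M = 1) (hM : 1 < M) : 1 - τ ≤ M - 1 := by
  have h1 : 1 - τ ≤ 1 - τ ^ 2 := by nlinarith
  have h2 : 1 - τ ^ 2 ≤ M - 1 := by nlinarith
  linarith

lemma tau_aux2 {τ M u : ℝ} (h0 : 0 < τ) (h : τ ^ 2 * M = 1) (hM : 1 + u ≤ M) (hu : 0 ≤ u) (hu1 : u ≤ 1) :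
    u / 2 ≤ 1 - τ ^ 2 := by
  have h4 : τ ^ 2 * (1 + u) ≤ 1 := by
    have := mul_le_mul_of_nonneg_left hM (sq_nonneg τ)
    linarith
  nlinarith

set_option maxHeartbeats 1000000 in
/-- complex tangential directions -/
lemma nd_case2 {μ μ' : ℝ} (hμ : 0 < μ) (hμ' : 0 < μ') {z₀ x : Z} {w₀ y : X} (hy : inner ℂ w₀ y = 0)
    (hp : MM μ (z₀, w₀) = 1)
    {N : Set (Z × X)} (hN : IsOpen N) (hpN : (z₀, w₀) ∈ N) {f' : Z × X → Z' × X'}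
    (hf' : DifferentiableOn ℂ f' N)
    (hbd : ∀ q ∈ N, MM μ q = 1 → MM μ' (f' q) = 1)
    {κ : ℝ} (hκ : 0 < κ)
    (hop : ∀ q ∈ N ∩ DD Z X μ, q.1 = z₀ → q.2 ≠ 0 →
      ‖hh μ' (f' (z₀, w₀)) (f' q)‖ ^ 2 ≤ 1 - κ * (1 - MM μ q))
    (hne : x ≠ 0 ∨ y ≠ 0)
    (hker : fderiv ℂ f' (z₀, w₀) (fderiv ℂ (QF μ z₀ w₀ x y) (0, 1) (1, 0)) = 0) :
    False := by
  set Q := QF μ z₀ w₀ x y with hQ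
  have hQ0 : Q (0, 1) = (z₀, w₀) := by rw [hQ, QF_base, one_smul]
  have hQc : Continuous Q := (QF_diff μ z₀ w₀ x y).continuous
  set P := f' (z₀, w₀) with hP
  have hPM : MM μ' P = 1 := hbd _ hpN hp
  have hP2 : P.2 ≠ 0 := MM_one_ne hPM
  have hP2' : 0 < ‖P.2‖ := norm_pos_iff.2 hP2
  set L := (fderiv ℂ f' (z₀, w₀)).comp (fderiv ℂ Q (0, 1)) with hL
  have hfQ : HasFDerivAt (fun v => f' (Q v)) L (0, 1) := by
    have h1 : HasFDerivAt f' (fderiv ℂ f' (z₀, w₀)) (Q (0, 1)) := by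
      rw [hQ0]; exact (hf'.differentiableAt (hN.mem_nhds hpN)).hasFDerivAt
    exact h1.comp (0, 1) ((QF_diff μ z₀ w₀ x y).differentiableAt.hasFDerivAt)
  have hLe : ∀ v : ℂ × ℂ, ‖L v‖ ≤ ‖L (0, 1)‖ * ‖v.2‖ := by
    intro v
    have : v = v.1 • ((1, 0) : ℂ × ℂ) + v.2 • ((0, 1) : ℂ × ℂ) := by ext <;> simp
    have h1 : L (1, 0) = 0 := hker
    conv_lhs => rw [this, map_add, map_smul, map_smul, h1, smul_zero, zero_add, norm_smul, mul_comm]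
  set C := ‖L (0, 1)‖ with hC
  have hC0 : 0 ≤ C := norm_nonneg _
  set a := μ * ‖x‖ ^ 2 with ha
  set ρ := ‖y‖ ^ 2 * Real.exp (μ * ‖z₀‖ ^ 2) with hρ
  have ha0 : 0 ≤ a := by positivity
  have hρ0 : 0 ≤ ρ := by positivity
  have hMM : ∀ v, MM μ (Q v) = ‖v.2‖ ^ 2 * NN a ρ (‖v.1‖ ^ 2) := QF_MM μ z₀ w₀ x y hy hp
  set k := ρ + a with hk
  have hk0 : 0 < k := by
    rcases hne with h | h
    · have : 0 < a := by have := norm_pos_iff.2 h; positivity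
      linarith
    · have : 0 < ρ := by have := norm_pos_iff.2 h; positivity
      linarith
  set K := μ' + 2 * (‖P.2‖ ^ 2)⁻¹ with hK
  have hK0 : 0 < K := by positivity
  set ε := Real.sqrt (κ * k / (16 * K)) with hε
  have hε0 : 0 < ε := Real.sqrt_pos.2 (by positivity)
  have hε2 : K * (4 * ε ^ 2) = κ * k / 4 := by
    rw [hε, Real.sq_sqrt (by positivity)]; field_simp; norm_num
  -- neighbourhood
  have hfc : ContinuousAt (fun v => f' (Q v)) (0, 1) := hfQ.continuousAt
  have hval : f' (Q (0, 1)) = P := by rw [hQ0]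
  have B1 : ∀ᶠ v in 𝓝 ((0, 1) : ℂ × ℂ), Q v ∈ N :=
    hQc.continuousAt.eventually (by rw [hQ0]; exact hN.mem_nhds hpN)
  have B2 := hfQ.isLittleO.bound hε0
  have B3 : ∀ᶠ v in 𝓝 ((0, 1) : ℂ × ℂ), hh μ' P (f' (Q v)) ≠ 0 := by
    have h1 : ContinuousAt (fun v => hh μ' P (f' (Q v))) (0, 1) :=
      ContinuousAt.comp (g := hh μ' P) (hh_diff μ' P).continuous.continuousAt hfc
    apply h1.eventually_ne
    rw [hval, hh_self hPM]; exact one_ne_zero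
  have B4 : ∀ᶠ v in 𝓝 ((0, 1) : ℂ × ℂ), ‖P.2‖ ^ 2 / 2 < ‖(f' (Q v)).2‖ ^ 2 := by
    have h1 : ContinuousAt (fun v => ‖(f' (Q v)).2‖ ^ 2) (0, 1) :=
      (((continuous_snd.norm.pow 2).continuousAt).comp hfc :)
    apply h1.eventually_const_lt
    simp only [hval]; have : 0 < ‖P.2‖ ^ 2 := by positivity
    linarith
  obtain ⟨η, hη, hB⟩ := Metric.eventually_nhds_iff.1 (B1.and (B2.and (B3.and B4)))
  -- choose r
  have hsm : ∀ c : ℝ, ∀ b : ℝ, 0 < b → ∀ᶠ r in 𝓝[>] (0:ℝ), c * r < b := by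
    intro c b hb
    have : Tendsto (fun r : ℝ => c * r) (𝓝[>] 0) (𝓝 (c * 0)) :=
      ((continuous_const.mul continuous_id).tendsto 0).mono_left nhdsWithin_le_nhds
    rw [mul_zero] at this
    exact this.eventually_lt_const hb
  have hNe : ∀ᶠ r in 𝓝[>] (0:ℝ), NN a ρ (r ^ 2) ≤ 1 + 2 * k * r ^ 2 := by
    have : Tendsto (fun r : ℝ => r ^ 2) (𝓝[>] 0) (𝓝[≥] 0) := by
      apply tendsto_nhdsWithin_of_tendsto_nhds_of_eventually_within
      · have := ((continuous_pow 2).tendsto (0:ℝ)).mono_left (nhdsWithin_le_nhds (s := Ioi 0))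
        simpa using this
      · exact Eventually.of_forall fun r => sq_nonneg r
    exact this.eventually (NN_le hk0)
  obtain ⟨r, hr1, hr2, hr3, hr4, hr5, hr0⟩ := ((hsm 1 η hη).and ((hsm (2 * k) 1 one_pos).and
    ((hsm (C * (2 * k)) ε hε0).and ((hsm 1 1 one_pos).and (hNe.and self_mem_nhdsWithin))))).exists
  have hr0 : 0 < r := hr0
  rw [one_mul] at hr1 hr4
  have hNg := NN_ge ha0 hρ0 (sq_nonneg r)
  rw [← hk] at hNg
  set M := NN a ρ (r ^ 2) with hM
  have hkr : 0 < k * r ^ 2 := by positivity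
  have hM1 : 1 < M := by linarith
  set τ := (Real.sqrt M)⁻¹ with hτ
  have hsM : 1 < Real.sqrt M := by rw [Real.lt_sqrt zero_le_one]; linarith
  have hτ0 : 0 < τ := by positivity
  have hτ1 : τ < 1 := inv_lt_one_of_one_lt₀ hsM
  have hτ2 : τ ^ 2 = M⁻¹ := by rw [hτ, inv_pow, Real.sq_sqrt (by linarith)]
  have hτM : τ ^ 2 * M = 1 := by rw [hτ2, inv_mul_cancel₀ (by linarith)]
  have hτd : 1 - τ ≤ 2 * k * r ^ 2 := by
    have := tau_aux hτ0 hτ1 hτM hM1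
    linarith
  have hτr : 2 * k * r ^ 2 ≤ r := by
    have := mul_le_mul_of_nonneg_right hr2.le hr0.le
    linarith
  have hnd : ‖((τ:ℂ) - 1)‖ = 1 - τ := by
    rw [← Complex.ofReal_one, ← Complex.ofReal_sub, Complex.norm_real, Real.norm_eq_abs,
      abs_of_neg (by linarith)]; ring
  have hnτ : ‖(τ:ℂ)‖ = τ := by rw [Complex.norm_real, Real.norm_of_nonneg hτ0.le]
  have hdist : ∀ ζ : ℂ, ‖ζ‖ ≤ r → ‖((ζ, (τ:ℂ)) : ℂ × ℂ) - (0, 1)‖ ≤ r := by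
    intro ζ hζ
    rw [Prod.mk_sub_mk, Prod.norm_mk, sub_zero, hnd]
    exact max_le hζ (by linarith)
  have hin : ∀ ζ : ℂ, ‖ζ‖ ≤ r → dist ((ζ, (τ:ℂ)) : ℂ × ℂ) (0, 1) < η := fun ζ hζ => by
    rw [dist_eq_norm]; exact (hdist ζ hζ).trans_lt hr1
  have hclose : ∀ ζ : ℂ, ‖ζ‖ ≤ r → ‖f' (Q (ζ, τ)) - P‖ ≤ 2 * ε * r := by
    intro ζ hζ
    have h1 := (hB (hin ζ hζ)).2.1
    rw [hval] at h1
    have h2 := hLe (((ζ, (τ:ℂ)) : ℂ × ℂ) - (0, 1))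
    rw [Prod.snd_sub, hnd] at h2
    have h3 : f' (Q (ζ, τ)) - P = (f' (Q (ζ, τ)) - P - L (((ζ, (τ:ℂ)) : ℂ × ℂ) - (0, 1))) +
      L (((ζ, (τ:ℂ)) : ℂ × ℂ) - (0, 1)) := by abel
    rw [h3]
    refine (norm_add_le _ _).trans ?_
    have h4 : ε * ‖((ζ, (τ:ℂ)) : ℂ × ℂ) - (0, 1)‖ ≤ ε * r := by gcongr; exact hdist ζ hζ
    have h5 : C * (1 - τ) ≤ C * (2 * k * r ^ 2) := by gcongr
    have h6 : C * (2 * k * r ^ 2) ≤ ε * r := by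
      have := mul_le_mul_of_nonneg_right hr3.le hr0.le
      linarith
    linarith
  have hlow : ∀ ζ : ℂ, ‖ζ‖ = r → 1 - κ * k / 4 * r ^ 2 ≤ ‖hh μ' P (f' (Q (ζ, τ)))‖ ^ 2 := by
    intro ζ hζ
    obtain ⟨b1, b2, b3, b4⟩ := hB (hin ζ hζ.le)
    have h1 : MM μ (Q (ζ, τ)) = 1 := by rw [hMM, hζ, hnτ]; exact hτM
    have h2 := hh_ge hμ' P hP2 (hbd _ b1 h1)
    have h3 : (‖(f' (Q (ζ, τ))).2‖ ^ 2)⁻¹ ≤ 2 * (‖P.2‖ ^ 2)⁻¹ := by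
      have : 2 * (‖P.2‖ ^ 2)⁻¹ = (‖P.2‖ ^ 2 / 2)⁻¹ := by rw [inv_div]; rfl
      rw [this]
      exact inv_anti₀ (by positivity) b4.le
    have h4 : (μ' + (‖(f' (Q (ζ, τ))).2‖ ^ 2)⁻¹) * ‖f' (Q (ζ, τ)) - P‖ ^ 2 ≤ K * (2 * ε * r) ^ 2 := by
      have := hclose ζ hζ.le
      rw [hK]; gcongr
    have h5 : K * (2 * ε * r) ^ 2 = κ * k / 4 * r ^ 2 := by rw [← hε2]; ring
    linarith
  -- hopf at the centre
  have hcen : ‖hh μ' P (f' (Q (0, τ)))‖ ^ 2 ≤ 1 - κ * k / 2 * r ^ 2 := by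
    have hMc : MM μ (Q (0, τ)) = τ ^ 2 := by rw [hMM, hnτ]; simp [NN_zero]
    have h1 := hop (Q (0, τ)) ⟨(hB (hin 0 (by simpa using hr0.le))).1, MM_lt.1 (by
        rw [hMc]; exact pow_lt_one₀ hτ0.le hτ1 two_ne_zero)⟩
      (by rw [hQ, QF_base]) (by
        rw [hQ, QF_base]; exact smul_ne_zero (by exact_mod_cast hτ0.ne') (MM_one_ne hp))
    rw [hMc] at h1
    have h2 : k * r ^ 2 / 2 ≤ 1 - τ ^ 2 := by
      have h3 : k * r ^ 2 ≤ 1 := by linarith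
      exact tau_aux2 hτ0 hτM hNg hkr.le h3
    have h3 : κ * (k * r ^ 2 / 2) ≤ κ * (1 - τ ^ 2) := by gcongr
    linarith
  -- maximum principle
  set b := 1 - κ * k / 4 * r ^ 2 with hb
  have hb0 : 0 < b := by
    have : 0 < κ * k * r ^ 2 := by positivity
    have := sq_nonneg ‖hh μ' P (f' (Q (0, τ)))‖
    linarith
  have hdiff : DifferentiableOn ℂ (fun ζ : ℂ => (hh μ' P (f' (Q (ζ, τ))))⁻¹) (closedBall 0 r) := by
    refine DifferentiableOn.inv ?_ ?_
    · refine (hh_diff μ' P).comp_differentiableOn ?_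
      refine hf'.comp (t := N) ?_ ?_
      · exact ((QF_diff μ z₀ w₀ x y).comp (by fun_prop : Differentiable ℂ fun ζ : ℂ => (ζ, (τ:ℂ)))).differentiableOn
      · intro ζ hζ; exact (hB (hin ζ (by simpa using hζ))).1
    · intro ζ hζ; exact (hB (hin ζ (by simpa using hζ))).2.2.1
  have hmax := Complex.norm_le_of_forall_mem_frontier_norm_le (U := ball (0:ℂ) r)
    (f := fun ζ : ℂ => (hh μ' P (f' (Q (ζ, τ))))⁻¹) (C := (Real.sqrt b)⁻¹) isBounded_ball
    (DifferentiableOn.diffContOnCl (by rw [closure_ball _ hr0.ne']; exact hdiff))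
    (fun ζ hζ => by
      rw [frontier_ball _ hr0.ne'] at hζ
      have hζ : ‖ζ‖ = r := by simpa using hζ
      rw [norm_inv]
      exact inv_anti₀ (Real.sqrt_pos.2 hb0) (Real.sqrt_le_iff.2 ⟨norm_nonneg _, hlow ζ hζ⟩))
    (z := 0) (subset_closure (mem_ball_self hr0))
  rw [norm_inv, inv_le_inv₀ (norm_pos_iff.2 (hB (hin 0 (by simpa using hr0.le))).2.2.1)
    (Real.sqrt_pos.2 hb0), Real.sqrt_le_iff] at hmax
  have := hmax.2
  have h9 : 0 < κ * k * r ^ 2 := by positivity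
  linarith

lemma nondeg {μ μ' : ℝ} (hμ : 0 < μ) (hμ' : 0 < μ') {f f' : Z × X → Z' × X'}
    (hf : DifferentiableOn ℂ f (DD Z X μ))
    (hmaps : MapsTo f (DD Z X μ) (DD Z' X' μ'))
    (hprop : ∀ K ⊆ DD Z' X' μ', IsCompact K → IsCompact (f ⁻¹' K ∩ DD Z X μ))
    {N : Set (Z × X)} (hN : IsOpen N) (hf' : DifferentiableOn ℂ f' N)
    (heq : EqOn f' f (N ∩ DD Z X μ))
    {p : Z × X} (hpN : p ∈ N) (hp : MM μ p = 1) {v : Z × X} (hv : fderiv ℂ f' p v = 0) : v = 0 := by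
  by_contra hv0
  obtain ⟨z₀, w₀⟩ := p
  obtain ⟨x, y⟩ := v
  have hw : w₀ ≠ 0 := MM_one_ne hp
  have hbd : ∀ q ∈ N, MM μ q = 1 → MM μ' (f' q) = 1 := fun q hq hq1 =>
    bdry_to_bdry hμ' hmaps hprop hN hf'.continuousOn heq hq hq1
  set P := f' (z₀, w₀) with hP
  have hPM : MM μ' P = 1 := hbd _ hpN hp
  obtain ⟨κ, hκ, δ, hδ, hop⟩ := hopf hμ (g := fun q => hh μ' P (f q))
    ((hh_diff μ' P).comp_differentiableOn hf) (fun q hq => hh_lt hμ' P (hmaps hq)) z₀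
  set y1 := y + (μ * inner ℂ z₀ x : ℂ) • w₀ with hy1
  set s : ℂ := inner ℂ w₀ y1 / inner ℂ w₀ w₀ with hs
  set y' := y1 - s • w₀ with hy'
  have hin : inner ℂ w₀ y' = 0 := by
    rw [hy', inner_sub_right, inner_smul_right, hs, div_mul_cancel₀ _ (inner_self_ne_zero.2 hw), sub_self]
  have hQ : fderiv ℂ (QF μ z₀ w₀ x y') (0, 1) (1, s) = (x, y) := by
    rw [QF_fderiv]
    simp only [one_smul, mul_one, Prod.mk.injEq, true_and]
    rw [hy', hy1]; module
  have hfd : DifferentiableAt ℂ f' (z₀, w₀) := hf'.differentiableAt (hN.mem_nhds hpN)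
  by_cases h0 : s = 0
  · refine nd_case2 hμ hμ' hin hp hN hpN hf' hbd hκ ?_ ?_ (x := x) (by rw [h0] at hQ; rw [hQ, hv])
    · intro q hq h1 h2
      have := hop q hq.2 (by rw [h1, dist_self]; exact hδ) h2
      rwa [heq hq]
    · by_contra! hcon
      apply hv0
      have : y' = y := by rw [hy', hy1, h0, hcon.1]; simp
      rw [hcon.1, ← this, hcon.2]; rfl
  · refine nd_case1 hin hp hN hpN (G := fun q => hh μ' P (f' q)) (κ := κ) (δ := δ) (x := x) (s := s)
      ?_ ?_ hκ hδ ?_ h0 ?_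
    · exact (hh_diff μ' P).differentiableAt.comp _ hfd
    · exact hh_self hPM
    · intro q hq h1 h2
      rw [heq hq]; exact hop q hq.2 h1 h2
    · rw [hQ]
      have : fderiv ℂ (hh μ' P ∘ f') (z₀, w₀) = _ :=
        fderiv_comp (g := hh μ' P) (f := f') (z₀, w₀) (hh_diff μ' P).differentiableAt hfd
      change fderiv ℂ (hh μ' P ∘ f') (z₀, w₀) (x, y) = 0
      rw [this, ContinuousLinearMap.comp_apply, hv, map_zero]
end nd
end FBHProof
end

section
open Set Filter Topology MeasureTheory Metric
open scoped Nat ComplexConjugate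
set_option linter.unusedSectionVars false
namespace FBHProof

section hur
variable {X : Type*} [NormedAddCommGroup X] [InnerProductSpace ℂ X] [FiniteDimensional ℂ X]

lemma exists_perp (hX : 1 < Module.finrank ℂ X) (w : X) : ∃ e : X, e ≠ 0 ∧ inner ℂ w e = 0 := by
  have h1 : Module.finrank ℂ (Submodule.span ℂ {w}) ≤ 1 :=
    (finrank_span_le_card ({w} : Set X)).trans (by simp)
  have h2 := Submodule.finrank_add_finrank_orthogonal (𝕜 := ℂ) (Submodule.span ℂ {w})
  have h3 : (Submodule.span ℂ {w})ᗮ ≠ ⊥ := by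
    intro h; rw [h, finrank_bot] at h2; omega
  obtain ⟨e, he, he0⟩ := Submodule.exists_mem_ne_zero_of_ne_bot h3
  exact ⟨e, he0, Submodule.mem_orthogonal_singleton_iff_inner_right.1 he⟩

lemma no_zero (hX : 1 < Module.finrank ℂ X) {J : X → ℂ} {R : ℝ}
    (hJ : DifferentiableOn ℂ J (ball 0 R))
    (hb : ∀ w, ‖w‖ = R → ∀ᶠ w' in 𝓝[ball 0 R] w, J w' ≠ 0) :
    ∀ w ∈ ball (0:X) R, J w ≠ 0 := by
  have : ProperSpace X := FiniteDimensional.proper ℂ X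
  by_contra! hcon
  set S := {w ∈ ball (0:X) R | J w = 0} with hS
  have hSc : IsCompact S := by
    refine (isCompact_closedBall (0:X) R).of_isClosed_subset ?_ ?_
    · refine isClosed_of_closure_subset fun w hw => ?_
      have hfr : ∃ᶠ w' in 𝓝 w, w' ∈ S := mem_closure_iff_frequently.1 hw
      have hwR : ‖w‖ ≤ R := by
        have : w ∈ closedBall (0:X) R :=
          closure_minimal (fun v hv => ball_subset_closedBall hv.1) isClosed_closedBall hw
        simpa using this
      rcases hwR.lt_or_eq with h | h
      · have hwb : w ∈ ball (0:X) R := by simpa using h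
        refine ⟨hwb, ?_⟩
        by_contra h0
        have := (hJ.continuousOn.continuousAt (isOpen_ball.mem_nhds hwb)).eventually_ne h0
        obtain ⟨v, hv1, hv2⟩ := (hfr.and_eventually this).exists
        exact hv2 hv1.2
      · have := eventually_nhdsWithin_iff.1 (hb w h)
        obtain ⟨v, hv1, hv2⟩ := (hfr.and_eventually this).exists
        exact absurd hv1.2 (hv2 hv1.1)
    · exact fun v hv => ball_subset_closedBall hv.1
  obtain ⟨w₀, hw₀, hmax⟩ := hSc.exists_isMaxOn (f := fun w => ‖w‖) hcon continuous_norm.continuousOn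
  have hnz : ∀ w ∈ ball (0:X) R, ‖w₀‖ < ‖w‖ → J w ≠ 0 := fun w hw hlt h0 =>
    absurd (hmax (show w ∈ S from ⟨hw, h0⟩)) (not_le.2 hlt)
  obtain ⟨d, hd0, c, hc, hcd⟩ : ∃ d : X, d ≠ 0 ∧ ∃ c : ℝ, 0 ≤ c ∧ w₀ = (c : ℂ) • d := by
    by_cases h : w₀ = 0
    · obtain ⟨e, he, -⟩ := exists_perp hX (0 : X)
      exact ⟨e, he, 0, le_rfl, by simp [h]⟩
    · exact ⟨w₀, h, 1, zero_le_one, by simp⟩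
  obtain ⟨e, he0, hde⟩ := exists_perp hX d
  have hdp := norm_pos_iff.2 hd0
  have hep := norm_pos_iff.2 he0
  set W : ℝ × ℂ → X := fun v => ((c + v.1 : ℝ) : ℂ) • d + v.2 • e with hW
  have hWc : Continuous W := by rw [hW]; fun_prop
  have hWn : ∀ v : ℝ × ℂ, ‖W v‖ ^ 2 = (c + v.1) ^ 2 * ‖d‖ ^ 2 + ‖v.2‖ ^ 2 * ‖e‖ ^ 2 := by
    intro v
    rw [hW]
    simp only
    rw [@norm_add_sq ℂ, inner_smul_left, inner_smul_right, hde, norm_smul, norm_smul, mul_pow, mul_pow,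
      Complex.norm_real, Real.norm_eq_abs, sq_abs]
    simp
  have hW0 : W (0, 0) = w₀ := by simp [hW, hcd]
  have hw₀n : ‖w₀‖ ^ 2 = c ^ 2 * ‖d‖ ^ 2 := by rw [← hW0, hWn]; simp
  have hWgt : ∀ v : ℝ × ℂ, 0 ≤ v.1 → (0 < v.1 ∨ v.2 ≠ 0) → ‖w₀‖ < ‖W v‖ := by
    intro v h1 h2
    refine lt_of_pow_lt_pow_left₀ 2 (norm_nonneg _) ?_
    rw [hw₀n, hWn]
    rcases h2 with h2 | h2
    · have : c ^ 2 * ‖d‖ ^ 2 < (c + v.1) ^ 2 * ‖d‖ ^ 2 := by gcongr; linarith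
      have : 0 ≤ ‖v.2‖ ^ 2 * ‖e‖ ^ 2 := by positivity
      linarith
    · have : c ^ 2 * ‖d‖ ^ 2 ≤ (c + v.1) ^ 2 * ‖d‖ ^ 2 := by gcongr; linarith
      have := norm_pos_iff.2 h2
      have : 0 < ‖v.2‖ ^ 2 * ‖e‖ ^ 2 := by positivity
      linarith
  have hnb : ∀ᶠ v in 𝓝 ((0, 0) : ℝ × ℂ), W v ∈ ball (0:X) R :=
    hWc.continuousAt.eventually (isOpen_ball.mem_nhds (by rw [hW0]; exact hw₀.1))
  obtain ⟨r, hr, hrB⟩ := Metric.nhds_basis_closedBall.mem_iff.1 hnb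
  have hrB' : ∀ s : ℝ, 0 ≤ s → s ≤ r → ∀ ζ : ℂ, ‖ζ‖ ≤ r → W (s, ζ) ∈ ball (0:X) R := by
    intro s hs hs' ζ hζ
    apply hrB
    rw [mem_closedBall, dist_eq_norm, Prod.mk_sub_mk, Prod.norm_mk, sub_zero, sub_zero,
      Real.norm_of_nonneg hs]
    exact max_le hs' hζ
  have hKc : IsCompact (Icc (0:ℝ) r ×ˢ sphere (0:ℂ) r) := isCompact_Icc.prod (isCompact_sphere _ _)
  have hKne : (Icc (0:ℝ) r ×ˢ sphere (0:ℂ) r).Nonempty :=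
    ⟨(0, (r:ℂ)), ⟨⟨le_rfl, hr.le⟩, by simp [hr.le]⟩⟩
  have hcont : ContinuousOn (fun v : ℝ × ℂ => ‖J (W v)‖) (Icc (0:ℝ) r ×ˢ sphere (0:ℂ) r) := by
    refine continuous_norm.comp_continuousOn (hJ.continuousOn.comp hWc.continuousOn ?_)
    rintro ⟨s, ζ⟩ ⟨hs, hζ⟩
    exact hrB' s hs.1 hs.2 ζ (by simpa using (mem_sphere_zero_iff_norm.1 hζ).le)
  obtain ⟨v₀, hv₀, hmin⟩ := hKc.exists_isMinOn hKne hcont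
  set M := ‖J (W v₀)‖ with hM
  have hM0 : 0 < M := by
    rw [hM, norm_pos_iff]
    obtain ⟨hs, hζ⟩ := hv₀
    have hζ' := mem_sphere_zero_iff_norm.1 hζ
    refine hnz _ (hrB' v₀.1 hs.1 hs.2 v₀.2 hζ'.le) (hWgt v₀ hs.1 (Or.inr ?_))
    rw [← norm_pos_iff, hζ']; exact hr
  have key : ∀ s : ℝ, 0 < s → s ≤ r → M ≤ ‖J (W (s, 0))‖ := by
    intro s hs hs'
    have hz : ∀ ζ ∈ closedBall (0:ℂ) r, J (W (s, ζ)) ≠ 0 := fun ζ hζ =>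
      hnz _ (hrB' s hs.le hs' ζ (by simpa using hζ)) (hWgt (s, ζ) hs.le (Or.inl hs))
    have hdiff : DifferentiableOn ℂ (fun ζ : ℂ => (J (W (s, ζ)))⁻¹) (closedBall 0 r) := by
      refine DifferentiableOn.inv ?_ hz
      refine hJ.comp (t := ball 0 R) ?_ fun ζ hζ => hrB' s hs.le hs' ζ (by simpa using hζ)
      exact (by fun_prop : Differentiable ℂ fun ζ : ℂ => ((c + s : ℝ) : ℂ) • d + ζ • e).differentiableOn
    have hmax := Complex.norm_le_of_forall_mem_frontier_norm_le (U := ball (0:ℂ) r)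
      (f := fun ζ : ℂ => (J (W (s, ζ)))⁻¹) (C := M⁻¹) isBounded_ball
      (DifferentiableOn.diffContOnCl (by rw [closure_ball _ hr.ne']; exact hdiff))
      (fun ζ hζ => by
        rw [frontier_ball _ hr.ne'] at hζ
        rw [norm_inv]
        exact inv_anti₀ hM0 (hmin (show (s, ζ) ∈ _ from ⟨⟨hs.le, hs'⟩, hζ⟩)))
      (z := 0) (subset_closure (mem_ball_self hr))
    rw [norm_inv, inv_le_inv₀ (norm_pos_iff.2 (hz 0 (mem_closedBall_self hr.le))) hM0] at hmax
    exact hmax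
  have hct : ContinuousAt (fun s : ℝ => ‖J (W (s, 0))‖) 0 := by
    refine ContinuousAt.norm ?_
    refine ContinuousAt.comp (g := J) ?_ (by fun_prop)
    rw [hW0]; exact hJ.continuousOn.continuousAt (isOpen_ball.mem_nhds hw₀.1)
  have hlim : Tendsto (fun s : ℝ => ‖J (W (s, 0))‖) (𝓝[>] 0) (𝓝 0) := by
    have := hct.tendsto
    rw [hW0, hw₀.2, norm_zero] at this
    exact this.mono_left nhdsWithin_le_nhds
  have : M ≤ 0 := by
    refine ge_of_tendsto hlim ?_
    filter_upwards [Ioc_mem_nhdsGT hr] with s hs using key s hs.1 hs.2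
  linarith
end hur

section jac
variable {Z X Z' X' : Type*} [NormedAddCommGroup Z] [InnerProductSpace ℂ Z] [FiniteDimensional ℂ Z]
  [NormedAddCommGroup X] [InnerProductSpace ℂ X] [FiniteDimensional ℂ X]
  [NormedAddCommGroup Z'] [InnerProductSpace ℂ Z'] [FiniteDimensional ℂ Z']
  [NormedAddCommGroup X'] [InnerProductSpace ℂ X'] [FiniteDimensional ℂ X']
  [Nontrivial X] [Nontrivial X']

lemma jac_ne_zero (hX : 1 < Module.finrank ℂ X) (T : (Z' × X') ≃L[ℂ] (Z × X)) {μ μ' : ℝ}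
    (hμ : 0 < μ) (hμ' : 0 < μ') {f : Z × X → Z' × X'}
    (hf : DifferentiableOn ℂ f (DD Z X μ))
    (hmaps : MapsTo f (DD Z X μ) (DD Z' X' μ'))
    (hprop : ∀ K ⊆ DD Z' X' μ', IsCompact K → IsCompact (f ⁻¹' K ∩ DD Z X μ)) :
    ∀ q ∈ DD Z X μ, (fderiv ℂ (fun x => T (f x)) q).det ≠ 0 := by
  have hDo : IsOpen (DD Z X μ) := (DD_CC hμ).isOpen
  have hJ : DifferentiableOn ℂ (fun q => (fderiv ℂ (fun x => T (f x)) q).det) (DD Z X μ) :=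
    jac_differentiableOn hDo (T.differentiable.comp_differentiableOn hf)
  rintro ⟨z, w⟩ hq
  set R := Real.exp (-μ * ‖z‖ ^ 2 / 2) with hR
  have hR2 : R ^ 2 = Real.exp (-μ * ‖z‖ ^ 2) := by
    rw [hR, ← Real.exp_nat_mul]; congr 1; push_cast; ring
  have hR0 : 0 < R := Real.exp_pos _
  have hiff : ∀ v : X, v ∈ ball (0:X) R ↔ (z, v) ∈ DD Z X μ := by
    intro v
    rw [mem_ball_zero_iff, mem_DD, ← hR2]
    exact (pow_lt_pow_iff_left₀ (norm_nonneg _) hR0.le two_ne_zero).symm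
  have hsec : Differentiable ℂ fun v : X => ((z, v) : Z × X) := by fun_prop
  refine no_zero hX (J := fun v => (fderiv ℂ (fun x => T (f x)) (z, v)).det) (R := R)
    (hJ.comp hsec.differentiableOn fun v hv => (hiff v).1 hv) ?_ w ((hiff w).2 hq)
  intro v hv
  have hle : ‖((z, v) : Z × X).2‖ ^ 2 ≤ Real.exp (-μ * ‖((z, v) : Z × X).1‖ ^ 2) := by
    simp only [hv, hR2, le_refl]
  have hMM : MM μ ((z, v) : Z × X) = 1 := by
    rw [MM]
    simp only
    rw [hv, hR2, ← Real.exp_add]; simp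
  obtain ⟨N, hN, hpN, f', hf', heq⟩ := DD_ext T hμ hμ' hf hmaps hprop hle
  have hTf' : DifferentiableOn ℂ (fun x => T (f' x)) N := T.differentiable.comp_differentiableOn hf'
  have hdet : (fderiv ℂ (fun x => T (f' x)) (z, v)).det ≠ 0 := by
    apply det_ne_zero_of_inj
    intro u hu
    have h1 : fderiv ℂ (fun x => T (f' x)) (z, v) = _ :=
      T.comp_fderiv (f := f') (x := (z, v))
    rw [h1] at hu
    have h2 : fderiv ℂ f' (z, v) u = 0 := T.injective (by simpa using hu)
    exact nondeg hμ hμ' hf hmaps hprop hN hf' heq hpN hMM h2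
  have hJ' := jac_differentiableOn hN hTf'
  have hcon : ContinuousAt (fun v' : X => (fderiv ℂ (fun x => T (f' x)) (z, v')).det) v :=
    ContinuousAt.comp (g := fun q => (fderiv ℂ (fun x => T (f' x)) q).det)
      (f := fun v' : X => ((z, v') : Z × X)) (hJ'.continuousOn.continuousAt (hN.mem_nhds hpN))
      hsec.continuous.continuousAt
  have h1 := hcon.eventually_ne hdet
  have h2 : ∀ᶠ v' in 𝓝 v, ((z, v') : Z × X) ∈ N :=
    hsec.continuous.continuousAt.eventually (hN.mem_nhds hpN)
  filter_upwards [nhdsWithin_le_nhds h1, nhdsWithin_le_nhds h2, self_mem_nhdsWithin] with v' h3 h4 h5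
  have h6 : (fun x => T (f x)) =ᶠ[𝓝 (z, v')] fun x => T (f' x) := by
    filter_upwards [hN.mem_nhds h4, hDo.mem_nhds ((hiff v').1 h5)] with x hx hx'
    rw [heq ⟨hx, hx'⟩]
  rw [h6.fderiv_eq]
  exact h3
end jac
end FBHProof
end

section
open Set Filter Topology MeasureTheory Metric
open scoped Nat ComplexConjugate
set_option linter.unusedSectionVars false
namespace FBHProof

section top
variable {E F : Type*} [NormedAddCommGroup E] [NormedSpace ℂ E] [FiniteDimensional ℂ E]
  [NormedAddCommGroup F] [NormedSpace ℂ F] [FiniteDimensional ℂ F]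

lemma proper_biholo {D : Set E} {D' : Set F} (hD : CC D) (hD' : CC D') {f : E → F}
    (hf : DifferentiableOn ℂ f D) (hmaps : MapsTo f D D')
    (hprop : ∀ K ⊆ D', IsCompact K → IsCompact (f ⁻¹' K ∩ D))
    (hder : ∀ x ∈ D, ∃ A : E ≃L[ℂ] F, fderiv ℂ f x = (A : E →L[ℂ] F)) :
    BijOn f D D' ∧ ∃ g : F → E, DifferentiableOn ℂ g D' ∧ MapsTo g D' D ∧
      (∀ x ∈ D, g (f x) = x) ∧ (∀ y ∈ D', f (g y) = y) := by
  have : CompleteSpace E := FiniteDimensional.complete ℂ E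
  have : CompleteSpace F := FiniteDimensional.complete ℂ F
  have : ProperSpace F := FiniteDimensional.proper ℂ F
  have : LocallyCompactSpace D' := hD'.isOpen.locallyCompactSpace
  letI : NormedSpace ℝ F := NormedSpace.restrictScalars ℝ ℂ F
  have hstar : StarConvex ℝ (0:F) D' := by
    rw [starConvex_zero_iff]
    intro x hx a ha0 ha1
    have : a • x = (a : ℂ) • x := rfl
    rw [this]
    exact hD'.smul x hx _ (by rw [Complex.norm_real, Real.norm_of_nonneg ha0]; exact ha1)
  have : ContractibleSpace D' := hstar.contractibleSpace ⟨0, hD'.zero⟩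
  have : SimplyConnectedSpace D' := inferInstance
  have : LocallyPathConnectedSpace D' := hD'.isOpen.locallyPathConnectedSpace
  have : PreconnectedSpace D := Subtype.preconnectedSpace hD.isPathConnected.isConnected.isPreconnected
  set p : D → D' := fun x => ⟨f x, hmaps x.2⟩ with hp
  have hpc : Continuous p :=
    Continuous.subtype_mk (continuousOn_iff_continuous_domRestrict.1 hf.continuousOn) _
  have hloc : IsLocalHomeomorphOn f D := by
    refine IsLocalHomeomorphOn.mk f D fun x hx => ?_
    obtain ⟨A, hA⟩ := hder x hx
    have h1 : HasStrictFDerivAt f (A : E →L[ℂ] F) x := by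
      rw [← hA]
      exact ((contDiffOn_of_hol hD.isOpen 1 hf).contDiffAt (hD.isOpen.mem_nhds hx)).hasStrictFDerivAt
        (by norm_num)
    exact ⟨h1.toOpenPartialHomeomorph f, h1.mem_toOpenPartialHomeomorph_source, fun y _ => rfl⟩
  have hlp : IsLocalHomeomorph p := by
    refine IsLocalHomeomorph.of_comp (g := (Subtype.val : D' → F)) ?_
      hD'.isOpen.isOpenEmbedding_subtypeVal.isLocalHomeomorph hpc
    have h1 : IsLocalHomeomorph (Subtype.val : D → E) :=
      hD.isOpen.isOpenEmbedding_subtypeVal.isLocalHomeomorph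
    rw [isLocalHomeomorph_iff_isLocalHomeomorphOn_univ] at h1 ⊢
    exact hloc.comp h1 fun x _ => x.2
  have hcomp : ∀ K : Set D', IsCompact K → IsCompact (p ⁻¹' K) := by
    intro K hK
    rw [Subtype.isCompact_iff] at hK ⊢
    have := hprop (Subtype.val '' K) (by rintro _ ⟨x, -, rfl⟩; exact x.2) hK
    convert this using 1
    ext x
    constructor
    · rintro ⟨y, hy, rfl⟩
      exact ⟨⟨p y, hy, rfl⟩, y.2⟩
    · rintro ⟨⟨y, hy, hyx⟩, hx⟩
      refine ⟨⟨x, hx⟩, ?_, rfl⟩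
      have : p ⟨x, hx⟩ = y := Subtype.ext hyx.symm
      rw [mem_preimage, this]; exact hy
  have hpp : IsProperMap p := isProperMap_iff_isCompact_preimage.2 ⟨hpc, fun K hK => hcomp K hK⟩
  have hcov : IsCoveringMap p := by
    rw [isCoveringMap_iff_isCoveringMapOn_univ]
    refine hpp.isClosedMap.isCoveringMapOn_of_isLocalHomeomorphOn (fun y _ => ?_) ?_
    · refine (hcomp {y} isCompact_singleton).finite ?_
      refine (hlp.isLocalHomeomorphOn.mono (subset_univ (p ⁻¹' {y}))).isDiscrete_of_image ?_
      exact (subsingleton_singleton.anti (image_preimage_subset p {y})).isDiscrete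
    · rw [preimage_univ]; exact hlp.isLocalHomeomorphOn
  obtain ⟨G, ⟨hG0, hpG⟩, -⟩ := hcov.existsUnique_continuousMap_lifts (ContinuousMap.id D')
    (p ⟨0, hD.zero⟩) ⟨0, hD.zero⟩ rfl
  have hpG' : ∀ y, p (G y) = y := fun y => congrFun hpG y
  have hGp : (fun x => G (p x)) = id := by
    refine hcov.eq_of_comp_eq (G.continuous.comp hpc) continuous_id ?_ ⟨0, hD.zero⟩ hG0
    funext x; exact hpG' (p x)
  have hGp' : ∀ x, G (p x) = x := fun x => congrFun hGp x
  classical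
  set g : F → E := fun y => if h : y ∈ D' then (G ⟨y, h⟩ : E) else 0 with hg
  have hgv : ∀ y (h : y ∈ D'), g y = G ⟨y, h⟩ := fun y h => by simp only [hg, dif_pos h]
  have hmapg : MapsTo g D' D := fun y hy => by rw [hgv y hy]; exact (G _).2
  have hgf : ∀ x ∈ D, g (f x) = x := fun x hx => by
    rw [hgv _ (hmaps hx)]; exact congrArg Subtype.val (hGp' ⟨x, hx⟩)
  have hfg : ∀ y ∈ D', f (g y) = y := fun y hy => by
    rw [hgv y hy]; exact congrArg Subtype.val (hpG' ⟨y, hy⟩)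
  have hgc : ContinuousOn g D' := by
    rw [continuousOn_iff_continuous_domRestrict]
    have : D'.domRestrict g = fun y => (G y : E) := by
      funext y; exact hgv y y.2
    rw [this]; exact continuous_subtype_val.comp G.continuous
  refine ⟨⟨hmaps, fun x hx x' hx' h => ?_, fun y hy => ⟨g y, hmapg hy, hfg y hy⟩⟩, g, ?_, hmapg, hgf, hfg⟩
  · rw [← hgf x hx, h, hgf x' hx']
  · intro y hy
    obtain ⟨A, hA⟩ := hder (g y) (hmapg hy)
    have h1 : HasFDerivAt f (A : E →L[ℂ] F) (g y) := by
      rw [← hA]; exact (hf.differentiableAt (hD.isOpen.mem_nhds (hmapg hy))).hasFDerivAt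
    have h2 := HasFDerivAt.of_local_left_inverse (g := g) (a := y)
      (hgc.continuousAt (hD'.isOpen.mem_nhds hy)) h1
      (by filter_upwards [hD'.isOpen.mem_nhds hy] with y' hy' using hfg y' hy')
    exact h2.differentiableAt.differentiableWithinAt
end top

section main
variable {Z X Z' X' : Type*} [NormedAddCommGroup Z] [InnerProductSpace ℂ Z] [FiniteDimensional ℂ Z]
  [NormedAddCommGroup X] [InnerProductSpace ℂ X] [FiniteDimensional ℂ X]
  [NormedAddCommGroup Z'] [InnerProductSpace ℂ Z'] [FiniteDimensional ℂ Z']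
  [NormedAddCommGroup X'] [InnerProductSpace ℂ X'] [FiniteDimensional ℂ X']
  [Nontrivial X] [Nontrivial X']

theorem DD_main (hX : 1 < Module.finrank ℂ X) (T : (Z' × X') ≃L[ℂ] (Z × X)) {μ μ' : ℝ}
    (hμ : 0 < μ) (hμ' : 0 < μ') {f : Z × X → Z' × X'}
    (hf : DifferentiableOn ℂ f (DD Z X μ))
    (hmaps : MapsTo f (DD Z X μ) (DD Z' X' μ'))
    (hprop : ∀ K ⊆ DD Z' X' μ', IsCompact K → IsCompact (f ⁻¹' K ∩ DD Z X μ)) :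
    BijOn f (DD Z X μ) (DD Z' X' μ') ∧ ∃ g : Z' × X' → Z × X, DifferentiableOn ℂ g (DD Z' X' μ') ∧
      MapsTo g (DD Z' X' μ') (DD Z X μ) ∧
      (∀ x ∈ DD Z X μ, g (f x) = x) ∧ (∀ y ∈ DD Z' X' μ', f (g y) = y) := by
  refine proper_biholo (DD_CC hμ) (DD_CC hμ') hf hmaps hprop fun x hx => ?_
  have hdet := jac_ne_zero hX T hμ hμ' hf hmaps hprop x hx
  have h1 : fderiv ℂ (fun x => T (f x)) x = _ := T.comp_fderiv (f := f) (x := x)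
  rw [h1] at hdet
  refine ⟨(ContinuousLinearMap.toContinuousLinearEquivOfDetNeZero _ hdet).trans T.symm, ?_⟩
  refine ContinuousLinearMap.ext fun v => ?_
  simp
end main
end FBHProof
end

/-- Any proper holomorphic mapping between equidimensional Fock–Bargmann–Hartogs
domains `D_{n,m}(μ)` and `D_{n',m'}(μ')` with `m ≥ 2` is a biholomorphism. -/
theorem proper_holomorphic_is_biholomorphism
    (n m n' m' : ℕ) (hn : 0 < n) (hm : 0 < m) (hn' : 0 < n') (hm' : 0 < m')
    (hdim : n + m = n' + m') (μ μ' : ℝ) (hμ : 0 < μ) (hμ' : 0 < μ') (hm2 : 2 ≤ m)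
    (f : EuclideanSpace ℂ (Fin n) × EuclideanSpace ℂ (Fin m) →
      EuclideanSpace ℂ (Fin n') × EuclideanSpace ℂ (Fin m'))
    (hol : DifferentiableOn ℂ f (FBH n m μ))
    (hmaps : Set.MapsTo f (FBH n m μ) (FBH n' m' μ'))
    (hproper : ∀ K : Set (EuclideanSpace ℂ (Fin n') × EuclideanSpace ℂ (Fin m')),
      K ⊆ FBH n' m' μ' → IsCompact K → IsCompact (f ⁻¹' K ∩ FBH n m μ)) :
    Set.BijOn f (FBH n m μ) (FBH n' m' μ') ∧
    ∃ g : EuclideanSpace ℂ (Fin n') × EuclideanSpace ℂ (Fin m') →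
        EuclideanSpace ℂ (Fin n) × EuclideanSpace ℂ (Fin m),
      DifferentiableOn ℂ g (FBH n' m' μ') ∧
      Set.MapsTo g (FBH n' m' μ') (FBH n m μ) ∧
      (∀ x ∈ FBH n m μ, g (f x) = x) ∧
      (∀ y ∈ FBH n' m' μ', f (g y) = y) := by
  have hX : Module.finrank ℂ (EuclideanSpace ℂ (Fin m)) = m := finrank_euclideanSpace_fin
  have hX' : Module.finrank ℂ (EuclideanSpace ℂ (Fin m')) = m' := finrank_euclideanSpace_fin
  haveI : Nontrivial (EuclideanSpace ℂ (Fin m)) :=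
    Module.nontrivial_of_finrank_pos (R := ℂ) (by rw [hX]; exact hm)
  haveI : Nontrivial (EuclideanSpace ℂ (Fin m')) :=
    Module.nontrivial_of_finrank_pos (R := ℂ) (by rw [hX']; exact hm')
  have hT : Module.finrank ℂ (EuclideanSpace ℂ (Fin n') × EuclideanSpace ℂ (Fin m')) =
      Module.finrank ℂ (EuclideanSpace ℂ (Fin n) × EuclideanSpace ℂ (Fin m)) := by
    simp only [Module.finrank_prod, finrank_euclideanSpace_fin]
    exact hdim.symm
  exact FBHProof.DD_main (by rw [hX]; exact hm2) (ContinuousLinearEquiv.ofFinrankEq hT)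
    hμ hμ' hol hmaps hproper
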